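/- arXiv:math/0507163 — 4 statements merged into one kernel-verified Lean document; each statement's English description precedes it below -/
import Mathlib

section
/- Let n ≥ 1 and let (c_1,…,c_n) be nonnegative integers with c_1 + ⋯ + c_n = n−1. Then the divided symmetrization of the monomial λ_1^{c_1} ⋯ λ_n^{c_n} equals the rational constant ⟨λ_1^{c_1} ⋯ λ_n^{c_n}⟩ = (−1)^{|I_{c_1,…,c_n}|} · D_n(I_{c_1,…,c_n}). -/
open MvPolynomial

/-- The divided symmetrization `⟨f⟩ = Σ_{w ∈ S_{n+1}} w( f / ((λ_1-λ_2)⋯(λ_n-λ_{n+1})) )`,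
an element of the field of rational functions in `λ_1,…,λ_{n+1}` over `ℚ`. -/
noncomputable def divSym (n : ℕ) (f : MvPolynomial (Fin (n + 1)) ℚ) :
    FractionRing (MvPolynomial (Fin (n + 1)) ℚ) :=
  ∑ w : Equiv.Perm (Fin (n + 1)),
    algebraMap (MvPolynomial (Fin (n + 1)) ℚ) (FractionRing (MvPolynomial (Fin (n + 1)) ℚ))
        (rename (⇑w) f) /
      algebraMap (MvPolynomial (Fin (n + 1)) ℚ) (FractionRing (MvPolynomial (Fin (n + 1)) ℚ))
        (rename (⇑w) (∏ i : Fin n, (X i.castSucc - X i.succ)))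

/-- The set `I_{c_1,…,c_{n+1}} ⊆ {1,…,n}` (encoded as `Fin n`, with `i : Fin n`
representing the index `i+1`). -/
def Iset (n : ℕ) (c : Fin (n + 1) → ℕ) : Finset (Fin n) :=
  Finset.univ.filter fun i : Fin n =>
    (((List.ofFn c).flatMap fun k => List.replicate k (1 : ℤ) ++ [-1]).take
      (2 * (i : ℕ) + 1)).sum < 0

/-- `D_{n+1}(I)`: the number of permutations of `{1,…,n+1}` with descent set `I`. -/
def Dnum (n : ℕ) (I : Finset (Fin n)) : ℕ :=
  (Finset.univ.filter fun w : Equiv.Perm (Fin (n + 1)) =>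
    (Finset.univ.filter fun i : Fin n => w i.succ < w i.castSucc) = I).card


section LexExponent

variable {ι : Type*}

/-- The `a`-th standard basis vector in the lexicographically ordered group `ι → ℤ`. -/
def lexSingle [DecidableEq ι] (a : ι) : Lex (ι → ℤ) := toLex (Pi.single a 1)

/-- The `b`-th coordinate on the lexicographically ordered group `ι → ℤ`. -/
def lexCoord (b : ι) : Lex (ι → ℤ) →+ ℤ where
  toFun d := ofLex d b
  map_zero' := rfl
  map_add' _ _ := rfl

lemma lexCoord_lexSingle [DecidableEq ι] (a b : ι) : lexCoord b (lexSingle a) = if b = a then 1 else 0 :=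
  Pi.single_apply a 1 b

lemma lexCoord_ext {d d' : Lex (ι → ℤ)} (h : ∀ b, lexCoord b d = lexCoord b d') : d = d' :=
  ofLex.injective (funext h)

lemma lexSingle_lt [LinearOrder ι] {a b : ι} (h : a < b) : lexSingle b < lexSingle a := by
  refine ⟨a, fun j hj => ?_, ?_⟩
  · simp [lexSingle, hj.ne, (hj.trans h).ne]
  · simp [lexSingle, h.ne]

end LexExponent

section Geometric

variable {Γ : Type*} [AddCommGroup Γ] [LinearOrder Γ] [IsOrderedAddMonoid Γ]

/-- The geometric series `1 + x ^ g + x ^ (2 g) + ⋯` as a Hahn series, for `0 < g`. -/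
noncomputable def hahnGeom (g : Γ) (hg : 0 < g) : HahnSeries Γ ℚ :=
  open Classical in
  { coeff := fun d => if ∃ m : ℕ, d = m • g then 1 else 0
    isPWO_support' := by
      have hr : (Set.range fun m : ℕ => m • g).IsPWO := by
        rw [← Set.image_univ]
        exact (Set.isWF_univ_iff.2 inferInstance).isPWO.image_of_monotone
          (fun a b hab => nsmul_le_nsmul_left hg.le hab)
      refine hr.mono fun d hd => ?_
      by_contra hcon
      refine hd (if_neg ?_)
      rintro ⟨m, rfl⟩
      exact hcon ⟨m, rfl⟩ }

open Classical in
lemma hahnGeom_coeff (g : Γ) (hg : 0 < g) (d : Γ) :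
    (hahnGeom g hg).coeff d = if ∃ m : ℕ, d = m • g then 1 else 0 := rfl

lemma one_sub_single_mul_hahnGeom (g : Γ) (hg : 0 < g) :
    (1 - HahnSeries.single g (1 : ℚ)) * hahnGeom g hg = 1 := by
  classical
  ext d
  rw [sub_mul, one_mul, HahnSeries.coeff_sub, HahnSeries.coeff_single_mul, HahnSeries.coeff_one,
    hahnGeom_coeff, hahnGeom_coeff, one_mul]
  by_cases hd : d = 0
  · subst hd
    rw [if_pos ⟨0, by simp⟩, if_neg, if_pos rfl, sub_zero]
    rintro ⟨m, hm⟩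
    have : (m + 1) • g = 0 := by rw [succ_nsmul, ← hm]; abel
    have h2 := nsmul_pos hg (Nat.succ_ne_zero m)
    exact h2.ne' this
  · rw [if_neg hd, sub_eq_zero]
    congr 1
    rw [eq_iff_iff]
    constructor
    · rintro ⟨m, rfl⟩
      cases m with
      | zero => simp at hd
      | succ m => exact ⟨m, by rw [succ_nsmul]; abel⟩
    · rintro ⟨m, hm⟩
      exact ⟨m + 1, by rw [succ_nsmul, ← hm]; abel⟩

lemma coeff_mul_hahnGeom_eq_zero (F : HahnSeries Γ ℚ) (g : Γ) (hg : 0 < g) (d : Γ)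
    (h : ∀ m : ℕ, F.coeff (d - m • g) = 0) : (F * hahnGeom g hg).coeff d = 0 := by
  classical
  rw [HahnSeries.coeff_mul]
  refine Finset.sum_eq_zero fun p hp => ?_
  rw [Finset.mem_antidiagonal] at hp
  rw [hahnGeom_coeff]
  split_ifs with hm
  · obtain ⟨m, hm⟩ := hm
    rw [← h m, ← hm, ← hp.2.2]; simp
  · simp

lemma coeff_mul_hahnGeom (F : HahnSeries Γ ℚ) (g : Γ) (hg : 0 < g) (d : Γ) (k : ℕ)
    (h : ∀ m : ℕ, m ≠ k → F.coeff (d - m • g) = 0) :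
    (F * hahnGeom g hg).coeff d = F.coeff (d - k • g) := by
  classical
  rw [HahnSeries.coeff_mul, Finset.sum_eq_single (d - k • g, k • g)]
  · rw [hahnGeom_coeff, if_pos ⟨k, rfl⟩, mul_one]
  · intro p hp hne
    rw [Finset.mem_antidiagonal] at hp
    rw [hahnGeom_coeff]
    split_ifs with hm
    · obtain ⟨m, hm⟩ := hm
      have h1 : p.1 = d - m • g := by rw [← hm, ← hp.2.2]; simp
      rw [h1, h m, zero_mul]
      rintro rfl
      exact hne (Prod.ext h1 hm)
    · simp
  · intro hp
    have h2 : (hahnGeom g hg).coeff (k • g) ≠ 0 := by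
      rw [hahnGeom_coeff, if_pos ⟨k, rfl⟩]; exact one_ne_zero
    by_contra hcon
    apply hp
    rw [Finset.mem_antidiagonal]
    exact ⟨left_ne_zero_of_mul hcon, h2, by simp⟩

end Geometric

lemma eq_zero_of_antisymmetric {n : ℕ} (W : MvPolynomial (Fin (n + 1)) ℚ)
    (hW : ∀ u : Equiv.Perm (Fin (n + 1)), rename u W = C ((Equiv.Perm.sign u : ℤ) : ℚ) * W)
    (hdeg : W.totalDegree ≤ ∑ i : Fin (n + 1), (i : ℕ))
    (h0 : W.coeff (Finsupp.equivFunOnFinite.symm fun i : Fin (n + 1) => (i : ℕ)) = 0) : W = 0 := by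
  ext m
  rw [coeff_zero]
  have hperm : ∀ u : Equiv.Perm (Fin (n + 1)),
      W.coeff m = ((Equiv.Perm.sign u : ℤ) : ℚ) * W.coeff (m.mapDomain u) := by
    intro u
    rw [← coeff_C_mul, ← hW, coeff_rename_mapDomain _ u.injective]
  by_contra hm
  have hinj : Function.Injective m := by
    intro i j hij
    by_contra hne
    apply hm
    have h1 := hperm (Equiv.swap i j)
    have h2 : m.mapDomain (Equiv.swap i j) = m := by
      ext k
      rw [← Finsupp.equivMapDomain_eq_mapDomain, Finsupp.equivMapDomain_apply, Equiv.symm_swap]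
      rcases eq_or_ne k i with rfl | hki
      · simp [hij]
      rcases eq_or_ne k j with rfl | hkj
      · simp [hij]
      rw [Equiv.swap_apply_of_ne_of_ne hki hkj]
    rw [h2, Equiv.Perm.sign_swap hne] at h1
    push_cast at h1
    linarith
  have hsm : StrictMono (m ∘ Tuple.sort m) :=
    (Tuple.monotone_sort m).strictMono_of_injective (hinj.comp (Equiv.injective _))
  have hge : ∀ k, ∀ i : Fin (n + 1), (i : ℕ) = k → k ≤ m (Tuple.sort m i) := by
    intro k
    induction k with
    | zero => intros; exact Nat.zero_le _
    | succ k ih =>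
      intro i hi
      have h1 := ih ⟨k, by omega⟩ rfl
      have h2 : (⟨k, by omega⟩ : Fin (n + 1)) < i := by rw [Fin.lt_def]; simp [hi]
      have := hsm h2
      simp only [Function.comp] at this
      omega
  have hsum : ∑ i, m (Tuple.sort m i) ≤ ∑ i : Fin (n + 1), (i : ℕ) := by
    rw [Equiv.sum_comp (Tuple.sort m) m]
    refine le_trans ?_ hdeg
    have := le_totalDegree (mem_support_iff.2 hm)
    rwa [Finsupp.sum_fintype _ _ (fun _ => rfl)] at this
  have heq := (Finset.sum_eq_sum_iff_of_le (fun i _ => hge _ i rfl)).1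
    (le_antisymm (Finset.sum_le_sum (fun i _ => hge _ i rfl)) hsum)
  apply hm
  rw [hperm (Tuple.sort m).symm, mul_eq_zero]
  right
  rw [← h0]
  congr 1
  ext i
  rw [← Finsupp.equivMapDomain_eq_mapDomain, Finsupp.equivMapDomain_apply]
  simpa using (heq i (Finset.mem_univ _)).symm

lemma rename_det_vandermonde {n : ℕ} (u : Equiv.Perm (Fin n)) :
    rename u (Matrix.vandermonde (X : Fin n → MvPolynomial (Fin n) ℚ)).det =
      C ((Equiv.Perm.sign u : ℤ) : ℚ) *
        (Matrix.vandermonde (X : Fin n → MvPolynomial (Fin n) ℚ)).det := by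
  have h := Matrix.det_permute u (Matrix.vandermonde (X : Fin n → MvPolynomial (Fin n) ℚ))
  rw [AlgHom.map_det]
  convert h using 2
  · ext i j; simp [Matrix.vandermonde_apply]
  · simp

lemma totalDegree_det_vandermonde_le (n : ℕ) :
    (Matrix.vandermonde (X : Fin n → MvPolynomial (Fin n) ℚ)).det.totalDegree ≤
      ∑ i : Fin n, (i : ℕ) := by
  rw [Matrix.det_apply]
  refine totalDegree_finsetSum_le fun u _ => ?_
  refine (totalDegree_smul_le _ _).trans ((totalDegree_finsetProd _ _).trans ?_)
  refine Finset.sum_le_sum fun i _ => ?_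
  rw [Matrix.vandermonde_apply, totalDegree_X_pow]

lemma prod_X_sub_X_dvd_det_vandermonde (n : ℕ) :
    (∏ i : Fin n, (X i.castSucc - X i.succ) : MvPolynomial (Fin (n + 1)) ℚ) ∣
      (Matrix.vandermonde (X : Fin (n + 1) → MvPolynomial (Fin (n + 1)) ℚ)).det := by
  rw [Matrix.det_vandermonde, Fin.prod_univ_castSucc]
  refine Dvd.dvd.mul_right (Finset.prod_dvd_prod_of_dvd _ _ fun i _ => ?_) _
  rw [← dvd_neg, ← neg_sub, neg_dvd, dvd_neg]
  exact Finset.dvd_prod_of_mem _ (Finset.mem_Ioi.2 i.castSucc_lt_succ)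

section PathExpansion

variable {ι : Type*} [LinearOrder ι] [Fintype ι]

/-- The Hahn series variable attached to `a : ι`, in exponents ordered lexicographically. -/
noncomputable def hahnVar (a : ι) : HahnSeries (Lex (ι → ℤ)) ℚ :=
  HahnSeries.single (lexSingle a) 1

lemma inv_sub_comm {K : Type*} [Field K] (x y : K) : (x - y)⁻¹ = -(y - x)⁻¹ := by
  rw [← neg_sub, inv_neg]

lemma inv_single_sub_single {Γ : Type*} [AddCommGroup Γ] [LinearOrder Γ] [IsOrderedAddMonoid Γ]
    {s t : Γ} (h : 0 < t - s) :
    (HahnSeries.single s (1 : ℚ) - HahnSeries.single t 1)⁻¹ =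
      HahnSeries.single (-s) 1 * hahnGeom (t - s) h := by
  refine DivisionMonoid.inv_eq_of_mul _ _ ?_
  have h1 : HahnSeries.single s (1 : ℚ) - HahnSeries.single t 1 =
      HahnSeries.single s 1 * (1 - HahnSeries.single (t - s) 1) := by
    rw [mul_sub, HahnSeries.single_mul_single]; simp
  have h2 : HahnSeries.single s (1 : ℚ) * HahnSeries.single (-s) 1 = 1 := by
    rw [HahnSeries.single_mul_single]; simp
  rw [h1, mul_mul_mul_comm, h2, one_sub_single_mul_hahnGeom, one_mul]

/-- The coefficient of the expansion of `1 / (x_a - x_b)` at `x_a ^ (-t - 1) * x_b ^ t`. -/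
def edgeCoeff (a b : ι) (t : ℤ) : ℚ :=
  if b < a then (if 0 ≤ t then 1 else 0) else (if t < 0 then -1 else 0)

lemma coeff_mul_inv_hahnVar_sub (F : HahnSeries (Lex (ι → ℤ)) ℚ) {a b : ι} (hab : a ≠ b)
    (hF : ∀ d, F.coeff d ≠ 0 → lexCoord b d = 0) (d : Lex (ι → ℤ)) :
    (F * (hahnVar a - hahnVar b)⁻¹).coeff d = edgeCoeff a b (lexCoord b d) *
      F.coeff (d - (lexCoord b d) • lexSingle b
        + (lexCoord b d + 1) • lexSingle a) := by
  have hF' : ∀ d, lexCoord b d ≠ 0 → F.coeff d = 0 := fun d hd => by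
    by_contra hc
    exact hd (hF d hc)
  unfold edgeCoeff
  split_ifs with hba ht ht
  · have hg := sub_pos.2 (lexSingle_lt hba)
    obtain ⟨k, hk⟩ := Int.eq_ofNat_of_zero_le ht
    rw [hahnVar, hahnVar, inv_single_sub_single hg, ← mul_assoc,
      coeff_mul_hahnGeom _ _ _ _ k, HahnSeries.coeff_mul_single, mul_one, one_mul, hk]
    · congr 1
      simp only [natCast_zsmul, add_smul, one_smul, nsmul_sub]
      abel
    · intro m hm
      rw [HahnSeries.coeff_mul_single, hF', zero_mul]
      simp [-zsmul_eq_mul, -nsmul_eq_mul, lexCoord_lexSingle, hab.symm, hk]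
      omega
  · have hg := sub_pos.2 (lexSingle_lt hba)
    rw [hahnVar, hahnVar, inv_single_sub_single hg, ← mul_assoc, zero_mul]
    refine coeff_mul_hahnGeom_eq_zero _ _ _ _ fun m => ?_
    rw [HahnSeries.coeff_mul_single, hF', zero_mul]
    simp [-zsmul_eq_mul, -nsmul_eq_mul, lexCoord_lexSingle, hab.symm]
    omega
  · have hg := sub_pos.2 (lexSingle_lt (lt_of_le_of_ne (not_lt.1 hba) hab))
    obtain ⟨k, hk⟩ := Int.eq_ofNat_of_zero_le (show 0 ≤ - lexCoord b d - 1 by omega)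
    have hk' : lexCoord b d = - (k : ℤ) - 1 := by omega
    rw [inv_sub_comm, mul_neg, HahnSeries.coeff_neg, hahnVar, hahnVar,
      inv_single_sub_single hg, ← mul_assoc,
      coeff_mul_hahnGeom _ _ _ _ k, HahnSeries.coeff_mul_single, mul_one, neg_one_mul, hk']
    · congr 2
      simp only [natCast_zsmul, add_smul, sub_smul, neg_smul, one_smul, nsmul_sub]
      abel
    · intro m hm
      rw [HahnSeries.coeff_mul_single, hF', zero_mul]
      simp [-zsmul_eq_mul, -nsmul_eq_mul, lexCoord_lexSingle, hab.symm, hk']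
      omega
  · have hg := sub_pos.2 (lexSingle_lt (lt_of_le_of_ne (not_lt.1 hba) hab))
    rw [inv_sub_comm, mul_neg, HahnSeries.coeff_neg, hahnVar, hahnVar,
      inv_single_sub_single hg, ← mul_assoc, zero_mul, neg_eq_zero]
    refine coeff_mul_hahnGeom_eq_zero _ _ _ _ fun m => ?_
    rw [HahnSeries.coeff_mul_single, hF', zero_mul]
    simp [-zsmul_eq_mul, -nsmul_eq_mul, lexCoord_lexSingle, hab.symm]
    omega

/-- The Hahn series expansion of `∏ 1 / (x_{v i} - x_{v (i + 1)})` along the path `v`. -/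
noncomputable def pathSeries (v : ℕ → ι) (k : ℕ) : HahnSeries (Lex (ι → ℤ)) ℚ :=
  ∏ i ∈ Finset.range k, (hahnVar (v i) - hahnVar (v (i + 1)))⁻¹

lemma eq_zero_of_pathSeries_coeff_ne_zero (v : ℕ → ι) (k : ℕ) (hv : Set.InjOn v (Set.Iic k))
    (d : Lex (ι → ℤ)) (hd : (pathSeries v k).coeff d ≠ 0) (b : ι) (hb : ∀ i ≤ k, v i ≠ b) :
    lexCoord b d = 0 := by
  induction k generalizing d b with
  | zero =>
    rw [pathSeries, Finset.prod_range_zero, HahnSeries.coeff_one] at hd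
    have : d = 0 := by
      by_contra h
      exact hd (if_neg h)
    rw [this, map_zero]
  | succ k ih =>
    have ih' := ih (hv.mono (Set.Iic_subset_Iic.2 k.le_succ))
    rw [pathSeries, Finset.prod_range_succ, ← pathSeries, coeff_mul_inv_hahnVar_sub] at hd
    · have := ih' _ (right_ne_zero_of_mul hd) b fun i hi => hb i (by omega)
      simpa [-zsmul_eq_mul, lexCoord_lexSingle, (hb k (by omega)).symm, (hb (k + 1) le_rfl).symm] using this
    · intro h
      have := hv (Set.mem_Iic.2 (by omega)) (Set.mem_Iic.2 le_rfl) h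
      omega
    · refine fun d hd => ih' d hd _ fun i hi h => ?_
      have := hv (Set.mem_Iic.2 (by omega)) (Set.mem_Iic.2 le_rfl) h
      omega

lemma pathSeries_coeff (v : ℕ → ι) (k : ℕ) (hv : Set.InjOn v (Set.Iic k))
    (d : Lex (ι → ℤ)) (hd : ∀ b, (∀ i ≤ k, v i ≠ b) → lexCoord b d = 0)
    (hsum : ∑ j ∈ Finset.range (k + 1), lexCoord (v j) d = -k) :
    (pathSeries v k).coeff d = ∏ i ∈ Finset.range k, edgeCoeff (v i) (v (i + 1))
      (-(∑ j ∈ Finset.range (i + 1), lexCoord (v j) d) - i - 1) := by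
  induction k generalizing d with
  | zero =>
    have : d = 0 := by
      refine lexCoord_ext fun b => ?_
      rw [map_zero]
      by_cases hb : v 0 = b
      · subst hb; simpa using hsum
      · exact hd b fun i hi => by rwa [Nat.le_zero.1 hi]
    simp [pathSeries, this]
  | succ k ih =>
    have hne : ∀ i ≤ k, v i ≠ v (k + 1) := fun i hi h => by
      have := hv (Set.mem_Iic.2 (by omega)) (Set.mem_Iic.2 le_rfl) h
      omega
    have hne' : ∀ i < k, v i ≠ v k := fun i hi h => by
      have := hv (Set.mem_Iic.2 (by omega)) (Set.mem_Iic.2 (by omega)) h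
      omega
    have hv' := hv.mono (Set.Iic_subset_Iic.2 k.le_succ)
    rw [pathSeries, Finset.prod_range_succ, ← pathSeries, coeff_mul_inv_hahnVar_sub _ (hne k le_rfl),
      Finset.prod_range_succ, mul_comm]
    · have hpart : ∀ i ≤ k, ∑ j ∈ Finset.range i, lexCoord (v j) (d
          - lexCoord (v (k + 1)) d • lexSingle (v (k + 1))
          + (lexCoord (v (k + 1)) d + 1) • lexSingle (v k)) =
          ∑ j ∈ Finset.range i, lexCoord (v j) d := fun i hi =>
        Finset.sum_congr rfl fun j hj => by
          have hj := Finset.mem_range.1 hj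
          simp [-zsmul_eq_mul, -nsmul_eq_mul, lexCoord_lexSingle, hne j (by omega), hne' j (by omega)]
      rw [ih hv']
      · congr 1
        · refine Finset.prod_congr rfl fun i hi => ?_
          rw [hpart _ (Finset.mem_range.1 hi)]
        · congr 1
          rw [Finset.sum_range_succ] at hsum
          push_cast at hsum
          linarith
      · intro b hb
        by_cases hbk : v (k + 1) = b
        · subst hbk
          simp [-zsmul_eq_mul, -nsmul_eq_mul, lexCoord_lexSingle, (hne k le_rfl).symm]
        · have := hd b fun i hi => by
            rcases Nat.le_succ_iff.1 hi with h | rfl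
            exacts [hb i h, hbk]
          simp [-zsmul_eq_mul, -nsmul_eq_mul, lexCoord_lexSingle, this, (hb k le_rfl).symm, Ne.symm hbk]
      · rw [Finset.sum_range_succ, hpart k le_rfl]
        rw [Finset.sum_range_succ, Finset.sum_range_succ] at hsum
        push_cast at hsum
        simp [-zsmul_eq_mul, -nsmul_eq_mul, lexCoord_lexSingle, hne k le_rfl]
        linarith
    · exact fun d hd => eq_zero_of_pathSeries_coeff_ne_zero v k hv' d hd _ hne

end PathExpansion

lemma exists_sum_div_eq_const {n : ℕ} (f : MvPolynomial (Fin (n + 1)) ℚ)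
    (hf : f.totalDegree ≤ n) :
    ∃ K : ℚ, ∀ (L : Type) [Field L] (ψ : MvPolynomial (Fin (n + 1)) ℚ →+* L),
      Function.Injective (fun i => ψ (X i)) →
      ∑ w : Equiv.Perm (Fin (n + 1)), ψ (rename w f) /
        ψ (rename w (∏ i : Fin n, (X i.castSucc - X i.succ))) = ψ (C K) := by
  set E : MvPolynomial (Fin (n + 1)) ℚ := ∏ i : Fin n, (X i.castSucc - X i.succ) with hE
  set V := (Matrix.vandermonde (X : Fin (n + 1) → MvPolynomial (Fin (n + 1)) ℚ)).det with hV
  obtain ⟨q, hq⟩ : E ∣ V := prod_X_sub_X_dvd_det_vandermonde n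
  have hV0 : V ≠ 0 := Matrix.det_vandermonde_ne_zero_iff.2 (X_injective)
  have hE0 : E ≠ 0 := by rintro h; rw [h, zero_mul] at hq; exact hV0 hq
  have hq0 : q ≠ 0 := by rintro h; rw [h, mul_zero] at hq; exact hV0 hq
  have hVdeg : V.totalDegree ≤ ∑ i : Fin (n + 1), (i : ℕ) := totalDegree_det_vandermonde_le _
  have hEdeg : E.totalDegree = n := by
    have : E.IsHomogeneous (∑ _i : Fin n, 1) :=
      IsHomogeneous.prod _ _ _ fun i _ => (isHomogeneous_X _ _).sub (isHomogeneous_X _ _)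
    simpa using this.totalDegree hE0
  set P := ∑ w : Equiv.Perm (Fin (n + 1)),
    C ((Equiv.Perm.sign w : ℤ) : ℚ) * rename w (f * q) with hP
  have hPanti : ∀ u : Equiv.Perm (Fin (n + 1)),
      rename u P = C ((Equiv.Perm.sign u : ℤ) : ℚ) * P := by
    intro u
    rw [hP, map_sum, Finset.mul_sum, ← Equiv.sum_comp (Equiv.mulLeft u)
      (fun w => C ((Equiv.Perm.sign u : ℤ) : ℚ) *
        (C ((Equiv.Perm.sign w : ℤ) : ℚ) * rename w (f * q)))]
    refine Finset.sum_congr rfl fun w _ => ?_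
    rw [map_mul, rename_C, rename_rename, Equiv.coe_mulLeft, ← mul_assoc, ← C_mul,
      Equiv.Perm.sign_mul, Equiv.Perm.coe_mul]
    rcases Int.units_eq_one_or (Equiv.Perm.sign u) with h | h <;> simp [h]
  have hPdeg : P.totalDegree ≤ ∑ i : Fin (n + 1), (i : ℕ) := by
    refine totalDegree_finsetSum_le fun w _ => ?_
    refine (totalDegree_mul _ _).trans ?_
    rw [totalDegree_C, zero_add]
    refine (totalDegree_rename_le _ _).trans ((totalDegree_mul _ _).trans ?_)
    have h1 := totalDegree_mul_of_isDomain hE0 hq0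
    rw [← hq] at h1
    omega
  have hVanti := fun u : Equiv.Perm (Fin (n + 1)) => rename_det_vandermonde u
  rw [← hV] at hVanti
  set δ : Fin (n + 1) →₀ ℕ := Finsupp.equivFunOnFinite.symm fun i : Fin (n + 1) => (i : ℕ) with hδ
  have hcV : V.coeff δ ≠ 0 := fun h => hV0 (eq_zero_of_antisymmetric V hVanti hVdeg h)
  refine ⟨P.coeff δ / V.coeff δ, fun L _ ψ hψ => ?_⟩
  set K := P.coeff δ / V.coeff δ with hK
  have hPV : P = C K * V := by
    rw [← sub_eq_zero]
    refine eq_zero_of_antisymmetric _ (fun u => ?_) ?_ ?_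
    · rw [map_sub, map_mul, rename_C, hPanti, hVanti]; ring
    · refine (totalDegree_sub _ _).trans (max_le hPdeg ((totalDegree_mul _ _).trans ?_))
      rwa [totalDegree_C, zero_add]
    · rw [coeff_sub, coeff_C_mul, ← hδ, hK, div_mul_cancel₀ _ hcV, sub_self]
  have hψV : ψ V ≠ 0 := by
    have : ψ V = (Matrix.vandermonde fun i => ψ (X i)).det := by
      rw [hV, RingHom.map_det]
      congr 1
      ext i j
      simp [Matrix.vandermonde_apply]
    rw [this]
    exact Matrix.det_vandermonde_ne_zero_iff.2 hψ
  have hterm : ∀ w : Equiv.Perm (Fin (n + 1)), ψ (rename w f) / ψ (rename w E) =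
      ψ (C ((Equiv.Perm.sign w : ℤ) : ℚ) * rename w (f * q)) / ψ V := by
    intro w
    have h1 : ψ (rename w E) * ψ (rename w q) = ψ (C ((Equiv.Perm.sign w : ℤ) : ℚ)) * ψ V := by
      rw [← map_mul, ← map_mul, ← hq, hVanti, map_mul]
    have h2 : ψ (C ((Equiv.Perm.sign w : ℤ) : ℚ)) * ψ (C ((Equiv.Perm.sign w : ℤ) : ℚ)) = 1 := by
      rw [← map_mul, ← C_mul]
      rcases Int.units_eq_one_or (Equiv.Perm.sign w) with h | h <;> simp [h]
    have h3 : ψ (rename w E) ≠ 0 := by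
      intro h0
      rw [h0, zero_mul] at h1
      exact mul_ne_zero (left_ne_zero_of_mul_eq_one h2) hψV h1.symm
    rw [div_eq_div_iff h3 hψV, map_mul, map_mul, map_mul]
    linear_combination (-ψ (C ((Equiv.Perm.sign w : ℤ) : ℚ)) * ψ (rename w f)) * h1 - ψ (rename w f) * ψ V * h2
  rw [Finset.sum_congr rfl fun w _ => hterm w, ← Finset.sum_div, ← map_sum, ← hP, hPV, map_mul,
    mul_div_cancel_right₀ _ hψV]

section BallotWord

lemma length_flatMap_replicate (l : List ℕ) :
    (l.flatMap fun k => List.replicate k (1 : ℤ) ++ [-1]).length = l.sum + l.length := by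
  induction l with
  | nil => rfl
  | cons a l ih =>
    rw [List.flatMap_cons, List.length_append, ih]
    simp
    ring

lemma sum_flatMap_replicate (l : List ℕ) :
    (l.flatMap fun k => List.replicate k (1 : ℤ) ++ [-1]).sum =
      ((l.sum : ℕ) : ℤ) - l.length := by
  induction l with
  | nil => rfl
  | cons a l ih =>
    rw [List.flatMap_cons, List.sum_append, ih]
    simp
    ring

lemma le_one_of_mem_flatMap_replicate {l : List ℕ} {x : ℤ}
    (hx : x ∈ l.flatMap fun k => List.replicate k (1 : ℤ) ++ [-1]) : x ≤ 1 := by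
  obtain ⟨k, -, hk⟩ := List.mem_flatMap.1 hx
  rcases List.mem_append.1 hk with h | h
  · exact (List.eq_of_mem_replicate h).le
  · rw [List.mem_singleton.1 h]; norm_num

lemma sum_take_flatMap_replicate_neg_iff (l : List ℕ) (i : ℕ) (hi : i < l.length) :
    ((l.flatMap fun k => List.replicate k (1 : ℤ) ++ [-1]).take (2 * i + 1)).sum < 0 ↔
      (l.take (i + 1)).sum ≤ i := by
  have hbound : ∀ L : List ℤ, (∀ x ∈ L, x ≤ 1) → L.sum ≤ L.length := fun L hL => by
    simpa using List.sum_le_card_nsmul L 1 hL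
  have hlen : (l.take (i + 1)).length = i + 1 := by rw [List.length_take]; omega
  set E : List ℕ → List ℤ := fun l => l.flatMap fun k => List.replicate k (1 : ℤ) ++ [-1] with hE
  have hsplit : E l = E (l.take (i + 1)) ++ E (l.drop (i + 1)) := by
    rw [hE]
    simp only
    rw [← List.flatMap_append, List.take_append_drop]
  have hElen : (E (l.take (i + 1))).length = (l.take (i + 1)).sum + (i + 1) := by
    simpa only [hlen] using length_flatMap_replicate (l.take (i + 1))
  have hEsum : (E (l.take (i + 1))).sum =
      (((l.take (i + 1)).sum : ℕ) : ℤ) - (i + 1 : ℕ) := by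
    simpa only [hlen] using sum_flatMap_replicate (l.take (i + 1))
  change ((E l).take (2 * i + 1)).sum < 0 ↔ _
  rw [hsplit]
  constructor
  · intro h
    by_contra! hC
    refine absurd h (not_lt.2 ?_)
    obtain ⟨A, hA⟩ : ∃ A, E (l.take (i + 1)) = A ++ [-1] := by
      refine ⟨E (l.take i) ++ List.replicate l[i] 1, ?_⟩
      rw [← List.take_concat_get' l i hi, List.append_assoc]
      simp only [hE, List.flatMap_append, List.flatMap_singleton]
    have hA1 : ∀ x ∈ A, x ≤ 1 := fun x hx =>
      le_one_of_mem_flatMap_replicate (l := l.take (i + 1))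
        (show x ∈ E (l.take (i + 1)) from hA ▸ List.mem_append_left _ hx)
    rw [hA] at hElen hEsum ⊢
    rw [List.length_append, List.length_singleton] at hElen
    rw [List.sum_append, List.sum_singleton] at hEsum
    rw [List.append_assoc, List.take_append_of_le_length (by omega)]
    have h1 := hbound (A.drop (2 * i + 1)) fun x hx => hA1 x (List.mem_of_mem_drop hx)
    have h2 := congrArg List.sum (List.take_append_drop (2 * i + 1) A)
    rw [List.sum_append] at h2
    rw [List.length_drop] at h1
    omega
  · intro hC
    rw [List.take_append, List.take_of_length_le (by omega), List.sum_append, hEsum]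
    have h1 := hbound ((E (l.drop (i + 1))).take (2 * i + 1 - (E (l.take (i + 1))).length))
      fun x hx => le_one_of_mem_flatMap_replicate (List.mem_of_mem_take hx)
    have h2 := List.length_take_le (2 * i + 1 - (E (l.take (i + 1))).length) (E (l.drop (i + 1)))
    omega

lemma mem_Iset_iff (n : ℕ) (c : Fin (n + 1) → ℕ) (i : Fin n) :
    i ∈ Iset n c ↔ ∑ j ∈ Finset.range (i + 1), c (Fin.ofNat (n + 1) j) ≤ i := by
  rw [Iset, Finset.mem_filter_univ,
    sum_take_flatMap_replicate_neg_iff _ _ (by rw [List.length_ofFn]; omega)]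
  have h : ∀ k ≤ n + 1, ((List.ofFn c).take k).sum =
      ∑ j ∈ Finset.range k, c (Fin.ofNat (n + 1) j) := by
    intro k hk
    induction k with
    | zero => simp
    | succ k ih =>
      rw [List.sum_take_succ _ _ (by simpa using hk), ih (by omega), Finset.sum_range_succ]
      congr 1
      rw [List.getElem_ofFn]
      congr 1
      ext
      simp [Nat.mod_eq_of_lt (show k < n + 1 by omega)]
  rw [h _ (by omega)]

end BallotWord

lemma coeff_zero_term (n : ℕ) (c : Fin (n + 1) → ℕ) (hc : ∑ i, c i = n)
    (w : Equiv.Perm (Fin (n + 1))) :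
    ((aeval (fun i : Fin (n + 1) => hahnVar i.rev) (rename w (∏ i, X i ^ c i) :
        MvPolynomial (Fin (n + 1)) ℚ)) /
      aeval (fun i : Fin (n + 1) => hahnVar i.rev)
        (rename w (∏ i : Fin n, (X i.castSucc - X i.succ)) : MvPolynomial (Fin (n + 1)) ℚ)).coeff 0
      = if (Finset.univ.filter fun i : Fin n => w i.succ < w i.castSucc) = Iset n c then
        (-1) ^ (Iset n c).card else 0 := by
  set v : ℕ → Fin (n + 1) := fun j => (w (Fin.ofNat (n + 1) j)).rev with hv
  have hcast : ∀ i : Fin n, Fin.ofNat (n + 1) i = i.castSucc := fun i => by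
    ext; simp
  have hsucc : ∀ i : Fin n, Fin.ofNat (n + 1) (i + 1) = i.succ := fun i => by
    ext; simp [Nat.mod_eq_of_lt (show (i : ℕ) + 1 < n + 1 by omega)]
  have hval : ∀ i : Fin (n + 1), Fin.ofNat (n + 1) i = i := fun i => by
    ext; simp
  have hvinj : Set.InjOn v (Set.Iic n) := by
    intro i hi j hj hij
    rw [Set.mem_Iic] at hi hj
    have := congrArg Fin.val (w.injective (Fin.rev_injective hij))
    simpa [Nat.mod_eq_of_lt (show i < n + 1 by omega),
      Nat.mod_eq_of_lt (show j < n + 1 by omega)] using this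
  have hvar : ∀ (a : Fin (n + 1)) (k : ℕ), hahnVar a ^ k = HahnSeries.single (k • lexSingle a) 1 := by
    intro a k
    rw [hahnVar, HahnSeries.single_pow, one_pow]
  have hprod : ∀ s : Finset (Fin (n + 1)), ∏ i ∈ s, HahnSeries.single (c i • lexSingle (w i).rev) (1 : ℚ) =
      HahnSeries.single (∑ i ∈ s, c i • lexSingle (w i).rev) 1 := by
    intro s
    induction s using Finset.induction_on with
    | empty => simp
    | insert a s ha ih =>
      rw [Finset.prod_insert ha, Finset.sum_insert ha, ih, HahnSeries.single_mul_single, one_mul]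
  have hnum : aeval (fun i : Fin (n + 1) => hahnVar i.rev) (rename w (∏ i, X i ^ c i) :
        MvPolynomial (Fin (n + 1)) ℚ) =
      HahnSeries.single (∑ i, c i • lexSingle (w i).rev) 1 := by
    rw [← hprod]
    simp only [map_prod, map_pow, rename_X, aeval_X, hvar]
  have hden : (aeval (fun i : Fin (n + 1) => hahnVar i.rev)
        (rename w (∏ i : Fin n, (X i.castSucc - X i.succ)) : MvPolynomial (Fin (n + 1)) ℚ))⁻¹ =
      pathSeries v n := by
    simp only [map_prod, map_sub, rename_X, aeval_X]
    rw [pathSeries, Finset.prod_range, Finset.prod_inv_distrib]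
    simp only [hv, hcast, hsucc]
  have hd : ∀ j, lexCoord (v j) (0 - ∑ i, c i • lexSingle (w i).rev) =
      -(c (Fin.ofNat (n + 1) j) : ℤ) := by
    intro j
    rw [map_sub, map_zero, zero_sub, map_sum, Finset.sum_eq_single (Fin.ofNat (n + 1) j)]
    · rw [map_nsmul, lexCoord_lexSingle, if_pos rfl, nsmul_eq_mul, mul_one]
    · intro i _ hi
      rw [map_nsmul, lexCoord_lexSingle, if_neg, smul_zero]
      exact fun h => hi (w.injective (Fin.rev_injective h)).symm
    · simp
  rw [div_eq_mul_inv, hnum, hden, HahnSeries.coeff_single_mul, one_mul, pathSeries_coeff v n hvinj,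
    Finset.prod_range]
  · have hfac : ∀ i : Fin n, edgeCoeff (v i) (v (i + 1)) (-(∑ j ∈ Finset.range ((i : ℕ) + 1),
        lexCoord (v j) (0 - ∑ i, c i • lexSingle (w i).rev)) - (i : ℕ) - 1) =
        if i ∈ (Finset.univ.filter fun i : Fin n => w i.succ < w i.castSucc) then
          (if i ∈ Iset n c then -1 else 0) else (if i ∈ Iset n c then 0 else 1) := by
      intro i
      have hI := mem_Iset_iff n c i
      rw [Finset.sum_congr rfl fun j _ => hd j, Finset.sum_neg_distrib, neg_neg, edgeCoeff,
        ← Nat.cast_sum]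
      simp only [hv, hcast, hsucc, Fin.rev_lt_rev, Finset.mem_filter_univ]
      have hne : w i.castSucc ≠ w i.succ := fun h => (Fin.castSucc_lt_succ (i := i)).ne (w.injective h)
      rcases lt_or_gt_of_ne hne with h | h
      · rw [if_pos h, if_neg h.not_gt]
        by_cases hi : i ∈ Iset n c
        · rw [if_pos hi, if_neg]; have := hI.1 hi; omega
        · rw [if_neg hi, if_pos]; have := mt hI.2 hi; omega
      · rw [if_neg h.not_gt, if_pos h]
        by_cases hi : i ∈ Iset n c
        · rw [if_pos hi, if_pos]; have := hI.1 hi; omega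
        · rw [if_neg hi, if_neg]; have := mt hI.2 hi; omega
    rw [Finset.prod_congr rfl fun i _ => hfac i]
    split_ifs with hD
    · rw [hD, ← Finset.prod_const, ← Finset.prod_filter_mul_prod_filter_not Finset.univ (· ∈ Iset n c)]
      rw [Finset.filter_univ_mem]
      have h1 : ∀ i ∈ Iset n c, (if i ∈ Iset n c then (if i ∈ Iset n c then (-1 : ℚ) else 0) else
          (if i ∈ Iset n c then 0 else 1)) = -1 := fun i hi => by simp [hi]
      have h2 : ∀ i ∈ Finset.univ.filter (fun i => i ∉ Iset n c),
          (if i ∈ Iset n c then (if i ∈ Iset n c then (-1 : ℚ) else 0) else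
          (if i ∈ Iset n c then 0 else 1)) = 1 := fun i hi => by
        simp [(Finset.mem_filter.1 hi).2]
      rw [Finset.prod_congr rfl h1, Finset.prod_congr rfl h2, Finset.prod_const_one, mul_one]
    · obtain ⟨i, hi⟩ := not_forall.1 (mt Finset.ext hD)
      refine Finset.prod_eq_zero (Finset.mem_univ i) ?_
      by_cases h : i ∈ Iset n c <;> simp_all
  · intro b hb
    refine absurd ?_ (hb (w.symm b.rev) (Nat.le_of_lt_succ (Fin.is_lt _)))
    simp only [hv, hval, Equiv.apply_symm_apply, Fin.rev_rev]
  · rw [Finset.sum_congr rfl fun j _ => hd j, Finset.sum_neg_distrib, ← Nat.cast_sum,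
      Finset.sum_range]
    simp only [hval, hc]

theorem stmt3 (n : ℕ) (c : Fin (n + 1) → ℕ) (hc : ∑ i, c i = n) :
    divSym n (∏ i, X i ^ c i) =
      algebraMap (MvPolynomial (Fin (n + 1)) ℚ) (FractionRing (MvPolynomial (Fin (n + 1)) ℚ))
        (C ((-1 : ℚ) ^ (Iset n c).card * (Dnum n (Iset n c) : ℚ))) := by
  classical
  have hdeg : (∏ i, X i ^ c i : MvPolynomial (Fin (n + 1)) ℚ).totalDegree ≤ n := by
    refine (totalDegree_finsetProd _ _).trans ?_
    simp only [totalDegree_X_pow, hc, le_refl]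
  obtain ⟨K, hK⟩ := exists_sum_div_eq_const _ hdeg
  have hfrac := hK (FractionRing (MvPolynomial (Fin (n + 1)) ℚ)) (algebraMap (MvPolynomial (Fin (n + 1)) ℚ)
    (FractionRing (MvPolynomial (Fin (n + 1)) ℚ)))
    ((IsFractionRing.injective _ _).comp X_injective)
  rw [divSym, hfrac]
  congr 2
  set φ := aeval (R := ℚ) (fun i : Fin (n + 1) => hahnVar i.rev) with hφ
  have hinj : Function.Injective fun i : Fin (n + 1) => φ.toRingHom (X i) := by
    intro i j hij
    have h1 : HahnSeries.single (lexSingle i.rev) (1 : ℚ) =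
        HahnSeries.single (lexSingle j.rev) 1 := by
      simpa [hφ, hahnVar] using hij
    have h2 := congrArg (fun s => HahnSeries.coeff s (lexSingle i.rev)) h1
    simp only [HahnSeries.coeff_single_same, HahnSeries.coeff_single] at h2
    by_contra hne
    have h3 : lexSingle i.rev ≠ lexSingle j.rev := fun h => by
      have := congrArg (lexCoord i.rev) h
      rw [lexCoord_lexSingle, lexCoord_lexSingle, if_pos rfl,
        if_neg fun h => hne (Fin.rev_injective h)] at this
      exact one_ne_zero this
    simp [h3] at h2
  have h := congrArg (fun s => HahnSeries.coeff s 0) (hK _ φ.toRingHom hinj)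
  have hconst : (φ (C K)).coeff 0 = K := by
    rw [hφ, aeval_C, HahnSeries.algebraMap_apply, HahnSeries.C_apply, HahnSeries.coeff_single_same,
      Algebra.algebraMap_self_apply]
  simp only [AlgHom.toRingHom_eq_coe, RingHom.coe_coe, hconst, HahnSeries.coeff_sum] at h
  rw [← h, Finset.sum_congr rfl fun w _ => coeff_zero_term n c hc w, ← Finset.sum_filter,
    Finset.sum_const, nsmul_eq_mul, mul_comm, Dnum]
end

section
/- Let n ≥ 1, let I_1,…,I_m ⊆ [n] be nonempty subsets, and let y_1,…,y_m ≥ 0 be nonnegative real numbers. Then the volume of the generalized permutohedron P_G(y_1,…,y_m) := y_1·Δ_{I_1} + ⋯ + y_m·Δ_{I_m} (Minkowski sum) equals Vol P_G(y_1,…,y_m) = Σ (y_1^{a_1}/a_1!) ⋯ (y_m^{a_m}/a_m!), where the sum is over all G-draconian sequences (a_1,…,a_m). -/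
open MeasureTheory Pointwise

/-- The `i`-th standard basis vector of `ℝ^n`. -/
def stdVec (n : ℕ) (i : Fin n) : Fin n → ℝ := fun j => if j = i then 1 else 0

/-- The coordinate simplex `Δ_I = ConvexHull{e_i : i ∈ I}`. -/
def coordSimplex (n : ℕ) (I : Finset (Fin n)) : Set (Fin n → ℝ) :=
  convexHull ℝ {p | ∃ i ∈ I, p = stdVec n i}

/-- Volume via projection forgetting the last coordinate. -/
noncomputable def projVol (n : ℕ) (P : Set (Fin (n + 1) → ℝ)) : ℝ :=
  (volume ((fun t : Fin (n + 1) → ℝ => fun i : Fin n => t i.castSucc) '' P)).toReal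

/-- The `G`-draconian sequences for the collection `I_1,…,I_m` of subsets of `[n+1]`:
nonnegative integer sequences `(a_1,…,a_m)` with `Σ a_i = n` such that for every nonempty
`S ⊆ [m]`, `|⋃_{i∈S} I_i| ≥ (Σ_{i∈S} a_i) + 1`. -/
def draconianSeqs (n m : ℕ) (I : Fin m → Finset (Fin (n + 1))) : Finset (Fin m → ℕ) :=
  (Finset.Nat.antidiagonalTuple m n).filter fun a =>
    ∀ S : Finset (Fin m), S.Nonempty → (∑ i ∈ S, a i) + 1 ≤ (S.biUnion I).card

section Flow

variable {ι κ : Type*} [Fintype ι] [Fintype κ]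

/-- Row sums of a function on the edges of a complete bipartite graph. -/
def leftSum {A : Type*} [AddCommMonoid A] (x : ι × κ → A) (i : ι) : A := ∑ j, x (i, j)

/-- Column sums of a function on the edges of a complete bipartite graph. -/
def rightSum {A : Type*} [AddCommMonoid A] (x : ι × κ → A) (j : κ) : A := ∑ i, x (i, j)

lemma sum_leftSum_eq_sum_rightSum (x : ι × κ → ℝ) : ∑ i, leftSum x i = ∑ j, rightSum x j := by
  simp only [leftSum, rightSum]
  exact Finset.sum_comm

omit [Fintype ι] in
lemma leftSum_add_mul (x z : ι × κ → ℝ) (s : ℝ) (i : ι) :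
    leftSum (fun e => x e + s * z e) i = leftSum x i + s * leftSum z i := by
  simp [leftSum, Finset.sum_add_distrib, Finset.mul_sum]

omit [Fintype κ] in
lemma rightSum_add_mul (x z : ι × κ → ℝ) (s : ℝ) (j : κ) :
    rightSum (fun e => x e + s * z e) j = rightSum x j + s * rightSum z j := by
  simp [rightSum, Finset.sum_add_distrib, Finset.mul_sum]

lemma sum_mul_leftSum (x : ι × κ → ℝ) (g : ι → ℝ) :
    ∑ i, g i * leftSum x i = ∑ e, g e.1 * x e := by
  simp [leftSum, Finset.mul_sum, Fintype.sum_prod_type]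

lemma sum_mul_rightSum (x : ι × κ → ℝ) (g : κ → ℝ) :
    ∑ j, g j * rightSum x j = ∑ e, g e.2 * x e := by
  simp [rightSum, Finset.mul_sum, Fintype.sum_prod_type_right]

/-- The pair `(L, R)` is a cut of the edge set `T` whose only crossing edge is `e`. -/
def IsCut (T : Finset (ι × κ)) (e : ι × κ) (L : Finset ι) (R : Finset κ) : Prop :=
  e.1 ∉ L ∧ e.2 ∈ R ∧ ∀ f ∈ T, f ≠ e → (f.1 ∈ L ↔ f.2 ∈ R)

/-- A bipartite edge set is a forest if each of its edges is a bridge. -/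
def IsForest (T : Finset (ι × κ)) : Prop := ∀ e ∈ T, ∃ L R, IsCut T e L R

omit [Fintype ι] [Fintype κ] in
lemma IsForest.subset {T U : Finset (ι × κ)} (hT : IsForest T) (h : U ⊆ T) : IsForest U := by
  intro e he
  obtain ⟨L, R, h1, h2, h3⟩ := hT e (h he)
  exact ⟨L, R, h1, h2, fun f hf => h3 f (h hf)⟩

variable [DecidableEq ι] [DecidableEq κ]

lemma IsCut.apply_eq {T : Finset (ι × κ)} {e : ι × κ} {L : Finset ι} {R : Finset κ}
    (h : IsCut T e L R) {x : ι × κ → ℝ} (hx : ∀ f ∉ T, x f = 0) :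
    x e = ∑ j ∈ R, rightSum x j - ∑ i ∈ L, leftSum x i := by
  obtain ⟨h1, h2, h3⟩ := h
  have hr := sum_mul_rightSum x (fun j => if j ∈ R then 1 else 0)
  have hl := sum_mul_leftSum x (fun i => if i ∈ L then 1 else 0)
  simp only [ite_mul, one_mul, zero_mul, Finset.sum_ite_mem, Finset.univ_inter] at hr hl
  rw [hr, hl, ← Finset.sum_sub_distrib, Finset.sum_eq_single e]
  · simp [h1, h2]
  · intro f _ hf
    by_cases hfT : f ∈ T
    · simp [h3 f hfT hf]
    · simp [hx f hfT]
  · simp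

lemma IsForest.eq_zero {T : Finset (ι × κ)} (hT : IsForest T) {x : ι × κ → ℝ}
    (hx : ∀ f ∉ T, x f = 0) (hl : ∀ i, leftSum x i = 0) (hr : ∀ j, rightSum x j = 0) :
    x = 0 := by
  ext e
  by_cases he : e ∈ T
  · obtain ⟨L, R, h⟩ := hT e he
    rw [h.apply_eq hx]
    simp [hl, hr]
  · exact hx e he

omit [Fintype ι] [Fintype κ] in
lemma IsForest.card_lt {T : Finset (ι × κ)} (hT : IsForest T) (L : Finset ι) (R : Finset κ)
    (hLR : T ⊆ L ×ˢ R) (hne : L.Nonempty ∨ R.Nonempty) : T.card < L.card + R.card := by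
  induction hc : T.card using Nat.strong_induction_on generalizing T L R with
  | _ N ih =>
  obtain rfl | ⟨e, he⟩ := T.eq_empty_or_nonempty
  · rcases hne with h | h <;> have := h.card_pos <;> simp at hc <;> omega
  obtain ⟨A, B, h1, h2, h3⟩ := hT e he
  have heLR := Finset.mem_product.1 (hLR he)
  set T₁ := (T.erase e).filter (fun f => f.1 ∈ A) with hT₁
  set T₂ := (T.erase e).filter (fun f => f.1 ∉ A) with hT₂
  have hcard : T₁.card + T₂.card = (T.erase e).card :=
    Finset.card_filter_add_card_filter_not _
  have hcard' := Finset.card_erase_add_one he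
  have s₁ : T₁ ⊆ T := (Finset.filter_subset _ _).trans (Finset.erase_subset _ _)
  have s₂ : T₂ ⊆ T := (Finset.filter_subset _ _).trans (Finset.erase_subset _ _)
  have k₁ := ih T₁.card (by omega) (hT.subset s₁) (L ∩ A) (R ∩ B) (by
    intro f hf
    have hfT := Finset.mem_product.1 (hLR (s₁ hf))
    simp only [hT₁, Finset.mem_filter, Finset.mem_erase] at hf
    have := h3 f hf.1.2 hf.1.1
    simp only [Finset.mem_product, Finset.mem_inter]
    tauto) (Or.inr ⟨e.2, by simp [heLR.2, h2]⟩) rfl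
  have k₂ := ih T₂.card (by omega) (hT.subset s₂) (L \ A) (R \ B) (by
    intro f hf
    have hfT := Finset.mem_product.1 (hLR (s₂ hf))
    simp only [hT₂, Finset.mem_filter, Finset.mem_erase] at hf
    have := h3 f hf.1.2 hf.1.1
    simp only [Finset.mem_product, Finset.mem_sdiff]
    tauto) (Or.inl ⟨e.1, by simp [heLR.1, h1]⟩) rfl
  have := Finset.card_inter_add_card_sdiff L A
  have := Finset.card_inter_add_card_sdiff R B
  omega

lemma exists_int_circulation {T : Finset (ι × κ)} (hT : ¬ IsForest T) :
    ∃ z : ι × κ → ℤ, z ≠ 0 ∧ (∀ f ∉ T, z f = 0) ∧ (∀ i, leftSum z i = 0) ∧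
      ∀ j, rightSum z j = 0 := by
  classical
  simp only [IsForest, not_forall] at hT
  obtain ⟨e, he, hcut⟩ := hT
  have lone : ∀ f : ι × κ, leftSum (Pi.single f (1 : ℤ)) = Pi.single f.1 1 := by
    rintro ⟨a, b⟩
    ext i
    by_cases h : i = a <;> simp [leftSum, Pi.single_apply, h]
  have rone : ∀ f : ι × κ, rightSum (Pi.single f (1 : ℤ)) = Pi.single f.2 1 := by
    rintro ⟨a, b⟩
    ext i
    by_cases h : i = b <;> simp [rightSum, Pi.single_apply, h]
  have ladd : ∀ z w : ι × κ → ℤ, leftSum (z + w) = leftSum z + leftSum w := by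
    intro z w; ext i; simp [leftSum, Finset.sum_add_distrib]
  have radd : ∀ z w : ι × κ → ℤ, rightSum (z + w) = rightSum z + rightSum w := by
    intro z w; ext i; simp [rightSum, Finset.sum_add_distrib]
  have lsub : ∀ z w : ι × κ → ℤ, leftSum (z - w) = leftSum z - leftSum w := by
    intro z w; ext i; simp [leftSum, Finset.sum_sub_distrib]
  have rsub : ∀ z w : ι × κ → ℤ, rightSum (z - w) = rightSum z - rightSum w := by
    intro z w; ext i; simp [rightSum, Finset.sum_sub_distrib]
  let L : Finset ι := {i | ∃ z : ι × κ → ℤ, (∀ f, f ∉ T ∨ f = e → z f = 0) ∧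
    leftSum z = Pi.single i 1 ∧ rightSum z = Pi.single e.2 1}
  let R : Finset κ := {j | ∃ z : ι × κ → ℤ, (∀ f, f ∉ T ∨ f = e → z f = 0) ∧
    leftSum z = 0 ∧ rightSum z = Pi.single e.2 1 - Pi.single j 1}
  have hR : e.2 ∈ R := by
    simp only [R, Finset.mem_filter_univ]
    exact ⟨0, by simp, by ext; simp [leftSum], by ext; simp [rightSum]⟩
  have hLR : ∀ f ∈ T, f ≠ e → (f.1 ∈ L ↔ f.2 ∈ R) := by
    intro f hf hfe
    have hs : ∀ g, g ∉ T ∨ g = e → (Pi.single f (1 : ℤ) : ι × κ → ℤ) g = 0 := by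
      intro g hg
      have : g ≠ f := by rintro rfl; tauto
      simp [this]
    simp only [L, R, Finset.mem_filter_univ]
    constructor
    · rintro ⟨z, h1, h2, h3⟩
      refine ⟨z - Pi.single f 1, fun g hg => by simp [h1 g hg, hs g hg], ?_, ?_⟩
      · rw [lsub, h2, lone, sub_self]
      · rw [rsub, h3, rone]
    · rintro ⟨z, h1, h2, h3⟩
      refine ⟨z + Pi.single f 1, fun g hg => by simp [h1 g hg, hs g hg], ?_, ?_⟩
      · rw [ladd, h2, lone, zero_add]
      · rw [radd, h3, rone, sub_add_cancel]
  have hL : e.1 ∈ L := by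
    by_contra h
    exact hcut ⟨L, R, h, hR, hLR⟩
  simp only [L, Finset.mem_filter_univ] at hL
  obtain ⟨z, h1, h2, h3⟩ := hL
  refine ⟨Pi.single e 1 - z, fun h => ?_, fun f hf => ?_, fun i => ?_, fun j => ?_⟩
  · have := congrFun h e
    simp [h1 e (Or.inr rfl)] at this
  · have : f ≠ e := by rintro rfl; exact hf he
    simp [this, h1 f (Or.inl hf)]
  · rw [lsub, lone, h2, sub_self, Pi.zero_apply]
  · rw [rsub, rone, h3, sub_self, Pi.zero_apply]

/-- `x` is nonnegative, supported on `E`, and of minimal cost among such functions with the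
same row and column sums. -/
def IsOptimal (c : ι × κ → ℝ) (E : Finset (ι × κ)) (x : ι × κ → ℝ) : Prop :=
  (∀ e, 0 ≤ x e) ∧ (∀ e ∉ E, x e = 0) ∧ ∀ x' : ι × κ → ℝ, (∀ e, 0 ≤ x' e) →
    (∀ e ∉ E, x' e = 0) → (∀ i, leftSum x' i = leftSum x i) →
    (∀ j, rightSum x' j = rightSum x j) → ∑ e, c e * x e ≤ ∑ e, c e * x' e

omit [DecidableEq ι] [DecidableEq κ] in
lemma exists_pos_add_mul_nonneg {x z : ι × κ → ℝ} (hx : ∀ e, 0 ≤ x e)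
    (h : ∀ e, x e = 0 → 0 ≤ z e) : ∃ s : ℝ, 0 < s ∧ ∀ e, 0 ≤ x e + s * z e := by
  have key : ∀ e, ∀ᶠ s : ℝ in nhdsWithin 0 (Set.Ioi 0), 0 ≤ x e + s * z e := by
    intro e
    rcases (hx e).eq_or_lt with h0 | h0
    · filter_upwards [self_mem_nhdsWithin] with s hs
      have := h e h0.symm
      have hs' : (0 : ℝ) < s := hs
      rw [← h0]
      positivity
    · have : ContinuousAt (fun s : ℝ => x e + s * z e) 0 := by fun_prop
      have := this.eventually_const_le (u := 0 / 2 + 0) (by simpa using h0)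
      filter_upwards [nhdsWithin_le_nhds this] with s hs
      simpa using hs
  obtain ⟨s, hs1, hs2⟩ := ((Filter.eventually_all.2 key).and self_mem_nhdsWithin).exists
  exact ⟨s, hs2, hs1⟩

omit [DecidableEq ι] [DecidableEq κ] in
lemma IsOptimal.of_support {c : ι × κ → ℝ} {E : Finset (ι × κ)} {x x' : ι × κ → ℝ}
    (hx : IsOptimal c E x) (hx' : ∀ e, 0 ≤ x' e) (h : ∀ e, x e = 0 → x' e = 0) :
    IsOptimal c E x' := by
  refine ⟨hx', fun e he => h e (hx.2.1 e he), fun w hw hwE hl hr => ?_⟩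
  obtain ⟨s, hs, hpos⟩ := exists_pos_add_mul_nonneg (x := x) (z := fun e => w e - x' e) hx.1
    (fun e he => by simpa [h e he] using hw e)
  have hl' : ∀ i, leftSum (fun e => w e - x' e) i = 0 := by
    intro i; have := hl i; simp only [leftSum, Finset.sum_sub_distrib] at *; linarith
  have hr' : ∀ j, rightSum (fun e => w e - x' e) j = 0 := by
    intro i; have := hr i; simp only [rightSum, Finset.sum_sub_distrib] at *; linarith
  have := hx.2.2 _ hpos (fun e he => by simp [hx.2.1 e he, hwE e he, h e (hx.2.1 e he)])
    (fun i => by rw [leftSum_add_mul, hl']; simp) (fun j => by rw [rightSum_add_mul, hr']; simp)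
  have e1 : ∑ e, c e * (x e + s * (w e - x' e)) =
      ∑ e, c e * x e + s * (∑ e, c e * w e - ∑ e, c e * x' e) := by
    rw [← Finset.sum_sub_distrib, Finset.mul_sum, ← Finset.sum_add_distrib]
    exact Finset.sum_congr rfl fun e _ => by ring
  rw [e1] at this
  by_contra! hlt
  nlinarith [mul_pos hs (sub_pos.2 hlt)]

/-- A cost function is generic if it vanishes on no nonzero integer vector. -/
def IsGeneric (c : ι × κ → ℝ) : Prop := ∀ z : ι × κ → ℤ, z ≠ 0 → ∑ e, c e * (z e : ℝ) ≠ 0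

omit [DecidableEq ι] [DecidableEq κ] in
lemma exists_isGeneric : ∃ c : ι × κ → ℝ, IsGeneric c := by
  have b := Module.Basis.ofVectorSpace ℚ ℝ
  have hinf : Infinite (Module.Basis.ofVectorSpaceIndex ℚ ℝ) := by
    by_contra hfin
    rw [not_infinite_iff_finite] at hfin
    have := Module.Finite.of_basis b
    have h1 := Real.rank_rat_real
    have h2 := Module.rank_lt_aleph0 ℚ ℝ
    rw [h1] at h2
    exact absurd Cardinal.aleph0_le_continuum (not_le.2 h2)
  let φ : ι × κ ↪ Module.Basis.ofVectorSpaceIndex ℚ ℝ :=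
    (Fintype.equivFin (ι × κ)).toEmbedding.trans (Fin.valEmbedding.trans (Infinite.natEmbedding _))
  have hli := b.linearIndependent.comp φ φ.injective
  refine ⟨b ∘ φ, fun z hz h0 => hz ?_⟩
  ext e
  have := Fintype.linearIndependent_iff.1 hli (fun e => (z e : ℚ)) (by
    rw [← h0]
    exact Finset.sum_congr rfl fun e _ => by
      rw [Rat.smul_def, mul_comm]; simp) e
  simpa using this

lemma IsOptimal.isForest {c : ι × κ → ℝ} {E T : Finset (ι × κ)} {x : ι × κ → ℝ}
    (hc : IsGeneric c) (hx : IsOptimal c E x) (hT : ∀ e, e ∈ T ↔ x e ≠ 0) : IsForest T := by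
  by_contra hf
  obtain ⟨z, hz0, hzT, hl, hr⟩ := exists_int_circulation hf
  have hsum := hc z hz0
  have main : ∀ w : ι × κ → ℤ, (∀ f ∉ T, w f = 0) → (∀ i, leftSum w i = 0) →
      (∀ j, rightSum w j = 0) → 0 ≤ ∑ e, c e * (w e : ℝ) := by
    intro w hwT hwl hwr
    have hwT' : ∀ e, x e = 0 → (w e : ℝ) = 0 := fun e he => by
      rw [hwT e (by simp [hT, he]), Int.cast_zero]
    obtain ⟨s, hs, hpos⟩ := exists_pos_add_mul_nonneg (x := x) (z := fun e => (w e : ℝ)) hx.1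
      (fun e he => (hwT' e he).ge)
    have hwl' : ∀ i, leftSum (fun e => (w e : ℝ)) i = 0 := fun i => by
      have := hwl i; simp only [leftSum] at *; exact_mod_cast this
    have hwr' : ∀ i, rightSum (fun e => (w e : ℝ)) i = 0 := fun i => by
      have := hwr i; simp only [rightSum] at *; exact_mod_cast this
    have := hx.2.2 _ hpos (fun e he => by simp [hx.2.1 e he, hwT' e (hx.2.1 e he)])
      (fun i => by rw [leftSum_add_mul, hwl']; simp)
      (fun j => by rw [rightSum_add_mul, hwr']; simp)
    simp only [mul_add, Finset.sum_add_distrib, le_add_iff_nonneg_right] at this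
    have e1 : ∑ e, c e * (s * (w e : ℝ)) = s * ∑ e, c e * (w e : ℝ) := by
      rw [Finset.mul_sum]; exact Finset.sum_congr rfl fun e _ => by ring
    rw [e1] at this
    exact nonneg_of_mul_nonneg_right this hs
  have h1 := main z hzT hl hr
  have h2 := main (-z) (fun f hf => by simp [hzT f hf])
    (fun i => by have := hl i; simp only [leftSum] at *; simp [this])
    (fun i => by have := hr i; simp only [rightSum] at *; simp [this])
  simp at h2
  exact hsum (le_antisymm h2 h1)

lemma IsOptimal.unique {c : ι × κ → ℝ} {E : Finset (ι × κ)} {x x' : ι × κ → ℝ}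
    (hc : IsGeneric c) (hx : IsOptimal c E x) (hx' : IsOptimal c E x')
    (hl : ∀ i, leftSum x i = leftSum x' i) (hr : ∀ j, rightSum x j = rightSum x' j) :
    x = x' := by
  have hle := hx.2.2 x' hx'.1 hx'.2.1 (fun i => (hl i).symm) (fun j => (hr j).symm)
  have hmid : IsOptimal c E (fun e => (x e + x' e) / 2) := by
    refine ⟨fun e => by have := hx.1 e; have := hx'.1 e; positivity,
      fun e he => by simp [hx.2.1 e he, hx'.2.1 e he], fun w hw hwE hwl hwr => ?_⟩
    have h1 := hx'.2.2 w hw hwE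
      (fun i => by
        rw [hwl, ← add_self_div_two (leftSum x' i)]; nth_rw 1 [← hl]
        simp only [leftSum, ← Finset.sum_div, Finset.sum_add_distrib])
      (fun i => by
        rw [hwr, ← add_self_div_two (rightSum x' i)]; nth_rw 1 [← hr]
        simp only [rightSum, ← Finset.sum_div, Finset.sum_add_distrib])
    have e1 : ∑ e, c e * ((x e + x' e) / 2) = (∑ e, c e * x e + ∑ e, c e * x' e) / 2 := by
      rw [← Finset.sum_add_distrib, Finset.sum_div]
      exact Finset.sum_congr rfl fun e _ => by ring
    rw [e1]; linarith
  classical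
  have hf := hmid.isForest hc (T := {e | (x e + x' e) / 2 ≠ 0}) (by simp)
  have hz := hf.eq_zero (x := fun e => x e + (-1) * x' e) (by
    intro f hf
    simp only [Finset.mem_filter_univ, not_not] at hf
    have := hx.1 f; have := hx'.1 f
    have a : x f = 0 := by linarith
    have b : x' f = 0 := by linarith
    simp [a, b]) (fun i => by rw [leftSum_add_mul, hl]; ring)
    (fun i => by rw [rightSum_add_mul, hr]; ring)
  ext e
  have := congrFun hz e
  simp at this
  linarith

omit [DecidableEq ι] [DecidableEq κ] in
lemma exists_isOptimal (c : ι × κ → ℝ) (E : Finset (ι × κ)) {x : ι × κ → ℝ}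
    (hx : ∀ e, 0 ≤ x e) (hE : ∀ e ∉ E, x e = 0) : ∃ x', IsOptimal c E x' ∧
      (∀ i, leftSum x' i = leftSum x i) ∧ ∀ j, rightSum x' j = rightSum x j := by
  let K : Set (ι × κ → ℝ) := {w | (∀ e, 0 ≤ w e) ∧ (∀ e ∉ E, w e = 0) ∧
    (∀ i, leftSum w i = leftSum x i) ∧ ∀ j, rightSum w j = rightSum x j}
  have hclosed : IsClosed K := by
    simp only [K, Set.ofPred_and, Set.ofPred_forall, leftSum, rightSum]
    refine IsClosed.inter ?_ (IsClosed.inter ?_ (IsClosed.inter ?_ ?_))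
    · exact isClosed_iInter fun e => isClosed_le (by fun_prop) (by fun_prop)
    · exact isClosed_iInter fun e => isClosed_iInter fun _ => isClosed_eq (by fun_prop) (by fun_prop)
    · exact isClosed_iInter fun e => isClosed_eq (by fun_prop) (by fun_prop)
    · exact isClosed_iInter fun e => isClosed_eq (by fun_prop) (by fun_prop)
  have hsub : K ⊆ Set.Icc 0 (fun e => leftSum x e.1) := by
    rintro w ⟨h1, -, h3, -⟩
    refine ⟨h1, fun e => ?_⟩
    change w e ≤ leftSum x e.1
    rw [← h3]
    exact Finset.single_le_sum (f := fun j => w (e.1, j)) (fun j _ => h1 _) (Finset.mem_univ e.2)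
  have hK : IsCompact K := isCompact_Icc.of_isClosed_subset hclosed hsub
  obtain ⟨w, hw, hmin⟩ := hK.exists_isMinOn ⟨x, hx, hE, fun _ => rfl, fun _ => rfl⟩
    (f := fun w => ∑ e, c e * w e) (by fun_prop)
  refine ⟨w, ⟨hw.1, hw.2.1, fun x' h1 h2 h3 h4 => hmin ⟨h1, h2, ?_, ?_⟩⟩, hw.2.2⟩
  · exact fun i => (h3 i).trans (hw.2.2.1 i)
  · exact fun j => (h4 j).trans (hw.2.2.2 j)

end Flow

section Simplex

variable {ι : Type*} [Fintype ι] [DecidableEq ι]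

lemma lintegral_pow_div_factorial (c : ℕ) {b C : ℝ} (hb : 0 < b) (hC : 0 ≤ C) :
    ∫⁻ s in Set.Ioo 0 b, ENNReal.ofReal (C * ((b - s) ^ c / c.factorial)) =
      ENNReal.ofReal (C * (b ^ (c + 1) / (c + 1).factorial)) := by
  rw [← ofReal_integral_eq_lintegral_ofReal]
  · congr 1
    rw [← integral_Ioc_eq_integral_Ioo, ← intervalIntegral.integral_of_le hb.le,
      intervalIntegral.integral_const_mul, intervalIntegral.integral_div,
      intervalIntegral.integral_comp_sub_left (fun s => s ^ c) b, integral_pow,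
      Nat.factorial_succ]
    simp only [sub_self, sub_zero]
    push_cast
    field_simp
    ring
  · have : ContinuousOn (fun s : ℝ => C * ((b - s) ^ c / c.factorial)) (Set.Icc 0 b) := by
      fun_prop
    exact this.integrableOn_Icc.mono_set Set.Ioo_subset_Icc_self
  · filter_upwards [ae_restrict_mem measurableSet_Ioo] with s hs
    have : 0 ≤ b - s := by linarith [hs.2]
    change 0 ≤ _
    positivity

/-- The product of open corner simplices, one for each fibre of `p`. -/
def simplexProd {N : ℕ} (p : Fin N → ι) (y : ι → ℝ) : Set (Fin N → ℝ) :=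
  {u | (∀ k, 0 < u k) ∧ ∀ i, ∑ k with p k = i, u k < y i}

omit [Fintype ι] in
lemma isOpen_simplexProd [Finite ι] {N : ℕ} (p : Fin N → ι) (y : ι → ℝ) :
    IsOpen (simplexProd p y) := by
  simp only [simplexProd, Set.ofPred_and, Set.ofPred_forall]
  refine IsOpen.inter ?_ ?_
  · exact isOpen_iInter_of_finite fun k => isOpen_lt (by fun_prop) (by fun_prop)
  · exact isOpen_iInter_of_finite fun i => isOpen_lt (by fun_prop) (by fun_prop)

lemma volume_simplexProd {N : ℕ} (p : Fin N → ι) (y : ι → ℝ) (hy : ∀ i, 0 < y i) :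
    volume (simplexProd p y) = ENNReal.ofReal
      (∏ i, y i ^ (Finset.card {k | p k = i}) / (Finset.card {k | p k = i}).factorial) := by
  induction N generalizing y with
  | zero =>
    have : simplexProd p y = Set.univ := by
      ext u; simp [simplexProd, hy]
    simp [this, Measure.volume_pi_eq_dirac (0 : Fin 0 → ℝ)]
  | succ N ih =>
    let i₀ := p 0
    let p' : Fin N → ι := fun k => p k.succ
    have hsum : ∀ (u : Fin (N + 1) → ℝ) i, ∑ k with p k = i, u k =
        (if i₀ = i then u 0 else 0) + ∑ k with p' k = i, u k.succ := by
      intro u i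
      simp [Finset.sum_filter, Fin.sum_univ_succ, i₀, p']
    have hcard : ∀ i, Finset.card {k | p k = i} =
        (if i₀ = i then 1 else 0) + Finset.card {k | p' k = i} := by
      intro i
      simp only [Finset.card_filter, Fin.sum_univ_succ, i₀, p']
    let A : Set (ℝ × (Fin N → ℝ)) := {w | Fin.cons w.1 w.2 ∈ simplexProd p y}
    have hcons : Continuous (fun w : ℝ × (Fin N → ℝ) => (Fin.cons w.1 w.2 : Fin (N + 1) → ℝ)) := by
      fun_prop
    have hA : MeasurableSet A := ((isOpen_simplexProd p y).preimage hcons).measurableSet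
    have hpre : simplexProd p y = MeasurableEquiv.piFinSuccAbove (fun _ => ℝ) 0 ⁻¹' A := by
      ext u
      simp only [A, Set.mem_preimage, MeasurableEquiv.piFinSuccAbove_apply, Set.mem_ofPred_eq,
        Fin.insertNthEquiv_zero]
      simp [Fin.consEquiv]
    rw [hpre, (volume_preserving_piFinSuccAbove (fun _ => ℝ) 0).measure_preimage
      hA.nullMeasurableSet, Measure.volume_eq_prod, Measure.prod_apply hA]
    let y' : ℝ → ι → ℝ := fun s i => y i - if i₀ = i then s else 0
    let C : ℝ := ∏ i ∈ Finset.univ.erase i₀,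
      y i ^ (Finset.card {k | p' k = i}) / (Finset.card {k | p' k = i}).factorial
    have hC : 0 ≤ C := Finset.prod_nonneg fun i _ => by have := (hy i).le; positivity
    have hslice : ∀ s, volume (Prod.mk s ⁻¹' A) = (Set.Ioo 0 (y i₀)).indicator
        (fun s => ENNReal.ofReal (C * ((y i₀ - s) ^ (Finset.card {k | p' k = i₀}) /
          (Finset.card {k | p' k = i₀}).factorial))) s := by
      intro s
      have hmem : ∀ u, u ∈ Prod.mk s ⁻¹' A ↔ 0 < s ∧ u ∈ simplexProd p' (y' s) := by
        intro u
        simp only [A, simplexProd, Set.mem_preimage, Set.mem_ofPred_eq, hsum, Fin.forall_fin_succ,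
          Fin.cons_zero, Fin.cons_succ, y', lt_sub_iff_add_lt', and_assoc]
      by_cases hs : s ∈ Set.Ioo 0 (y i₀)
      · have : Prod.mk s ⁻¹' A = simplexProd p' (y' s) := by
          ext u; rw [hmem]; simp [hs.1]
        rw [this, ih, Set.indicator_of_mem hs, ← Finset.prod_erase_mul _ _ (Finset.mem_univ i₀)]
        · congr 2
          · refine Finset.prod_congr rfl fun i hi => ?_
            simp [y', (Finset.ne_of_mem_erase hi).symm]
          · simp [y']
        · intro i
          by_cases h : i₀ = i
          · subst h; simpa [y'] using hs.2
          · simpa [y', h] using hy i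
      · rw [Set.indicator_of_notMem hs]
        have : Prod.mk s ⁻¹' A = ∅ := by
          ext u
          rw [hmem]
          simp only [Set.mem_empty_iff_false, iff_false]
          rintro ⟨h1, h2, h3⟩
          refine hs ⟨h1, ?_⟩
          have := h3 i₀
          have h4 : 0 ≤ ∑ k with p' k = i₀, u k := Finset.sum_nonneg fun k _ => (h2 k).le
          simp [y'] at this
          linarith
        simp [this]
    simp_rw [hslice]
    rw [lintegral_indicator measurableSet_Ioo, lintegral_pow_div_factorial _ (hy i₀) hC,
      ← Finset.prod_erase_mul _ _ (Finset.mem_univ i₀)]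
    congr 2
    · refine Finset.prod_congr rfl fun i hi => ?_
      rw [hcard]
      simp [(Finset.ne_of_mem_erase hi).symm]
    · rw [hcard]
      simp [add_comm]

end Simplex

section Cell

variable {ι : Type*} [Fintype ι] [DecidableEq ι] {n : ℕ}

/-- The projections of the column sums of functions that are positive exactly on `T` and have
row sums `y`. -/
def flowCell (T : Finset (ι × Fin (n + 1))) (y : ι → ℝ) : Set (Fin n → ℝ) :=
  {s | ∃ x : ι × Fin (n + 1) → ℝ, (∀ e, 0 ≤ x e) ∧ (∀ e, e ∈ T ↔ x e ≠ 0) ∧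
    (∀ i, leftSum x i = y i) ∧ ∀ j : Fin n, rightSum x j.castSucc = s j}

/-- The edge set `T` is partitioned into one root edge `r i` at every left vertex `i` and
further edges `q k`. -/
structure IsRooting {N : ℕ} (T : Finset (ι × Fin (n + 1))) (r : ι → ι × Fin (n + 1))
    (q : Fin N → ι × Fin (n + 1)) : Prop where
  fst_root : ∀ i, (r i).1 = i
  injective : Function.Injective q
  mem_iff : ∀ e, e ∈ T ↔ (∃ i, r i = e) ∨ ∃ k, q k = e
  ne : ∀ k i, q k ≠ r i

lemma exists_isRooting {T : Finset (ι × Fin (n + 1))} (h : ∀ i, ∃ e ∈ T, e.1 = i) :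
    ∃ (N : ℕ) (r : ι → ι × Fin (n + 1)) (q : Fin N → ι × Fin (n + 1)), IsRooting T r q ∧
      T.card = N + Fintype.card ι := by
  choose r hr hr1 using h
  have hinj : Function.Injective r := fun i i' h => by rw [← hr1 i, h, hr1]
  have hsub : Finset.univ.image r ⊆ T := by
    intro e he
    obtain ⟨i, -, rfl⟩ := Finset.mem_image.1 he
    exact hr i
  let D := T \ Finset.univ.image r
  refine ⟨D.card, r, fun k => (D.equivFin.symm k : ι × Fin (n + 1)), ⟨hr1, ?_, ?_, ?_⟩, ?_⟩
  · exact Subtype.val_injective.comp D.equivFin.symm.injective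
  · intro e
    constructor
    · intro he
      by_cases h : e ∈ Finset.univ.image r
      · left; simpa using h
      · right
        exact ⟨D.equivFin ⟨e, Finset.mem_sdiff.2 ⟨he, h⟩⟩, by simp⟩
    · rintro (⟨i, rfl⟩ | ⟨k, rfl⟩)
      · exact hr i
      · exact (Finset.mem_sdiff.1 (D.equivFin.symm k).2).1
  · intro k i h
    have := (Finset.mem_sdiff.1 (D.equivFin.symm k).2).2
    rw [h] at this
    simp at this
  · rw [← Finset.card_univ, ← Finset.card_image_of_injective _ hinj]
    exact (Finset.card_sdiff_add_card_eq_card hsub).symm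

namespace IsRooting

variable {N : ℕ} {T : Finset (ι × Fin (n + 1))} {r : ι → ι × Fin (n + 1)}
  {q : Fin N → ι × Fin (n + 1)}

lemma sum_eq (h : IsRooting T r q) {A : Type*} [AddCommMonoid A] (f : ι × Fin (n + 1) → A)
    (hf : ∀ e ∉ T, f e = 0) : ∑ e, f e = ∑ i, f (r i) + ∑ k, f (q k) := by
  have hinj : Function.Injective r := fun i i' h' => by rw [← h.fst_root i, h', h.fst_root]
  rw [← Finset.sum_image (s := Finset.univ) (g := r) (fun a _ b _ hab => hinj hab),
    ← Finset.sum_image (s := Finset.univ) (g := q) (fun a _ b _ hab => h.injective hab),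
    ← Finset.sum_union]
  · refine (Finset.sum_subset (Finset.subset_univ _) fun e _ he => hf e fun heT => he ?_).symm
    simpa using (h.mem_iff e).1 heT
  · rw [Finset.disjoint_left]
    intro e he he'
    obtain ⟨i, -, rfl⟩ := Finset.mem_image.1 he
    obtain ⟨k, -, hk⟩ := Finset.mem_image.1 he'
    exact h.ne k i hk

lemma leftSum_eq (h : IsRooting T r q) {A : Type*} [AddCommMonoid A]
    {x : ι × Fin (n + 1) → A} (hx : ∀ e ∉ T, x e = 0) (i : ι) :
    leftSum x i = x (r i) + ∑ k with (q k).1 = i, x (q k) := by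
  have := h.sum_eq (fun e => if e.1 = i then x e else 0) (fun e he => by simp [hx e he])
  simp only [h.fst_root, Finset.sum_ite_eq', Finset.mem_univ, if_true] at this
  rw [Finset.sum_filter, ← this, Fintype.sum_prod_type, Finset.sum_eq_single i]
  · simp [leftSum]
  · intro b _ hb; simp [hb]
  · simp

lemma card_filter (h : IsRooting T r q) (i : ι) :
    Finset.card {e ∈ T | e.1 = i} = 1 + Finset.card {k | (q k).1 = i} := by
  have := h.sum_eq (fun e => if e ∈ T ∧ e.1 = i then 1 else 0) (fun e he => by simp [he])
  have hr : ∀ i, r i ∈ T := fun i => (h.mem_iff _).2 (Or.inl ⟨i, rfl⟩)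
  have hq : ∀ k, q k ∈ T := fun k => (h.mem_iff _).2 (Or.inr ⟨k, rfl⟩)
  simp only [hr, hq, h.fst_root, true_and, Finset.sum_ite_eq', Finset.mem_univ, if_true] at this
  rw [Finset.card_filter (fun k => (q k).1 = i), ← this, Finset.card_filter]
  simp [ite_and]

/-- The matrix of the column sums as a function of the values on the edges `q k`. -/
def edgeMatrix (r : ι → ι × Fin (n + 1)) (q : Fin N → ι × Fin (n + 1)) :
    Matrix (Fin n) (Fin N) ℤ :=
  .of fun j k => (if (q k).2 = j.castSucc then 1 else 0) -
    if (r (q k).1).2 = j.castSucc then 1 else 0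

lemma rightSum_eq (h : IsRooting T r q) {x : ι × Fin (n + 1) → ℝ} (hx : ∀ e ∉ T, x e = 0)
    (j : Fin n) : rightSum x j.castSucc =
      ∑ i, (if (r i).2 = j.castSucc then leftSum x i else 0) +
        ((edgeMatrix r q).map (Int.cast : ℤ → ℝ)).mulVec (fun k => x (q k)) j := by
  have := h.sum_eq (fun e => if e.2 = j.castSucc then x e else 0) (fun e he => by simp [hx e he])
  have h1 : rightSum x j.castSucc = ∑ e, if e.2 = j.castSucc then x e else 0 := by
    rw [Fintype.sum_prod_type_right, Finset.sum_eq_single j.castSucc]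
    · simp [rightSum]
    · intro b _ hb; simp [hb]
    · simp
  rw [h1, this]
  have h2 : ∀ i, (if (r i).2 = j.castSucc then x (r i) else 0) =
      (if (r i).2 = j.castSucc then leftSum x i else 0) -
      ∑ k, if (q k).1 = i then (if (r i).2 = j.castSucc then x (q k) else 0) else 0 := by
    intro i
    rw [h.leftSum_eq hx]
    split_ifs <;> simp [Finset.sum_filter]
  simp only [h2, Finset.sum_sub_distrib]
  rw [Finset.sum_comm (s := Finset.univ) (t := Finset.univ)]
  simp only [Finset.sum_ite_eq, Finset.mem_univ, if_true]
  rw [sub_add_eq_add_sub, add_sub_assoc, ← Finset.sum_sub_distrib]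
  simp [Matrix.mulVec, dotProduct, edgeMatrix, sub_mul]

omit [Fintype ι] in
lemma exists_mul_edgeMatrix_eq_one (h : IsRooting T r q) (hT : IsForest T) :
    ∃ B : Matrix (Fin N) (Fin n) ℤ, B * edgeMatrix r q = 1 := by
  have hq : ∀ k, q k ∈ T := fun k => (h.mem_iff _).2 (Or.inr ⟨k, rfl⟩)
  have hr : ∀ i, r i ∈ T := fun i => (h.mem_iff _).2 (Or.inl ⟨i, rfl⟩)
  choose L R hcut using fun k => hT (q k) (hq k)
  let g : Fin N → Fin (n + 1) → ℤ := fun k j => if j ∈ R k then 1 else 0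
  refine ⟨.of fun k j => g k j.castSucc - g k (Fin.last n), ?_⟩
  ext k k'
  have key : ∀ j₀ : Fin (n + 1), ∑ j : Fin n, (g k j.castSucc - g k (Fin.last n)) *
      (if j₀ = j.castSucc then 1 else 0) = g k j₀ - g k (Fin.last n) := by
    intro j₀
    have := Fin.sum_univ_castSucc
      (fun j => (g k j - g k (Fin.last n)) * (if j₀ = j then 1 else 0))
    simp only [sub_self, zero_mul, add_zero] at this
    rw [← this]
    simp
  simp only [Matrix.mul_apply, edgeMatrix, Matrix.of_apply, mul_sub, Finset.sum_sub_distrib, key]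
  obtain ⟨h1, h2, h3⟩ := hcut k
  have hroot := h3 (r (q k').1) (hr _) (h.ne _ _).symm
  rw [h.fst_root] at hroot
  by_cases hk : k = k'
  · subst hk
    simp [g, h2, ← hroot, h1]
  · have := h3 (q k') (hq _) (fun h' => hk (h.injective h').symm)
    simp [g, ← hroot, ← this, hk]

/-- The function on the edges of `T` with row sums `y` and prescribed values on the edges
`q k`. -/
def extend (r : ι → ι × Fin (n + 1)) (q : Fin N → ι × Fin (n + 1)) (y : ι → ℝ)
    (u : Fin N → ℝ) (e : ι × Fin (n + 1)) : ℝ :=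
  (∑ k, if q k = e then u k else 0) +
    if r e.1 = e then y e.1 - ∑ k with (q k).1 = e.1, u k else 0

omit [Fintype ι] in
lemma extend_apply_edge (h : IsRooting T r q) (y : ι → ℝ) (u : Fin N → ℝ) (k : Fin N) :
    extend r q y u (q k) = u k := by
  simp [extend, h.injective.eq_iff, (h.ne _ _).symm]

omit [Fintype ι] in
lemma extend_apply_root (h : IsRooting T r q) (y : ι → ℝ) (u : Fin N → ℝ) (i : ι) :
    extend r q y u (r i) = y i - ∑ k with (q k).1 = i, u k := by
  simp [extend, h.ne, h.fst_root]

omit [Fintype ι] in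
lemma extend_apply_of_notMem (h : IsRooting T r q) (y : ι → ℝ) (u : Fin N → ℝ)
    {e : ι × Fin (n + 1)} (he : e ∉ T) : extend r q y u e = 0 := by
  have h1 : ∀ k, q k ≠ e := fun k hk => he ((h.mem_iff e).2 (Or.inr ⟨k, hk⟩))
  have h2 : r e.1 ≠ e := fun hk => he ((h.mem_iff e).2 (Or.inl ⟨_, hk⟩))
  simp [extend, h1, h2]

lemma flowCell_eq (h : IsRooting T r q) (y : ι → ℝ) :
    flowCell T y = (fun s => (fun j => ∑ i, if (r i).2 = Fin.castSucc j then y i else 0) + s) ''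
      (Matrix.toLin' ((edgeMatrix r q).map (Int.cast : ℤ → ℝ)) ''
        simplexProd (fun k => (q k).1) y) := by
  have hq : ∀ k, q k ∈ T := fun k => (h.mem_iff _).2 (Or.inr ⟨k, rfl⟩)
  have hr : ∀ i, r i ∈ T := fun i => (h.mem_iff _).2 (Or.inl ⟨i, rfl⟩)
  rw [Set.image_image]
  ext s
  constructor
  · rintro ⟨x, hx0, hxT, hl, hs⟩
    have hx : ∀ e ∉ T, x e = 0 := fun e he => by simpa using (hxT e).not.1 he
    refine ⟨fun k => x (q k), ⟨fun k => (hx0 _).lt_of_ne' ((hxT _).1 (hq k)), fun i => ?_⟩, ?_⟩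
    · have h1 := h.leftSum_eq hx i
      have h2 := (hx0 _).lt_of_ne' ((hxT _).1 (hr i))
      rw [hl] at h1
      linarith
    · ext j
      rw [← hs, h.rightSum_eq hx]
      simp [hl]
  · rintro ⟨u, ⟨hu0, hu⟩, rfl⟩
    have hx : ∀ e ∉ T, extend r q y u e = 0 := fun e he => h.extend_apply_of_notMem y u he
    have hpos : ∀ e ∈ T, 0 < extend r q y u e := by
      intro e he
      rcases (h.mem_iff e).1 he with ⟨i, rfl⟩ | ⟨k, rfl⟩
      · rw [h.extend_apply_root]; linarith [hu i]
      · rw [h.extend_apply_edge]; exact hu0 k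
    have hl : ∀ i, leftSum (extend r q y u) i = y i := by
      intro i
      rw [h.leftSum_eq hx, h.extend_apply_root]
      simp [h.extend_apply_edge]
    refine ⟨extend r q y u, fun e => ?_, fun e => ⟨fun he => (hpos e he).ne', fun he => ?_⟩, hl,
      fun j => ?_⟩
    · by_cases he : e ∈ T
      · exact (hpos e he).le
      · rw [hx e he]
    · by_contra h'
      exact he (hx e h')
    · rw [h.rightSum_eq hx]
      simp [hl, h.extend_apply_edge]

end IsRooting

omit [DecidableEq ι] in
lemma flowCell_eq_empty {T : Finset (ι × Fin (n + 1))} {y : ι → ℝ} (hy : ∀ i, 0 < y i) {i : ι}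
    (hi : ∀ e ∈ T, e.1 ≠ i) : flowCell T y = ∅ := by
  rw [Set.eq_empty_iff_forall_notMem]
  rintro s ⟨x, -, hxT, hl, -⟩
  have : leftSum x i = 0 := Finset.sum_eq_zero fun j _ => by
    by_contra h
    exact hi _ ((hxT _).2 h) rfl
  linarith [hl i, hy i]

lemma volume_flowCell_of_card_ne {T : Finset (ι × Fin (n + 1))} (hT : IsForest T) {y : ι → ℝ}
    (hy : ∀ i, 0 < y i) (hc : T.card ≠ n + Fintype.card ι) : volume (flowCell T y) = 0 := by
  by_cases hcov : ∀ i, ∃ e ∈ T, e.1 = i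
  · obtain ⟨N, r, q, h, hN⟩ := exists_isRooting hcov
    have hlt : N < n := by
      have := hT.card_lt Finset.univ Finset.univ (fun e _ => by simp)
        (Or.inr Finset.univ_nonempty)
      simp only [Finset.card_univ, Fintype.card_fin] at this
      omega
    rw [h.flowCell_eq]
    simp only [Set.image_add_left, measure_preimage_add]
    set f := Matrix.toLin' ((IsRooting.edgeMatrix r q).map (Int.cast : ℤ → ℝ))
    refine measure_mono_null (Set.image_subset_range _ _) ?_
    rw [← LinearMap.coe_range]
    refine Measure.addHaar_submodule _ _ fun htop => ?_
    have := LinearMap.finrank_range_le f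
    rw [htop, finrank_top] at this
    simp at this
    omega
  · push Not at hcov
    obtain ⟨i, hi⟩ := hcov
    simp [flowCell_eq_empty hy hi]

lemma flowCell_of_card_eq {T : Finset (ι × Fin (n + 1))} (hT : IsForest T) {y : ι → ℝ}
    (hy : ∀ i, 0 < y i) (hcov : ∀ i, ∃ e ∈ T, e.1 = i) (hc : T.card = n + Fintype.card ι) :
    MeasurableSet (flowCell T y) ∧ volume (flowCell T y) = ENNReal.ofReal
      (∏ i, y i ^ (Finset.card {e ∈ T | e.1 = i} - 1) /
        (Finset.card {e ∈ T | e.1 = i} - 1).factorial) := by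
  obtain ⟨N, r, q, h, hN⟩ := exists_isRooting hcov
  obtain rfl : N = n := by omega
  obtain ⟨B, hB⟩ := h.exists_mul_edgeMatrix_eq_one hT
  set f := Matrix.toLin' ((IsRooting.edgeMatrix r q).map (Int.cast : ℤ → ℝ)) with hf
  have hdet : |LinearMap.det f| = 1 := by
    have h1 : (IsRooting.edgeMatrix r q).det = 1 ∨ (IsRooting.edgeMatrix r q).det = -1 := by
      rw [← Int.isUnit_iff]
      have := congrArg Matrix.det hB
      rw [Matrix.det_mul, Matrix.det_one] at this
      exact IsUnit.of_mul_eq_one_right _ this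
    have h2 : LinearMap.det f = ((IsRooting.edgeMatrix r q).det : ℝ) := by
      rw [hf, LinearMap.det_toLin']
      exact ((Int.castRingHom ℝ).map_det _).symm
    rw [h2]
    rcases h1 with h1 | h1 <;> simp [h1]
  have hinj : Function.Injective f := by
    have : LinearMap.det f ≠ 0 := fun h0 => by simp [h0] at hdet
    exact (LinearMap.equivOfDetNeZero f this).injective
  rw [h.flowCell_eq]
  simp only [Set.image_add_left, measure_preimage_add]
  constructor
  · refine measurable_const_add _ ?_
    refine MeasurableSet.image_of_continuousOn_injOn (isOpen_simplexProd _ _).measurableSet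
      (LinearMap.continuous_of_finiteDimensional f).continuousOn hinj.injOn
  · rw [Measure.addHaar_image_linearMap, hdet, volume_simplexProd _ _ hy]
    simp [h.card_filter]

end Cell

section Tree

variable {ι : Type*} [Fintype ι] [DecidableEq ι] {n : ℕ}

lemma IsForest.exists_fst_eq {T : Finset (ι × Fin (n + 1))} (hT : IsForest T)
    (hc : T.card = n + Fintype.card ι) (i : ι) : ∃ e ∈ T, e.1 = i := by
  by_contra! h
  have := hT.card_lt (Finset.univ.erase i) Finset.univ (fun e he => by simp [h e he])
    (Or.inr Finset.univ_nonempty)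
  have h1 := Finset.card_erase_add_one (Finset.mem_univ i)
  simp only [Finset.card_univ, Fintype.card_fin] at this h1
  omega

lemma IsForest.exists_flow {T : Finset (ι × Fin (n + 1))} (hT : IsForest T)
    (hc : T.card = n + Fintype.card ι) {y : ι → ℝ} {t : Fin (n + 1) → ℝ}
    (hyt : ∑ i, y i = ∑ j, t j) : ∃ x : ι × Fin (n + 1) → ℝ, (∀ e ∉ T, x e = 0) ∧
      (∀ i, leftSum x i = y i) ∧ ∀ j, rightSum x j = t j := by
  obtain ⟨N, r, q, h, hN⟩ := exists_isRooting (hT.exists_fst_eq hc)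
  obtain rfl : N = n := by omega
  obtain ⟨B, hB⟩ := h.exists_mul_edgeMatrix_eq_one hT
  have hB' : (IsRooting.edgeMatrix r q).map (Int.cast : ℤ → ℝ) * B.map (Int.cast : ℤ → ℝ) = 1 := by
    have : (IsRooting.edgeMatrix r q * B).map (Int.castRingHom ℝ) = 1 := by
      rw [mul_eq_one_comm.1 hB]
      exact Matrix.map_one _ (map_zero _) (map_one _)
    rw [Matrix.map_mul] at this
    exact this
  let s : Fin N → ℝ := fun j => t j.castSucc - ∑ i, if (r i).2 = j.castSucc then y i else 0
  let u : Fin N → ℝ := (B.map (Int.cast : ℤ → ℝ)).mulVec s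
  have hx : ∀ e ∉ T, IsRooting.extend r q y u e = 0 := fun e he => h.extend_apply_of_notMem y u he
  have hl : ∀ i, leftSum (IsRooting.extend r q y u) i = y i := by
    intro i
    rw [h.leftSum_eq hx, h.extend_apply_root]
    simp [h.extend_apply_edge]
  have hr : ∀ j : Fin N, rightSum (IsRooting.extend r q y u) j.castSucc = t j.castSucc := by
    intro j
    rw [h.rightSum_eq hx]
    simp only [hl, h.extend_apply_edge]
    change _ + Matrix.mulVec _ ((B.map (Int.cast : ℤ → ℝ)).mulVec s) j = _
    rw [Matrix.mulVec_mulVec, hB', Matrix.one_mulVec]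
    simp [s]
  refine ⟨_, hx, hl, Fin.lastCases ?_ hr⟩
  have h1 := sum_leftSum_eq_sum_rightSum (IsRooting.extend r q y u)
  simp only [hl, hyt, Fin.sum_univ_castSucc, hr] at h1
  linarith

omit [Fintype ι] in
lemma card_filter_fst_mem_eq_sum {κ : Type*} [DecidableEq κ] (T : Finset (ι × κ)) (L : Finset ι) :
    Finset.card {e ∈ T | e.1 ∈ L} = ∑ i ∈ L, Finset.card {e ∈ T | e.1 = i} := by
  rw [Finset.card_eq_sum_card_fiberwise (f := Prod.fst) (t := L) (by intro e; simp)]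
  refine Finset.sum_congr rfl fun i hi => ?_
  rw [Finset.filter_filter]
  congr 1
  ext e
  simp only [Finset.mem_filter]
  constructor
  · tauto
  · rintro ⟨h1, rfl⟩; tauto

lemma IsCut.card_right_eq {T : Finset (ι × Fin (n + 1))} (hT : IsForest T)
    (hc : T.card = n + Fintype.card ι) {e : ι × Fin (n + 1)} (he : e ∈ T) {L : Finset ι}
    {R : Finset (Fin (n + 1))} (h : IsCut T e L R) {a : ι → ℕ}
    (ha : ∀ i, Finset.card {e ∈ T | e.1 = i} = a i + 1) : R.card = ∑ i ∈ L, a i + 1 := by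
  obtain ⟨h1, h2, h3⟩ := h
  have k₁ := (hT.subset (Finset.filter_subset (fun f => f.1 ∈ L) T)).card_lt L R (by
    intro f hf
    simp only [Finset.mem_filter] at hf
    have := h3 f hf.1 (by rintro rfl; exact h1 hf.2)
    simp only [Finset.mem_product]
    tauto) (Or.inr ⟨_, h2⟩)
  have k₂ := (hT.subset ((Finset.erase_subset e _).trans
    (Finset.filter_subset (fun f => f.1 ∉ L) T))).card_lt Lᶜ Rᶜ (by
    intro f hf
    simp only [Finset.mem_erase, Finset.mem_filter] at hf
    have := h3 f hf.2.1 hf.1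
    simp only [Finset.mem_product, Finset.mem_compl]
    tauto) (Or.inl ⟨e.1, by simpa using h1⟩)
  have k₃ := Finset.card_erase_add_one
    (show e ∈ Finset.filter (fun f => f.1 ∉ L) T by simp [he, h1])
  have k₄ := Finset.card_filter_add_card_filter_not (s := T) (fun f => f.1 ∈ L)
  have k₅ := Finset.card_add_card_compl L
  have k₆ := Finset.card_add_card_compl R
  rw [Fintype.card_fin] at k₆
  rw [card_filter_fst_mem_eq_sum] at k₁ k₄
  simp only [ha, Finset.sum_add_distrib, Finset.sum_const, smul_eq_mul, mul_one] at k₁ k₄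
  omega

lemma IsForest.exists_pos_flow {T : Finset (ι × Fin (n + 1))} (hT : IsForest T)
    (hc : T.card = n + Fintype.card ι) {a : ι → ℕ}
    (ha : ∀ i, Finset.card {e ∈ T | e.1 = i} = a i + 1) :
    ∃ x : ι × Fin (n + 1) → ℝ, (∀ e ∈ T, 0 < x e) ∧ (∀ e ∉ T, x e = 0) ∧
      (∀ i, leftSum x i = Fintype.card ι * a i + 1) ∧ ∀ j, rightSum x j = Fintype.card ι := by
  have hsum : ∑ i, a i = n := by
    have := card_filter_fst_mem_eq_sum T Finset.univ
    simp only [ha, Finset.sum_add_distrib, Finset.mem_univ, Finset.filter_true, hc, Finset.sum_const,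
      Finset.card_univ, smul_eq_mul, mul_one] at this
    omega
  obtain ⟨x, hx, hl, hr⟩ := hT.exists_flow hc
    (y := fun i => (Fintype.card ι * a i + 1 : ℝ)) (t := fun _ => (Fintype.card ι : ℝ)) (by
      have : (∑ i, (a i : ℝ)) = n := by exact_mod_cast hsum
      simp only [Finset.sum_add_distrib, ← Finset.mul_sum, this]
      simp
      ring)
  refine ⟨x, fun e he => ?_, hx, hl, hr⟩
  obtain ⟨L, R, h⟩ := hT e he
  rw [h.apply_eq hx]
  simp only [hl, hr, Finset.sum_add_distrib, ← Finset.mul_sum, Finset.sum_const, nsmul_eq_mul,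
    mul_one]
  have hR : (R.card : ℝ) = ∑ i ∈ L, (a i : ℝ) + 1 := by
    exact_mod_cast IsCut.card_right_eq hT hc he h ha
  have hL : (L.card : ℝ) < Fintype.card ι := by
    exact_mod_cast Finset.card_lt_univ_of_notMem h.1
  rw [hR]
  linarith

/-- The edges of the bipartite graph in which `i` is joined to the elements of `I i`. -/
def edgesOf (I : ι → Finset (Fin (n + 1))) : Finset (ι × Fin (n + 1)) := {e | e.2 ∈ I e.1}

/-- `T` is a spanning tree that supports a minimal-cost flow. -/
def IsOptimalTree (c : ι × Fin (n + 1) → ℝ) (E T : Finset (ι × Fin (n + 1))) : Prop :=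
  (∃ x, IsOptimal c E x ∧ ∀ e, e ∈ T ↔ x e ≠ 0) ∧ T.card = n + Fintype.card ι

/-- The inequalities defining draconian sequences, over an arbitrary index type. -/
def IsDraconian (I : ι → Finset (Fin (n + 1))) (a : ι → ℕ) : Prop :=
  ∑ i, a i = n ∧ ∀ S : Finset ι, S.Nonempty → (∑ i ∈ S, a i) + 1 ≤ (S.biUnion I).card

lemma IsOptimalTree.isDraconian {c : ι × Fin (n + 1) → ℝ} (hc : IsGeneric c)
    {I : ι → Finset (Fin (n + 1))} {T : Finset (ι × Fin (n + 1))}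
    (hT : IsOptimalTree c (edgesOf I) T) {a : ι → ℕ}
    (ha : ∀ i, Finset.card {e ∈ T | e.1 = i} = a i + 1) : IsDraconian I a := by
  obtain ⟨⟨w, hw, hwT⟩, hcard⟩ := hT
  have hf := hw.isForest hc hwT
  refine ⟨?_, fun S hS => ?_⟩
  · have := card_filter_fst_mem_eq_sum T Finset.univ
    simp only [ha, Finset.sum_add_distrib, Finset.mem_univ, Finset.filter_true, hcard,
      Finset.sum_const, Finset.card_univ, smul_eq_mul, mul_one] at this
    omega
  · obtain ⟨x, hpos, hx, hl, hr⟩ := hf.exists_pos_flow hcard ha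
    have hnn : ∀ e, 0 ≤ x e := fun e => by
      by_cases he : e ∈ T
      · exact (hpos e he).le
      · rw [hx e he]
    have hE : ∀ i j, j ∉ I i → x (i, j) = 0 := fun i j hj => hx _ fun hT => by
      refine (hwT _).1 hT (hw.2.1 _ ?_)
      simpa [edgesOf] using hj
    have h1 : ∑ i ∈ S, leftSum x i ≤ ∑ j ∈ S.biUnion I, rightSum x j := by
      calc ∑ i ∈ S, leftSum x i = ∑ i ∈ S, ∑ j ∈ S.biUnion I, x (i, j) := by
            refine Finset.sum_congr rfl fun i hi => ?_
            refine (Finset.sum_subset (Finset.subset_univ _) fun j _ hj => hE i j fun hj' => ?_).symm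
            exact hj (Finset.mem_biUnion.2 ⟨i, hi, hj'⟩)
        _ = ∑ j ∈ S.biUnion I, ∑ i ∈ S, x (i, j) := Finset.sum_comm
        _ ≤ _ := Finset.sum_le_sum fun j _ =>
            Finset.sum_le_sum_of_subset_of_nonneg (Finset.subset_univ _) fun i _ _ => hnn _
    simp only [hl, hr, Finset.sum_add_distrib, ← Finset.mul_sum, Finset.sum_const, nsmul_eq_mul,
      mul_one] at h1
    have h2 : Fintype.card ι * ∑ i ∈ S, a i + S.card ≤ (S.biUnion I).card * Fintype.card ι := by
      exact_mod_cast h1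
    have h3 := hS.card_pos
    by_contra! hlt
    nlinarith [Nat.mul_le_mul_left (Fintype.card ι) (Nat.le_of_lt_succ hlt)]

lemma IsOptimalTree.eq_of_degree_eq {c : ι × Fin (n + 1) → ℝ} (hc : IsGeneric c)
    {E T T' : Finset (ι × Fin (n + 1))} (hT : IsOptimalTree c E T) (hT' : IsOptimalTree c E T')
    {a : ι → ℕ} (ha : ∀ i, Finset.card {e ∈ T | e.1 = i} = a i + 1)
    (ha' : ∀ i, Finset.card {e ∈ T' | e.1 = i} = a i + 1) : T = T' := by
  have key : ∀ U, IsOptimalTree c E U → (∀ i, Finset.card {e ∈ U | e.1 = i} = a i + 1) →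
      ∃ x, IsOptimal c E x ∧ (∀ e, e ∈ U ↔ x e ≠ 0) ∧
        (∀ i, leftSum x i = Fintype.card ι * a i + 1) ∧ ∀ j, rightSum x j = Fintype.card ι := by
    rintro U ⟨⟨w, hw, hwU⟩, hcard⟩ hU
    obtain ⟨x, hpos, hx, hl, hr⟩ := (hw.isForest hc hwU).exists_pos_flow hcard hU
    refine ⟨x, hw.of_support (fun e => ?_) (fun e he => hx e (by simp [hwU, he])),
      fun e => ⟨fun he => (hpos e he).ne', fun he => by_contra fun h => he (hx e h)⟩, hl, hr⟩
    by_cases he : e ∈ U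
    · exact (hpos e he).le
    · rw [hx e he]
  obtain ⟨x, h1, h2, h3, h4⟩ := key T hT ha
  obtain ⟨x', h1', h2', h3', h4'⟩ := key T' hT' ha'
  obtain rfl := h1.unique hc h1' (fun i => by rw [h3, h3']) (fun i => by rw [h4, h4'])
  ext e
  rw [h2, h2']

lemma IsDraconian.exists_flow {I : ι → Finset (Fin (n + 1))} {a : ι → ℕ} (ha : IsDraconian I a) :
    ∃ x : ι × Fin (n + 1) → ℝ, (∀ e, 0 ≤ x e) ∧ (∀ e ∉ edgesOf I, x e = 0) ∧
      (∀ i, leftSum x i = Fintype.card ι * a i + 1) ∧ ∀ j, rightSum x j = Fintype.card ι := by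
  obtain ⟨hsum, hS⟩ := ha
  set m := Fintype.card ι with hm
  have hall := (Finset.all_card_le_biUnion_card_iff_exists_injective
    (fun w : (i : ι) × Fin (m * a i + 1) => I w.1 ×ˢ (Finset.univ : Finset (Fin m)))).1 (by
    intro s
    obtain rfl | hs := s.eq_empty_or_nonempty
    · simp
    set S := s.image Sigma.fst with hSdef
    have h1 : s.card ≤ ∑ i ∈ S, (m * a i + 1) := by
      have : s ⊆ S.sigma fun _ => Finset.univ := by
        intro w hw
        simp only [Finset.mem_sigma, Finset.mem_univ, and_true, hSdef]
        exact Finset.mem_image_of_mem _ hw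
      simpa using Finset.card_le_card this
    have h2 : s.biUnion (fun w => I w.1 ×ˢ (Finset.univ : Finset (Fin m))) =
        S.biUnion I ×ˢ Finset.univ := by
      ext ⟨j, k⟩
      simp [hSdef]
    rw [h2, Finset.card_product, Finset.card_univ, Fintype.card_fin]
    have h3 := hS S (hs.image _)
    have h4 : S.card ≤ m := Finset.card_le_univ S
    simp only [Finset.sum_add_distrib, ← Finset.mul_sum, Finset.sum_const, smul_eq_mul,
      mul_one] at h1
    nlinarith [Nat.mul_le_mul_left m h3])
  obtain ⟨f, hf, hfI⟩ := hall
  have hbij : Function.Bijective f := by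
    rw [Fintype.bijective_iff_injective_and_card]
    refine ⟨hf, ?_⟩
    simp only [Fintype.card_sigma, Fintype.card_fin, Fintype.card_prod, Finset.sum_add_distrib,
      ← Finset.mul_sum, hsum, Finset.sum_const, Finset.card_univ, smul_eq_mul, ← hm]
    ring
  refine ⟨fun e => ∑ w, if w.1 = e.1 ∧ (f w).1 = e.2 then 1 else 0, fun e => ?_, fun e he => ?_,
    fun i => ?_, fun j => ?_⟩
  · exact Finset.sum_nonneg fun w _ => by split_ifs <;> norm_num
  · refine Finset.sum_eq_zero fun w _ => if_neg ?_
    rintro ⟨h1, h2⟩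
    refine he ?_
    have := (Finset.mem_product.1 (hfI w)).1
    simpa [edgesOf, ← h1, ← h2] using this
  · simp only [leftSum]
    rw [Finset.sum_comm]
    simp only [ite_and]
    rw [Fintype.sum_sigma, Finset.sum_eq_single i]
    · simp
    · intro b _ hb; simp [hb]
    · simp
  · simp only [rightSum]
    rw [Finset.sum_comm]
    simp only [ite_and, Finset.sum_ite_eq, Finset.mem_univ, if_true]
    rw [hbij.sum_comp (fun v => if v.1 = j then (1 : ℝ) else 0), Fintype.sum_prod_type,
      Finset.sum_eq_single j]
    · simp
    · intro b _ hb; simp [hb]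
    · simp

lemma IsDraconian.exists_isOptimalTree {c : ι × Fin (n + 1) → ℝ} (hc : IsGeneric c)
    {I : ι → Finset (Fin (n + 1))} {a : ι → ℕ} (ha : IsDraconian I a) :
    ∃ T, IsOptimalTree c (edgesOf I) T ∧ ∀ i, Finset.card {e ∈ T | e.1 = i} = a i + 1 := by
  classical
  obtain ⟨x₀, hx₀, hE, hl₀, hr₀⟩ := ha.exists_flow
  obtain ⟨x, hx, hl, hr⟩ := exists_isOptimal c (edgesOf I) hx₀ hE
  simp only [hl₀, hr₀] at hl hr
  let T : Finset (ι × Fin (n + 1)) := {e | x e ≠ 0}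
  have hT : ∀ e, e ∈ T ↔ x e ≠ 0 := by simp [T]
  have hf := hx.isForest hc hT
  have hdeg : ∀ i, a i + 1 ≤ Finset.card {e ∈ T | e.1 = i} := by
    intro i
    have h1 : leftSum x i ≤ Finset.card {e ∈ T | e.1 = i} * (Fintype.card ι : ℝ) := by
      have h2 : leftSum x i = ∑ e ∈ T with e.1 = i, x e := by
        rw [Finset.sum_filter, Finset.sum_subset (Finset.subset_univ T), Fintype.sum_prod_type,
          Finset.sum_eq_single i]
        · simp [leftSum]
        · intro b _ hb; simp [hb]
        · simp
        · intro e _ he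
          simp [show x e = 0 by simpa [hT] using he]
      rw [h2, ← nsmul_eq_mul]
      refine Finset.sum_le_card_nsmul _ _ _ fun e _ => ?_
      rw [← hr e.2]
      exact Finset.single_le_sum (f := fun i => x (i, e.2)) (fun i _ => hx.1 _)
        (Finset.mem_univ e.1)
    rw [hl] at h1
    have h2 : Fintype.card ι * a i + 1 ≤ Finset.card {e ∈ T | e.1 = i} * Fintype.card ι := by
      exact_mod_cast h1
    by_contra! hlt
    nlinarith [Nat.mul_le_mul_left (Fintype.card ι) (Nat.le_of_lt_succ hlt)]
  have h1 := card_filter_fst_mem_eq_sum T Finset.univ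
  have h2 := hf.card_lt Finset.univ Finset.univ (fun e _ => by simp) (Or.inr Finset.univ_nonempty)
  have h3 := Finset.sum_le_sum fun i (_ : i ∈ Finset.univ) => hdeg i
  have h4 : ∑ i, (a i + 1) = n + Fintype.card ι := by simp [Finset.sum_add_distrib, ha.1]
  simp only [Finset.mem_univ, Finset.filter_true, Finset.card_univ, Fintype.card_fin] at h1 h2
  refine ⟨T, ⟨⟨x, hx, hT⟩, by omega⟩, fun i => ?_⟩
  exact ((Finset.sum_eq_sum_iff_of_le fun i (_ : i ∈ Finset.univ) => hdeg i).1 (by omega) i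
    (Finset.mem_univ i)).symm

/-- The projection of the set of column sums of flows on the edges of `I` with row sums `y`. -/
def flowImage (I : ι → Finset (Fin (n + 1))) (y : ι → ℝ) : Set (Fin n → ℝ) :=
  {s | ∃ x : ι × Fin (n + 1) → ℝ, (∀ e, 0 ≤ x e) ∧ (∀ e ∉ edgesOf I, x e = 0) ∧
    (∀ i, leftSum x i = y i) ∧ ∀ j : Fin n, rightSum x j.castSucc = s j}

lemma volume_flowImage (I : ι → Finset (Fin (n + 1))) {y : ι → ℝ} (hy : ∀ i, 0 < y i)
    (D : Finset (ι → ℕ)) (hD : ∀ a, a ∈ D ↔ IsDraconian I a) :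
    volume (flowImage I y) = ENNReal.ofReal (∑ a ∈ D, ∏ i, y i ^ a i / (a i).factorial) := by
  classical
  obtain ⟨c, hc⟩ := exists_isGeneric (ι := ι) (κ := Fin (n + 1))
  let G : Finset (Finset (ι × Fin (n + 1))) :=
    {T | ∃ x, IsOptimal c (edgesOf I) x ∧ ∀ e, e ∈ T ↔ x e ≠ 0}
  have hG : ∀ T, T ∈ G ↔ ∃ x, IsOptimal c (edgesOf I) x ∧ ∀ e, e ∈ T ↔ x e ≠ 0 := by simp [G]
  have hforest : ∀ T ∈ G, IsForest T := fun T hT => by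
    obtain ⟨x, hx, hxT⟩ := (hG T).1 hT
    exact hx.isForest hc hxT
  have hunion : flowImage I y = ⋃ T ∈ G, flowCell T y := by
    ext s
    simp only [Set.mem_iUnion, exists_prop]
    constructor
    · rintro ⟨x, hx, hE, hl, hs⟩
      obtain ⟨x', hx', hl', hr'⟩ := exists_isOptimal c (edgesOf I) hx hE
      refine ⟨Finset.univ.filter fun e => x' e ≠ 0, (hG _).2 ⟨x', hx', by simp⟩, x', hx'.1, by simp,
        fun i => ?_,
        fun j => ?_⟩
      · rw [hl', hl]
      · rw [hr', hs]
    · rintro ⟨T, hT, x, hx, hxT, hl, hs⟩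
      obtain ⟨w, hw, hwT⟩ := (hG T).1 hT
      refine ⟨x, hx, fun e he => ?_, hl, hs⟩
      by_contra h
      exact (hwT e).1 ((hxT e).2 h) (hw.2.1 e he)
  have hdisj : Set.PairwiseDisjoint (G : Set (Finset (ι × Fin (n + 1)))) (flowCell · y) := by
    intro T hT T' hT' hne
    rw [Function.onFun, Set.disjoint_left]
    rintro s ⟨x, hx, hxT, hl, hs⟩ ⟨x', hx', hxT', hl', hs'⟩
    have key : ∀ U ∈ G, ∀ z : ι × Fin (n + 1) → ℝ, (∀ e, 0 ≤ z e) → (∀ e, e ∈ U ↔ z e ≠ 0) →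
        IsOptimal c (edgesOf I) z := by
      intro U hU z hz hzU
      obtain ⟨w, hw, hwU⟩ := (hG U).1 hU
      refine hw.of_support hz fun e he => ?_
      by_contra h
      exact (hwU e).1 ((hzU e).2 h) he
    have hr : ∀ j : Fin n, rightSum x j.castSucc = rightSum x' j.castSucc := fun j => by
      rw [hs, hs']
    have heq : x = x' := by
      refine (key T hT x hx hxT).unique hc (key T' hT' x' hx' hxT') (fun i => by rw [hl, hl'])
        (Fin.lastCases ?_ hr)
      have h1 := sum_leftSum_eq_sum_rightSum x
      have h2 := sum_leftSum_eq_sum_rightSum x'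
      simp only [hl, hl', Fin.sum_univ_castSucc, hr] at h1 h2
      linarith
    refine hne ?_
    ext e
    rw [hxT, hxT', heq]
  have hnull : ∀ T ∈ G, NullMeasurableSet (flowCell T y) := by
    intro T hT
    by_cases hcard : T.card = n + Fintype.card ι
    · exact (flowCell_of_card_eq (hforest T hT) hy ((hforest T hT).exists_fst_eq hcard)
        hcard).1.nullMeasurableSet
    · exact NullMeasurableSet.of_null (volume_flowCell_of_card_ne (hforest T hT) hy hcard)
  rw [hunion, measure_biUnion_finset₀ (fun T hT T' hT' h => (hdisj hT hT' h).aedisjoint) hnull,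
    ENNReal.ofReal_sum_of_nonneg (fun a _ => Finset.prod_nonneg fun i _ => by
      have := (hy i).le; positivity),
    ← Finset.sum_filter_of_ne (p := fun T => T.card = n + Fintype.card ι) (fun T hT h => by
      by_contra hcard
      exact h (volume_flowCell_of_card_ne (hforest T hT) hy hcard))]
  have hdeg : ∀ T ∈ G.filter (fun T => T.card = n + Fintype.card ι), ∀ i,
      Finset.card {e ∈ T | e.1 = i} = Finset.card {e ∈ T | e.1 = i} - 1 + 1 := by
    intro T hT i
    simp only [Finset.mem_filter] at hT
    obtain ⟨e, he, hei⟩ := (hforest T hT.1).exists_fst_eq hT.2 i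
    have : 0 < Finset.card {e ∈ T | e.1 = i} := Finset.card_pos.2 ⟨e, by simp [he, hei]⟩
    omega
  have hopt : ∀ T, T ∈ G.filter (fun T => T.card = n + Fintype.card ι) ↔
      IsOptimalTree c (edgesOf I) T := by
    intro T
    rw [Finset.mem_filter, hG, IsOptimalTree]
  refine Finset.sum_bij (fun T _ i => Finset.card {e ∈ T | e.1 = i} - 1) ?_ ?_ ?_ ?_
  · intro T hT
    exact (hD _).2 (((hopt T).1 hT).isDraconian hc (hdeg T hT))
  · intro T hT T' hT' h
    refine ((hopt T).1 hT).eq_of_degree_eq hc ((hopt T').1 hT') (hdeg T hT) fun i => ?_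
    rw [hdeg T' hT' i]
    exact congrArg (· + 1) (congrFun h i).symm
  · intro a ha
    obtain ⟨T, hT, hTa⟩ := ((hD a).1 ha).exists_isOptimalTree hc
    exact ⟨T, (hopt T).2 hT, by ext i; simp [hTa]⟩
  · intro T hT
    have hT' := Finset.mem_filter.1 hT
    have hf := hforest T hT'.1
    exact (flowCell_of_card_eq hf hy (hf.exists_fst_eq hT'.2) hT'.2).2

end Tree

lemma mem_coordSimplex {N : ℕ} {I : Finset (Fin N)} {p : Fin N → ℝ} :
    p ∈ coordSimplex N I ↔ (∀ j, 0 ≤ p j) ∧ (∀ j ∉ I, p j = 0) ∧ ∑ j, p j = 1 := by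
  constructor
  · intro hp
    have hconv : Convex ℝ {p : Fin N → ℝ | (∀ j, 0 ≤ p j) ∧ (∀ j ∉ I, p j = 0) ∧ ∑ j, p j = 1} := by
      rintro p ⟨h1, h2, h3⟩ q ⟨k1, k2, k3⟩ a b ha hb hab
      refine ⟨fun j => ?_, fun j hj => by simp [h2 j hj, k2 j hj], ?_⟩
      · have := h1 j
        have := k1 j
        simp only [Pi.add_apply, Pi.smul_apply, smul_eq_mul]
        positivity
      · simp [Finset.sum_add_distrib, ← Finset.mul_sum, h3, k3, hab]
    refine convexHull_min ?_ hconv hp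
    rintro _ ⟨i, hi, rfl⟩
    refine ⟨fun j => ?_, fun j hj => ?_, by simp [stdVec]⟩
    · simp only [stdVec]
      split_ifs <;> norm_num
    · have : j ≠ i := by rintro rfl; exact hj hi
      simp [stdVec, this]
  · rintro ⟨h1, h2, h3⟩
    have hp : p = ∑ i ∈ I, p i • stdVec N i := by
      ext j
      simp only [Finset.sum_apply, Pi.smul_apply, stdVec, smul_eq_mul, mul_ite, mul_one, mul_zero,
        Finset.sum_ite_eq]
      split_ifs with hj
      · rfl
      · exact h2 j hj
    rw [hp]
    refine (convex_convexHull ℝ _).sum_mem (fun i _ => h1 i) ?_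
      fun i hi => subset_convexHull ℝ _ ⟨i, hi, rfl⟩
    rw [← h3]
    exact Finset.sum_subset (Finset.subset_univ _) fun j _ hj => h2 j hj

lemma image_sum_smul_coordSimplex {ι : Type*} [Fintype ι] [DecidableEq ι] {n : ℕ}
    (I : ι → Finset (Fin (n + 1))) {y : ι → ℝ} (hy : ∀ i, 0 < y i) :
    (fun t : Fin (n + 1) → ℝ => fun i : Fin n => t i.castSucc) ''
      (∑ i, y i • coordSimplex (n + 1) (I i)) = flowImage I y := by
  ext s
  simp only [Set.mem_image, Set.mem_fintype_sum]
  constructor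
  · rintro ⟨_, ⟨g, hg, rfl⟩, rfl⟩
    choose w hw hwg using fun i => Set.mem_smul_set.1 (hg i)
    simp only [mem_coordSimplex] at hw
    have hg' : ∀ i j, g i j = y i * w i j := fun i j => by rw [← hwg i]; simp
    refine ⟨fun e => g e.1 e.2, fun e => ?_, fun e he => ?_, fun i => ?_, fun j => ?_⟩
    · change 0 ≤ g e.1 e.2
      rw [hg']
      exact mul_nonneg (hy _).le ((hw _).1 _)
    · change g e.1 e.2 = 0
      rw [hg', (hw _).2.1 _ (by simpa [edgesOf] using he), mul_zero]
    · simp [leftSum, hg', ← Finset.mul_sum, (hw i).2.2]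
    · simp [rightSum]
  · rintro ⟨x, hx, hE, hl, hs⟩
    refine ⟨_, ⟨fun i j => x (i, j), fun i => ?_, rfl⟩, ?_⟩
    · refine Set.mem_smul_set.2 ⟨fun j => (y i)⁻¹ * x (i, j), mem_coordSimplex.2
        ⟨fun j => ?_, fun j hj => ?_, ?_⟩, ?_⟩
      · exact mul_nonneg (inv_nonneg.2 (hy i).le) (hx _)
      · simp [hE (i, j) (by simpa [edgesOf] using hj)]
      · rw [← Finset.mul_sum]
        change (y i)⁻¹ * leftSum x i = 1
        rw [hl, inv_mul_cancel₀ (hy i).ne']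
      · ext j
        simp [(hy i).ne']
    · ext j
      rw [← hs j]
      simp [rightSum]

lemma mem_draconianSeqs {n m : ℕ} {I : Fin m → Finset (Fin (n + 1))} {a : Fin m → ℕ} :
    a ∈ draconianSeqs n m I ↔ IsDraconian I a := by
  simp [draconianSeqs, IsDraconian, Finset.Nat.mem_antidiagonalTuple]

lemma isDraconian_restrict_iff {ι : Type*} [Fintype ι] [DecidableEq ι] {n : ℕ}
    {I : ι → Finset (Fin (n + 1))} (hI : ∀ i, (I i).Nonempty) {p : ι → Prop} [DecidablePred p]
    {a : ι → ℕ} (ha : ∀ i, ¬ p i → a i = 0) :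
    IsDraconian (fun i : Subtype p => I i) (fun i => a i) ↔ IsDraconian I a := by
  have hsum : ∀ S : Finset ι, ∑ i ∈ S.subtype p, a i = ∑ i ∈ S, a i := by
    intro S
    rw [Finset.sum_subtype_eq_sum_filter, Finset.sum_filter_of_ne]
    intro i _ hi
    by_contra h
    exact hi (ha i h)
  have huniv : (Finset.univ : Finset ι).subtype p = Finset.univ := by ext; simp
  refine and_congr (by rw [← hsum, huniv]) ⟨fun h S hS => ?_, fun h S hS => ?_⟩
  · rw [← hsum]
    have hsub : (S.subtype p).biUnion (fun i => I i) ⊆ S.biUnion I := by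
      intro j
      simp only [Finset.mem_biUnion, Finset.mem_subtype]
      rintro ⟨i, hi, hj⟩
      exact ⟨i, hi, hj⟩
    obtain h0 | h0 := (S.subtype p).eq_empty_or_nonempty
    · rw [h0, Finset.sum_empty, zero_add]
      exact (hS.biUnion fun i _ => hI i).card_pos
    · exact (h _ h0).trans (Finset.card_le_card hsub)
  · have := h (S.map (Function.Embedding.subtype p)) (by simpa using hS)
    rw [Finset.sum_map] at this
    refine this.trans (Finset.card_le_card ?_)
    intro j
    simp

theorem stmt8 (n m : ℕ) (I : Fin m → Finset (Fin (n + 1))) (hI : ∀ i, (I i).Nonempty)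
    (y : Fin m → ℝ) (hy : ∀ i, 0 ≤ y i) :
    projVol n (∑ i : Fin m, y i • coordSimplex (n + 1) (I i)) =
      ∑ a ∈ draconianSeqs n m I, ∏ i, y i ^ a i / (Nat.factorial (a i) : ℝ) := by
  classical
  let p : Fin m → Prop := fun i => y i ≠ 0
  have hmem : ∀ i, i ∈ (Finset.univ.filter p) ↔ p i := by simp
  have hne : ∀ i, (coordSimplex (n + 1) (I i)).Nonempty := fun i => by
    obtain ⟨j, hj⟩ := hI i
    exact ⟨_, subset_convexHull ℝ _ ⟨j, hj, rfl⟩⟩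
  have hset : ∑ i, y i • coordSimplex (n + 1) (I i) =
      ∑ i : Subtype p, y i • coordSimplex (n + 1) (I i) := by
    rw [← Finset.sum_subtype _ hmem (fun i => y i • coordSimplex (n + 1) (I i)),
      Finset.sum_filter_of_ne]
    intro i _ hi h0
    rw [h0, Set.zero_smul_set (hne i)] at hi
    exact hi rfl
  let D₀ := (draconianSeqs n m I).filter fun a => ∀ i, ¬ p i → a i = 0
  let ρ : (Fin m → ℕ) → Subtype p → ℕ := fun a i => a i
  have hρ : Set.InjOn ρ D₀ := by
    intro a ha b hb hab
    ext i
    by_cases hi : p i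
    · exact congrFun hab ⟨i, hi⟩
    · rw [(Finset.mem_filter.1 ha).2 i hi, (Finset.mem_filter.1 hb).2 i hi]
  have hD : ∀ b, b ∈ D₀.image ρ ↔ IsDraconian (fun i : Subtype p => I i) b := by
    intro b
    rw [Finset.mem_image]
    constructor
    · rintro ⟨a, ha, rfl⟩
      have ha' := Finset.mem_filter.1 ha
      exact (isDraconian_restrict_iff hI ha'.2).2 (mem_draconianSeqs.1 ha'.1)
    · intro hb
      let a : Fin m → ℕ := fun i => if h : p i then b ⟨i, h⟩ else 0
      have ha : ∀ i, ¬ p i → a i = 0 := fun i hi => dif_neg hi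
      have hab : ρ a = b := by
        ext i
        exact dif_pos i.2
      refine ⟨a, Finset.mem_filter.2 ⟨mem_draconianSeqs.2 ?_, ha⟩, hab⟩
      rw [← hab] at hb
      exact (isDraconian_restrict_iff hI ha).1 hb
  have hpos : ∀ i : Subtype p, 0 < y i := fun i => (hy i).lt_of_ne' i.2
  have hprod : ∀ b : Subtype p → ℕ, 0 ≤ ∏ i : Subtype p, y i ^ b i / ((b i).factorial : ℝ) := fun b =>
    Finset.prod_nonneg fun i _ => by have := (hpos i).le; positivity
  rw [projVol, hset, image_sum_smul_coordSimplex _ hpos, volume_flowImage _ hpos _ hD,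
    ENNReal.toReal_ofReal (Finset.sum_nonneg fun b _ => hprod b), Finset.sum_image hρ,
    ← Finset.sum_filter_of_ne (s := draconianSeqs n m I) (p := fun a => ∀ i, ¬ p i → a i = 0)]
  · refine Finset.sum_congr rfl fun a ha => ?_
    rw [← Finset.prod_subtype _ hmem (fun i => y i ^ a i / ((a i).factorial : ℝ)),
      Finset.prod_filter_of_ne]
    intro i _ hi h0
    exact hi (by simp [(Finset.mem_filter.1 ha).2 i (not_not.2 h0)])
  · intro a _ h i hi
    by_contra h0
    refine h (Finset.prod_eq_zero (Finset.mem_univ i) ?_)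
    rw [not_not.1 hi, zero_pow h0, zero_div]
end

section
/- Let n ≥ 1, let I_1,…,I_m ⊆ [n] be nonempty subsets with I_1 ∪ ⋯ ∪ I_m = [n], and let y_1,…,y_m be nonnegative integers. Let P_G(y_1,…,y_m) := y_1·Δ_{I_1} + ⋯ + y_m·Δ_{I_m} and let P_G^−(y_1,…,y_m) := {x ∈ ℝ^n : x + Δ_{[n]} ⊆ P_G(y_1,…,y_m)} be the trimmed generalized permutohedron. Then the number of integer lattice points in P_G^−(y_1,…,y_m) equals Σ ((y_1)_{a_1}/a_1!) ⋯ ((y_m)_{a_m}/a_m!), where the sum is over all G-draconian sequences (a_1,…,a_m) and (y)_a := y(y+1)⋯(y+a−1) denotes the raising power (so (y)_a/a! = binom(y+a−1, a)). In particular, the number of lattice points in P_G^−(1,…,1) equals the number of G-draconian sequences. -/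
open Pointwise

/-- The trimmed polytope `P − Δ_[n] = {x : x + Δ_[n] ⊆ P}`. -/
def trimmed (n : ℕ) (P : Set (Fin n → ℝ)) : Set (Fin n → ℝ) :=
  {x | ∀ q ∈ coordSimplex n Finset.univ, x + q ∈ P}

section Hypertrees

variable {α β : Type*} [DecidableEq α] [DecidableEq β]

/-- The vertices of `B` joined to `S` by an edge of the bipartite graph `E`. -/
def nbr (E : Finset (α × β)) (B : Finset β) (S : Finset α) : Finset β :=
  B.filter fun r => ∃ l ∈ S, (l, r) ∈ E

/-- The integer vectors on `A` satisfying the draconian inequalities of the bipartite graph on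
`A ∪ B` with edge set `E`. -/
def hypertrees (A : Finset α) (B : Finset β) (E : Finset (α × β)) : Set (α → ℤ) :=
  {a | (∀ l ∉ A, a l = 0) ∧ ∑ l ∈ A, a l + 1 = B.card ∧
    ∀ S ⊆ A, S.Nonempty → ∑ l ∈ S, a l + 1 ≤ (nbr E B S).card}

/-- The ways to cut the vertices of a bipartite graph into two parts such that the only edge from
the left of the first part to the right of the second one is the additional edge `e`. -/
def cuts (A : Finset α) (B : Finset β) (E : Finset (α × β)) (e : α × β) :
    Set (Finset α × Finset β) :=
  {p | p.1 ⊆ A ∧ p.2 ⊆ B ∧ e.1 ∈ p.1 ∧ e.2 ∉ p.2 ∧ ∀ l ∈ p.1, ∀ r ∈ B, r ∉ p.2 → (l, r) ∉ E}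

variable {A : Finset α} {B : Finset β} {E : Finset (α × β)} {e : α × β}

theorem mem_nbr {S : Finset α} {r : β} : r ∈ nbr E B S ↔ r ∈ B ∧ ∃ l ∈ S, (l, r) ∈ E := by
  simp [nbr]

theorem nbr_union (S T : Finset α) : nbr E B (S ∪ T) = nbr E B S ∪ nbr E B T := by
  ext r
  simp only [mem_nbr, Finset.mem_union]
  grind

theorem nbr_insert_of_notMem {S : Finset α} (h : e.1 ∉ S) :
    nbr (insert e E) B S = nbr E B S := by
  ext r
  simp only [mem_nbr, Finset.mem_insert]
  grind

theorem nbr_insert_of_mem {S : Finset α} (h : e.1 ∈ S) (he : e.2 ∈ B) :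
    nbr (insert e E) B S = insert e.2 (nbr E B S) := by
  ext r
  simp only [mem_nbr, Finset.mem_insert]
  grind

theorem nbr_subset_nbr_insert (S : Finset α) : nbr E B S ⊆ nbr (insert e E) B S := by
  intro r
  simp only [mem_nbr, Finset.mem_insert]
  grind

theorem nbr_nbr {S T : Finset α} (h : T ⊆ S) : nbr E (nbr E B S) T = nbr E B T := by
  ext r
  simp only [mem_nbr]
  grind

theorem nbr_union_subset (S T : Finset α) :
    nbr E B (S ∪ T) ⊆ nbr E B S ∪ nbr E (B \ nbr E B S) T := by
  intro r
  simp only [mem_nbr, Finset.mem_union, Finset.mem_sdiff]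
  grind

theorem nbr_inter_subset (S T : Finset α) : nbr E B (S ∩ T) ⊆ nbr E B S ∩ nbr E B T := by
  intro r
  simp only [mem_nbr, Finset.mem_inter]
  grind

theorem hypertrees_subset_insert : hypertrees A B E ⊆ hypertrees A B (insert e E) := by
  rintro a ⟨h0, h1, h2⟩
  refine ⟨h0, h1, fun S hS hne => (h2 S hS hne).trans ?_⟩
  exact Int.ofNat_le.2 (Finset.card_le_card (nbr_subset_nbr_insert S))

theorem hypertrees_insert_of_notMem (he : e ∉ A ×ˢ B) :
    hypertrees A B (insert e E) = hypertrees A B E := by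
  have key : ∀ S ⊆ A, nbr (insert e E) B S = nbr E B S := by
    intro S hS
    ext r
    simp only [mem_nbr, Finset.mem_insert]
    simp only [Finset.mem_product] at he
    grind
  ext a
  simp only [hypertrees, Set.mem_ofPred_eq]
  refine and_congr_right fun _ => and_congr_right fun _ => ?_
  exact forall_congr' fun S => forall_congr' fun hS => by rw [key S hS]

/-- Two hypertrees on the parts of a cut are glued along the edge `e`. -/
def glue (e : α × β) (a a' : α → ℤ) : α → ℤ := a + a' + Pi.single e.1 1

omit [DecidableEq β] in
theorem sum_glue (a a' : α → ℤ) (S : Finset α) :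
    ∑ l ∈ S, glue e a a' l = ∑ l ∈ S, a l + ∑ l ∈ S, a' l + if e.1 ∈ S then 1 else 0 := by
  simp [glue, Finset.sum_add_distrib, Finset.sum_pi_single']

theorem sum_eq_sum_inter {a : α → ℤ} {A : Finset α} (h : ∀ l ∉ A, a l = 0) (S : Finset α) :
    ∑ l ∈ S, a l = ∑ l ∈ S ∩ A, a l := by
  symm
  apply Finset.sum_subset Finset.inter_subset_left
  intro l hl hl'
  exact h l fun h => hl' (Finset.mem_inter.2 ⟨hl, h⟩)

theorem sum_inter_add_le {J : Finset β} {S : Finset α} {a : α → ℤ} (ha : a ∈ hypertrees S J E)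
    (T : Finset α) :
    ∑ l ∈ T, a l + (if (T ∩ S).Nonempty then 1 else 0) ≤ (nbr E J (T ∩ S)).card := by
  rw [sum_eq_sum_inter ha.1]
  split_ifs with h
  · exact ha.2.2 _ Finset.inter_subset_right h
  · simp [Finset.not_nonempty_iff_eq_empty.1 h]

theorem card_nbr_inter_add_le {S T : Finset α} {J : Finset β} (hJ : J ⊆ B) :
    (nbr E J (T ∩ S)).card + (nbr E (B \ J) (T ∩ (A \ S))).card ≤ (nbr E B T).card := by
  rw [← Finset.card_union_of_disjoint]
  · apply Finset.card_le_card
    intro r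
    simp only [mem_nbr, Finset.mem_union, Finset.mem_inter, Finset.mem_sdiff]
    grind
  · rw [Finset.disjoint_left]
    intro r
    simp only [mem_nbr, Finset.mem_sdiff]
    grind

theorem glue_mem_hypertrees (he : e ∈ A ×ˢ B) {p : Finset α × Finset β}
    (hp : p ∈ cuts A B E e) {a a' : α → ℤ} (ha : a ∈ hypertrees p.1 p.2 E)
    (ha' : a' ∈ hypertrees (A \ p.1) (B \ p.2) E) :
    glue e a a' ∈ hypertrees A B (insert e E) := by
  obtain ⟨S, J⟩ := p
  obtain ⟨hS, hJ, hl, hr, -⟩ := hp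
  simp only at *
  rw [Finset.mem_product] at he
  refine ⟨fun l hlA => ?_, ?_, fun T hT hne => ?_⟩
  · have h1 : l ∉ S := fun h => hlA (hS h)
    have h2 : l ≠ e.1 := by rintro rfl; exact hlA he.1
    simp [glue, ha.1 l h1, ha'.1 l (by simp [hlA]), h2]
  · rw [sum_glue, if_pos he.1, sum_eq_sum_inter ha.1, sum_eq_sum_inter ha'.1,
      Finset.inter_eq_right.2 hS, Finset.inter_eq_right.2 Finset.sdiff_subset]
    have h1 := ha.2.1
    have h2 := ha'.2.1
    have h3 := Finset.card_sdiff_add_card_eq_card hJ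
    push_cast [← h3]
    linarith
  · have h1 := sum_inter_add_le ha T
    have h2 := sum_inter_add_le ha' T
    have h3 : T ∩ S ≠ ∅ ∨ T ∩ (A \ S) ≠ ∅ := by
      obtain ⟨t, ht⟩ := hne
      by_cases hts : t ∈ S
      · exact .inl (Finset.ne_empty_of_mem (Finset.mem_inter.2 ⟨ht, hts⟩))
      · exact .inr (Finset.ne_empty_of_mem
          (Finset.mem_inter.2 ⟨ht, Finset.mem_sdiff.2 ⟨hT ht, hts⟩⟩))
    have h4 := card_nbr_inter_add_le (E := E) (A := A) (S := S) (T := T) hJ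
    have h5 := Finset.card_le_card (nbr_subset_nbr_insert (E := E) (B := B) (e := e) T)
    rw [sum_glue]
    by_cases hlT : e.1 ∈ T
    · have h6 : (T ∩ S).Nonempty := ⟨e.1, Finset.mem_inter.2 ⟨hlT, hl⟩⟩
      rw [if_pos h6] at h1
      rw [if_pos hlT]
      split_ifs at h2 with h7
      · omega
      · have h8 : insert e.2 (nbr E J (T ∩ S)) ⊆ nbr (insert e E) B T := by
          intro r
          simp only [mem_nbr, Finset.mem_insert, Finset.mem_inter]
          grind
        have h9 := Finset.card_le_card h8
        rw [Finset.card_insert_of_notMem (fun h => hr (mem_nbr.1 h).1)] at h9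
        simp only [Finset.not_nonempty_iff_eq_empty] at h7
        simp [h7, nbr] at h2
        omega
    · rw [if_neg hlT]
      simp only [Finset.nonempty_iff_ne_empty] at h1 h2
      rcases h3 with h3 | h3
      · rw [if_pos h3] at h1
        split_ifs at h2 <;> omega
      · rw [if_pos h3] at h2
        split_ifs at h1 <;> omega

theorem nbr_eq_of_mem_cuts {p : Finset α × Finset β} (hp : p ∈ cuts A B E e) {a : α → ℤ}
    (ha : a ∈ hypertrees p.1 p.2 E) : nbr E B p.1 = p.2 := by
  obtain ⟨S, J⟩ := p
  obtain ⟨-, hJ, hl, -, hE⟩ := hp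
  simp only at *
  have h1 : nbr E B S ⊆ J := by
    intro r
    simp only [mem_nbr]
    grind
  refine Finset.eq_of_subset_of_card_le h1 ?_
  have h2 := ha.2.2 S subset_rfl ⟨_, hl⟩
  have h3 : nbr E J S ⊆ nbr E B S := Finset.filter_subset_filter _ hJ
  have h4 := Finset.card_le_card h3
  have h5 := ha.2.1
  omega

theorem sum_glue_fst {p : Finset α × Finset β} (hp : p ∈ cuts A B E e) {a a' : α → ℤ}
    (ha : a ∈ hypertrees p.1 p.2 E) (ha' : a' ∈ hypertrees (A \ p.1) (B \ p.2) E) :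
    ∑ l ∈ p.1, glue e a a' l = p.2.card := by
  rw [sum_glue, if_pos hp.2.2.1, ← ha.2.1, Finset.sum_eq_zero (f := a'), add_zero]
  exact fun l hl => ha'.1 l fun h => (Finset.mem_sdiff.1 h).2 hl

theorem subset_of_card_nbr_le {p : Finset α × Finset β} (hp : p ∈ cuts A B E e) {a a' : α → ℤ}
    (ha : a ∈ hypertrees p.1 p.2 E) (ha' : a' ∈ hypertrees (A \ p.1) (B \ p.2) E)
    {T : Finset α} (hT : T ⊆ A) (hlT : e.1 ∈ T)
    (h : ((nbr E B T).card : ℤ) ≤ ∑ l ∈ T, glue e a a' l) : T ⊆ p.1 := by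
  rw [sum_glue, if_pos hlT] at h
  have h1 := sum_inter_add_le ha T
  have h2 := sum_inter_add_le ha' T
  have h3 := card_nbr_inter_add_le (E := E) (A := A) (S := p.1) (T := T) hp.2.1
  rw [if_pos ⟨e.1, Finset.mem_inter.2 ⟨hlT, hp.2.2.1⟩⟩] at h1
  split_ifs at h2 with h4
  · omega
  · intro t ht
    by_contra hts
    exact h4 ⟨t, Finset.mem_inter.2 ⟨ht, Finset.mem_sdiff.2 ⟨hT ht, hts⟩⟩⟩

theorem glue_injective {p q : Finset α × Finset β} (hp : p ∈ cuts A B E e)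
    (hq : q ∈ cuts A B E e) {a a' c c' : α → ℤ}
    (ha : a ∈ hypertrees p.1 p.2 E) (ha' : a' ∈ hypertrees (A \ p.1) (B \ p.2) E)
    (hc : c ∈ hypertrees q.1 q.2 E) (hc' : c' ∈ hypertrees (A \ q.1) (B \ q.2) E)
    (h : glue e a a' = glue e c c') : p = q ∧ a = c ∧ a' = c' := by
  have hpn := nbr_eq_of_mem_cuts hp ha
  have hqn := nbr_eq_of_mem_cuts hq hc
  have h1 : p.1 = q.1 := by
    apply Finset.Subset.antisymm
    · apply subset_of_card_nbr_le hq hc hc' hp.1 hp.2.2.1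
      rw [← h, hpn, sum_glue_fst hp ha ha']
    · apply subset_of_card_nbr_le hp ha ha' hq.1 hq.2.2.1
      rw [h, hqn, sum_glue_fst hq hc hc']
  have h2 : p = q := Prod.ext h1 (by rw [← hpn, ← hqn, h1])
  subst h2
  have h3 : ∀ l, a l + a' l = c l + c' l := by
    intro l
    have := congrFun h l
    simp only [glue, Pi.add_apply] at this
    omega
  refine ⟨rfl, ?_, ?_⟩ <;> funext l <;> by_cases hl : l ∈ p.1
  · have h4 := ha'.1 l (by simp [hl])
    have h5 := hc'.1 l (by simp [hl])
    have := h3 l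
    omega
  · rw [ha.1 l hl, hc.1 l hl]
  · rw [ha'.1 l (by simp [hl]), hc'.1 l (by simp [hl])]
  · have h4 := ha.1 l hl
    have h5 := hc.1 l hl
    have := h3 l
    omega

theorem glue_notMem_hypertrees {p : Finset α × Finset β} (hp : p ∈ cuts A B E e) {a a' : α → ℤ}
    (ha : a ∈ hypertrees p.1 p.2 E) (ha' : a' ∈ hypertrees (A \ p.1) (B \ p.2) E) :
    glue e a a' ∉ hypertrees A B E := by
  intro h
  have h1 := h.2.2 p.1 hp.1 ⟨_, hp.2.2.1⟩
  rw [sum_glue_fst hp ha ha', nbr_eq_of_mem_cuts hp ha] at h1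
  omega

theorem exists_eq_glue (he : e ∈ A ×ˢ B) {a : α → ℤ} (ha : a ∈ hypertrees A B (insert e E))
    (ha' : a ∉ hypertrees A B E) :
    ∃ p ∈ cuts A B E e, ∃ c ∈ hypertrees p.1 p.2 E, ∃ c' ∈ hypertrees (A \ p.1) (B \ p.2) E,
      glue e c c' = a := by
  rw [Finset.mem_product] at he
  have hle : ∀ T ⊆ A, e.1 ∈ T → ∑ l ∈ T, a l ≤ (nbr E B T).card := by
    intro T hT hl
    have h1 := ha.2.2 T hT ⟨_, hl⟩
    rw [nbr_insert_of_mem hl he.2] at h1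
    have h2 := Finset.card_insert_le e.2 (nbr E B T)
    omega
  let F := A.powerset.filter fun T => e.1 ∈ T ∧ ∑ l ∈ T, a l = (nbr E B T).card
  have hF : ∀ {T}, T ∈ F ↔ T ⊆ A ∧ e.1 ∈ T ∧ ∑ l ∈ T, a l = (nbr E B T).card := by
    simp [F]
  have hFne : F.Nonempty := by
    by_contra hF0
    apply ha'
    refine ⟨ha.1, ha.2.1, fun T hT hne => ?_⟩
    by_cases hl : e.1 ∈ T
    · have h1 := hle T hT hl
      have h2 : ∑ l ∈ T, a l ≠ (nbr E B T).card := fun h => hF0 ⟨T, hF.2 ⟨hT, hl, h⟩⟩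
      omega
    · have h1 := ha.2.2 T hT hne
      rwa [nbr_insert_of_notMem hl] at h1
  have hFu : ∀ T ∈ F, ∀ U ∈ F, T ∪ U ∈ F := by
    intro T hT U hU
    rw [hF] at *
    obtain ⟨hT, hlT, haT⟩ := hT
    obtain ⟨hU, hlU, haU⟩ := hU
    refine ⟨Finset.union_subset hT hU, Finset.mem_union_left _ hlT, ?_⟩
    have h1 := hle (T ∪ U) (Finset.union_subset hT hU) (Finset.mem_union_left _ hlT)
    have h2 := hle (T ∩ U) (Finset.inter_subset_left.trans hT) (Finset.mem_inter.2 ⟨hlT, hlU⟩)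
    have h3 := Finset.sum_union_inter (s₁ := T) (s₂ := U) (f := a)
    have h4 := Finset.card_union_add_card_inter (nbr E B T) (nbr E B U)
    rw [← nbr_union] at h4
    have h5 := Finset.card_le_card (nbr_inter_subset (E := E) (B := B) T U)
    omega
  obtain ⟨S, hS, hmax⟩ := F.exists_max_image Finset.card hFne
  have hmax' : ∀ T ∈ F, T ⊆ S := by
    intro T hT
    have h1 := hmax _ (hFu T hT S hS)
    exact Finset.union_eq_right.1 (Finset.eq_of_subset_of_card_le Finset.subset_union_right h1).symm
  obtain ⟨hSA, hlS, haS⟩ := hF.1 hS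
  have hJB : nbr E B S ⊆ B := Finset.filter_subset _ _
  have hrS : e.2 ∉ nbr E B S := by
    intro h
    have h1 := ha.2.2 S hSA ⟨_, hlS⟩
    rw [nbr_insert_of_mem hlS he.2, Finset.insert_eq_of_mem h] at h1
    omega
  let c : α → ℤ := fun l => if l ∈ S then a l - (Pi.single e.1 1 : α → ℤ) l else 0
  let c' : α → ℤ := fun l => if l ∈ S then 0 else a l
  have hc : ∀ T ⊆ S, ∑ l ∈ T, c l = ∑ l ∈ T, a l - if e.1 ∈ T then 1 else 0 := by
    intro T hT
    rw [← Finset.sum_pi_single', ← Finset.sum_sub_distrib]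
    refine Finset.sum_congr rfl fun l hl => ?_
    simp only [c, if_pos (hT hl)]
  have hc' : ∀ T ⊆ A \ S, ∑ l ∈ T, c' l = ∑ l ∈ T, a l := by
    intro T hT
    refine Finset.sum_congr rfl fun l hl => ?_
    simp only [c', if_neg (Finset.mem_sdiff.1 (hT hl)).2]
  refine ⟨(S, nbr E B S), ⟨hSA, hJB, hlS, hrS, ?_⟩, c, ⟨?_, ?_, ?_⟩, c', ⟨?_, ?_, ?_⟩, ?_⟩
  · intro l hl r hr hr' hlr
    exact hr' (mem_nbr.2 ⟨hr, l, hl, hlr⟩)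
  · intro l hl
    simp [c, hl]
  · simp only
    rw [hc S subset_rfl, if_pos hlS, haS]
    ring
  · intro T hT hne
    simp only at hT ⊢
    rw [hc T hT, nbr_nbr hT]
    split_ifs with hl
    · have := hle T (hT.trans hSA) hl
      omega
    · have := ha.2.2 T (hT.trans hSA) hne
      rw [nbr_insert_of_notMem hl] at this
      omega
  · intro l hl
    simp only [c']
    split_ifs with h
    · rfl
    · exact ha.1 l fun h' => hl (Finset.mem_sdiff.2 ⟨h', h⟩)
  · simp only
    rw [hc' _ subset_rfl]
    have h1 := ha.2.1
    have h2 := Finset.card_sdiff_add_card_eq_card hJB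
    have h3 := Finset.sum_sdiff (f := a) hSA
    omega
  · intro T hT hne
    simp only at hT ⊢
    rw [hc' T hT]
    have hTA : S ∪ T ⊆ A := Finset.union_subset hSA (hT.trans Finset.sdiff_subset)
    have hdis : Disjoint S T := Finset.disjoint_left.2 fun l hl hl' =>
      (Finset.mem_sdiff.1 (hT hl')).2 hl
    have h1 : S ∪ T ∉ F := by
      intro h
      obtain ⟨t, ht⟩ := hne
      exact (Finset.mem_sdiff.1 (hT ht)).2 (hmax' _ h (Finset.mem_union_right _ ht))
    have h2 := hle _ hTA (Finset.mem_union_left _ hlS)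
    have h3 : ∑ l ∈ S ∪ T, a l ≠ (nbr E B (S ∪ T)).card := fun h =>
      h1 (hF.2 ⟨hTA, Finset.mem_union_left _ hlS, h⟩)
    rw [Finset.sum_union hdis] at h2 h3
    have h4 := (Finset.card_le_card (nbr_union_subset (E := E) (B := B) S T)).trans
      (Finset.card_union_le _ _)
    omega
  · funext l
    simp only [glue, c, c', Pi.add_apply]
    by_cases hl : l ∈ S
    · simp [hl]
    · have : l ≠ e.1 := by rintro rfl; exact hl hlS
      simp [hl, this]

/-- Deletion recursion for hypertrees. -/
noncomputable def hypertreesInsertEquiv (he : e ∈ A ×ˢ B) :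
    hypertrees A B E ⊕ (Σ p : cuts A B E e,
      hypertrees p.1.1 p.1.2 E × hypertrees (A \ p.1.1) (B \ p.1.2) E) ≃
      hypertrees A B (insert e E) :=
  Equiv.ofBijective
    (Sum.elim (fun a => ⟨a.1, hypertrees_subset_insert a.2⟩)
      fun x => ⟨glue e x.2.1.1 x.2.2.1, glue_mem_hypertrees he x.1.2 x.2.1.2 x.2.2.2⟩) <| by
    constructor
    · rintro (⟨a, ha⟩ | ⟨⟨p, hp⟩, ⟨a, ha⟩, ⟨a', ha'⟩⟩)
        (⟨c, hc⟩ | ⟨⟨q, hq⟩, ⟨c, hc⟩, ⟨c', hc'⟩⟩) h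
      · simpa using h
      · simp only [Sum.elim_inl, Sum.elim_inr, Subtype.mk.injEq] at h
        exact absurd (h ▸ ha) (glue_notMem_hypertrees hq hc hc')
      · simp only [Sum.elim_inl, Sum.elim_inr, Subtype.mk.injEq] at h
        exact absurd (h ▸ hc) (glue_notMem_hypertrees hp ha ha')
      · simp only [Sum.elim_inr, Subtype.mk.injEq] at h
        obtain ⟨rfl, rfl, rfl⟩ := glue_injective hp hq ha ha' hc hc' h
        rfl
    · rintro ⟨a, ha⟩
      by_cases ha' : a ∈ hypertrees A B E
      · exact ⟨.inl ⟨a, ha'⟩, rfl⟩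
      · obtain ⟨p, hp, c, hc, c', hc', h⟩ := exists_eq_glue he ha ha'
        exact ⟨.inr ⟨⟨p, hp⟩, ⟨c, hc⟩, ⟨c', hc'⟩⟩, Subtype.ext h⟩

/-- Complementing both parts of a cut swaps the roles of the two sides. -/
def cutsSwapEquiv (he : e ∈ A ×ˢ B) :
    cuts A B E e ≃ cuts B A (E.image Prod.swap) e.swap where
  toFun p := ⟨(B \ p.1.2, A \ p.1.1), by
    obtain ⟨⟨S, J⟩, h1, h2, h3, h4, h5⟩ := p
    rw [Finset.mem_product] at he
    refine ⟨Finset.sdiff_subset, Finset.sdiff_subset, ?_, ?_, ?_⟩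
    · simpa using ⟨he.2, h4⟩
    · simp only [Prod.snd_swap, Finset.mem_sdiff, not_and, not_not]
      exact fun _ => h3
    · intro r hr l hl hl' hrl
      simp only [Finset.mem_image, Prod.exists, Prod.swap_prod_mk, Prod.mk.injEq] at hrl
      simp only [Finset.mem_sdiff, not_and, not_not] at hr hl'
      obtain ⟨l', r', h, rfl, rfl⟩ := hrl
      exact h5 l' (hl' hl) r' hr.1 hr.2 h⟩
  invFun p := ⟨(A \ p.1.2, B \ p.1.1), by
    obtain ⟨⟨J, S⟩, h1, h2, h3, h4, h5⟩ := p
    rw [Finset.mem_product] at he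
    refine ⟨Finset.sdiff_subset, Finset.sdiff_subset, ?_, ?_, ?_⟩
    · simpa using ⟨he.1, h4⟩
    · simp only [Finset.mem_sdiff, not_and, not_not]
      exact fun _ => h3
    · intro l hl r hr hr' hlr
      simp only [Finset.mem_sdiff, not_and, not_not] at hl hr'
      exact h5 r (hr' hr) l hl.1 hl.2 (Finset.mem_image.2 ⟨_, hlr, rfl⟩)⟩
  left_inv p := by
    obtain ⟨⟨S, J⟩, h1, h2, h⟩ := p
    simp only at h1 h2
    simp [h1, h2]
  right_inv p := by
    obtain ⟨⟨J, S⟩, h1, h2, h⟩ := p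
    simp only at h1 h2
    simp [h1, h2]

theorem hypertrees_empty_iff {a : α → ℤ} : a ∈ hypertrees A B ∅ ↔
    (A = ∅ ∧ B.card = 1 ∧ a = 0) ∨ (B = ∅ ∧ ∃ l, A = {l} ∧ a = Pi.single l (-1)) := by
  have h0 : ∀ S : Finset α, nbr (∅ : Finset (α × β)) B S = ∅ := fun S => by simp [nbr]
  constructor
  · rintro ⟨h1, h2, h3⟩
    simp only [h0, Finset.card_empty, Nat.cast_zero] at h3
    rcases A.eq_empty_or_nonempty with rfl | hA
    · refine .inl ⟨rfl, ?_, funext fun l => h1 l (by simp)⟩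
      simpa [eq_comm] using h2
    · have h4 := h3 A subset_rfl hA
      have h5 : B.card = 0 := by omega
      rw [h5] at h2
      have h6 : ∑ l ∈ A, a l ≤ ∑ l ∈ A, (-1) := Finset.sum_le_sum fun l hl => by
        have := h3 {l} (by simpa using hl) (by simp)
        simp only [Finset.sum_singleton] at this
        omega
      have h7 := hA.card_pos
      simp only [Finset.sum_neg_distrib, Finset.sum_const, nsmul_eq_mul, mul_one] at h6
      obtain ⟨l, rfl⟩ := Finset.card_eq_one.1 (by omega : A.card = 1)
      refine .inr ⟨Finset.card_eq_zero.1 h5, l, rfl, ?_⟩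
      funext k
      by_cases hk : k = l
      · subst hk
        simp only [Finset.sum_singleton, Nat.cast_zero] at h2
        simp only [Pi.single_eq_same]
        omega
      · rw [h1 k (by simpa using hk)]
        simp [hk]
  · rintro (⟨rfl, hB, rfl⟩ | ⟨rfl, l, rfl, rfl⟩)
    · refine ⟨by simp, by simp [hB], fun S hS hne => ?_⟩
      rw [Finset.subset_empty.1 hS] at hne
      simp at hne
    · refine ⟨fun k hk => ?_, by simp, fun S hS hne => ?_⟩
      · simp only [Finset.mem_singleton] at hk
        simp [hk]
      · rw [(Finset.subset_singleton_iff.1 hS).resolve_left hne.ne_empty]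
        simp

theorem nonempty_hypertrees_empty_equiv (A : Finset α) (B : Finset β) :
    Nonempty (hypertrees A B ∅ ≃ hypertrees B A ∅) := by
  by_cases h : A.card + B.card = 1
  · rcases (by omega : (A.card = 0 ∧ B.card = 1) ∨ A.card = 1 ∧ B.card = 0) with ⟨h1, h2⟩ | ⟨h1, h2⟩
    · have hA := Finset.card_eq_zero.1 h1
      obtain ⟨r, rfl⟩ := Finset.card_eq_one.1 h2
      subst hA
      have e1 : hypertrees (∅ : Finset α) {r} ∅ = {0} := by
        ext a; simp [hypertrees_empty_iff]
      have e2 : hypertrees {r} (∅ : Finset α) ∅ = {Pi.single r (-1)} := by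
        ext a; simp [hypertrees_empty_iff]
      rw [e1, e2]
      exact ⟨Equiv.ofUnique _ _⟩
    · have hB := Finset.card_eq_zero.1 h2
      obtain ⟨r, rfl⟩ := Finset.card_eq_one.1 h1
      subst hB
      have e1 : hypertrees (∅ : Finset β) {r} ∅ = {0} := by
        ext a; simp [hypertrees_empty_iff]
      have e2 : hypertrees {r} (∅ : Finset β) ∅ = {Pi.single r (-1)} := by
        ext a; simp [hypertrees_empty_iff]
      rw [e1, e2]
      exact ⟨Equiv.ofUnique _ _⟩
  · have e1 : IsEmpty (hypertrees A B ∅) := by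
      refine ⟨fun a => h ?_⟩
      rcases hypertrees_empty_iff.1 a.2 with ⟨rfl, h1, -⟩ | ⟨rfl, l, rfl, -⟩
      · simp [h1]
      · simp
    have e2 : IsEmpty (hypertrees B A ∅) := by
      refine ⟨fun a => h ?_⟩
      rcases hypertrees_empty_iff.1 a.2 with ⟨rfl, h1, -⟩ | ⟨rfl, l, rfl, -⟩
      · simp [h1]
      · simp
    exact ⟨Equiv.equivOfIsEmpty _ _⟩

/-- A bipartite graph has as many hypertrees on the left as on the right. -/
theorem nonempty_hypertrees_equiv_swap (E : Finset (α × β)) : ∀ (A : Finset α) (B : Finset β),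
    Nonempty (hypertrees A B E ≃ hypertrees B A (E.image Prod.swap)) := by
  induction E using Finset.induction_on with
  | empty => simpa using nonempty_hypertrees_empty_equiv
  | insert e E _ ih =>
    intro A B
    rw [Finset.image_insert]
    by_cases he : e ∈ A ×ˢ B
    · have he' : e.swap ∈ B ×ˢ A := by
        rw [Finset.mem_product] at he ⊢
        exact ⟨he.2, he.1⟩
      refine ⟨(hypertreesInsertEquiv he).symm.trans
        ((Equiv.sumCongr (ih A B).some ?_).trans (hypertreesInsertEquiv he'))⟩
      refine Equiv.sigmaCongr (cutsSwapEquiv he) fun p => ?_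
      refine (Equiv.prodComm _ _).trans (Equiv.prodCongr (ih _ _).some ?_)
      refine (ih _ _).some.trans (Equiv.setCongr ?_)
      simp only [cutsSwapEquiv, Equiv.coe_fn_mk]
      rw [Finset.sdiff_sdiff_eq_self p.2.1, Finset.sdiff_sdiff_eq_self p.2.2.1]
    · have he' : e.swap ∉ B ×ˢ A := by
        rw [Finset.mem_product] at he ⊢
        exact fun h => he ⟨h.2, h.1⟩
      rw [hypertrees_insert_of_notMem he, hypertrees_insert_of_notMem he']
      exact ih A B

end Hypertrees

section Simplices

variable {N : ℕ}

theorem coordSimplex_nonempty {J : Finset (Fin N)} (h : J.Nonempty) :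
    (coordSimplex N J).Nonempty :=
  let ⟨i, hi⟩ := h
  ⟨_, subset_convexHull ℝ _ ⟨i, hi, rfl⟩⟩

theorem isLinearMap_sum_apply (J : Finset (Fin N)) :
    IsLinearMap ℝ fun p : Fin N → ℝ => ∑ j ∈ J, p j :=
  ⟨fun p q => by simp [Finset.sum_add_distrib], fun c p => by simp [Finset.mul_sum]⟩

theorem sum_stdVec (J : Finset (Fin N)) (i : Fin N) :
    ∑ j ∈ J, stdVec N i j = if i ∈ J then 1 else 0 := by
  simp [stdVec]

theorem sum_univ_of_mem_coordSimplex {K : Finset (Fin N)} {p : Fin N → ℝ}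
    (hp : p ∈ coordSimplex N K) : ∑ j, p j = 1 := by
  refine convexHull_min ?_ (convex_hyperplane (isLinearMap_sum_apply Finset.univ) 1) hp
  rintro _ ⟨i, -, rfl⟩
  simp [sum_stdVec]

theorem sum_le_of_mem_coordSimplex {K : Finset (Fin N)} {p : Fin N → ℝ}
    (hp : p ∈ coordSimplex N K) (J : Finset (Fin N)) :
    ∑ j ∈ J, p j ≤ if (K ∩ J).Nonempty then 1 else 0 := by
  refine convexHull_min ?_ (convex_halfSpace_le (isLinearMap_sum_apply J) _) hp
  rintro _ ⟨i, hi, rfl⟩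
  simp only [Set.mem_ofPred_eq, sum_stdVec]
  by_cases hJ : i ∈ J
  · rw [if_pos hJ, if_pos ⟨i, Finset.mem_inter.2 ⟨hi, hJ⟩⟩]
  · rw [if_neg hJ]
    split_ifs <;> norm_num

theorem sum_mem_smul_of_convex {F : Type*} [AddCommGroup F] [Module ℝ F] {s : Set F}
    (hs : Convex ℝ s) (hne : s.Nonempty) (k : ℕ) (f : Fin k → F) (hf : ∀ i, f i ∈ s) :
    ∑ i, f i ∈ (k : ℝ) • s := by
  rcases Nat.eq_zero_or_pos k with rfl | hk
  · simp [Set.zero_smul_set hne]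
  · have hk' : (k : ℝ) ≠ 0 := by positivity
    refine ⟨∑ i, (k : ℝ)⁻¹ • f i, hs.sum_mem (fun _ _ => by positivity) ?_ fun i _ => hf i, ?_⟩
    · simp [hk']
    · simp only
      rw [← Finset.smul_sum, smul_inv_smul₀ hk']

end Simplices

section Permutohedron

variable {N m : ℕ}

/-- The bipartite graph joining `y i` copies of `i` to the elements of `I i`. -/
def copiesGraph (I : Fin m → Finset (Fin N)) (y : Fin m → ℕ) :
    Finset ((Σ i : Fin m, Fin (y i)) × Fin N) :=
  Finset.univ.filter fun p => p.2 ∈ I p.1.1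

variable {I : Fin m → Finset (Fin N)} {y : Fin m → ℕ}

theorem card_nbr_copiesGraph_swap (J : Finset (Fin N)) :
    (nbr ((copiesGraph I y).image Prod.swap) Finset.univ J).card =
      ∑ i, if (I i ∩ J).Nonempty then y i else 0 := by
  have h : nbr ((copiesGraph I y).image Prod.swap) Finset.univ J =
      Finset.univ.filter fun l : Σ i, Fin (y i) => (I l.1 ∩ J).Nonempty := by
    ext l
    simp only [mem_nbr, copiesGraph, Finset.mem_image, Finset.mem_filter, Finset.mem_univ,
      true_and, Finset.Nonempty, Finset.mem_inter, Prod.exists, Prod.swap_prod_mk, Prod.mk.injEq]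
    grind
  rw [h, Finset.card_filter, Fintype.sum_sigma]
  refine Finset.sum_congr rfl fun i _ => ?_
  dsimp only
  split_ifs <;> simp

theorem sum_eq_of_mem_sum_simplices {x : Fin N → ℝ}
    (hx : x ∈ ∑ i : Fin m, (y i : ℝ) • coordSimplex N (I i)) : ∑ j, x j = ∑ i, (y i : ℝ) := by
  obtain ⟨g, hg, rfl⟩ := (Set.mem_fintype_sum _ _).1 hx
  simp only [Finset.sum_apply]
  rw [Finset.sum_comm]
  refine Finset.sum_congr rfl fun i _ => ?_
  obtain ⟨p, hp, h⟩ := hg i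
  simp only at h
  simp only [← h, Pi.smul_apply, smul_eq_mul]
  rw [← Finset.mul_sum, sum_univ_of_mem_coordSimplex hp, mul_one]

theorem sum_le_of_mem_sum_simplices {x : Fin N → ℝ}
    (hx : x ∈ ∑ i : Fin m, (y i : ℝ) • coordSimplex N (I i)) (J : Finset (Fin N)) :
    ∑ j ∈ J, x j ≤ ∑ i, if (I i ∩ J).Nonempty then (y i : ℝ) else 0 := by
  obtain ⟨g, hg, rfl⟩ := (Set.mem_fintype_sum _ _).1 hx
  simp only [Finset.sum_apply]
  rw [Finset.sum_comm]
  refine Finset.sum_le_sum fun i _ => ?_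
  obtain ⟨p, hp, h⟩ := hg i
  simp only at h
  simp only [← h, Pi.smul_apply, smul_eq_mul]
  rw [← Finset.mul_sum]
  refine (mul_le_mul_of_nonneg_left (sum_le_of_mem_coordSimplex hp J) (Nat.cast_nonneg _)).trans ?_
  split_ifs <;> simp

/-- The integral points of a generalized permutohedron are those satisfying its defining
inequalities. -/
theorem mem_sum_simplices (hI : ∀ i, (I i).Nonempty) {c : Fin N → ℤ}
    (hsum : ∑ j, c j = ∑ i, (y i : ℤ))
    (hle : ∀ J : Finset (Fin N), J.Nonempty →
      ∑ j ∈ J, c j ≤ (nbr ((copiesGraph I y).image Prod.swap) Finset.univ J).card) :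
    (fun j => (c j : ℝ)) ∈ ∑ i : Fin m, (y i : ℝ) • coordSimplex N (I i) := by
  have hle' : ∀ J : Finset (Fin N),
      ∑ j ∈ J, c j ≤ (nbr ((copiesGraph I y).image Prod.swap) Finset.univ J).card := by
    intro J
    rcases J.eq_empty_or_nonempty with rfl | hJ
    · simp
    · exact hle J hJ
  have hc : ∀ j, 0 ≤ c j := by
    intro j
    have h1 := hle' (Finset.univ.erase j)
    have h2 := Finset.add_sum_erase Finset.univ c (Finset.mem_univ j)
    have h3 : (nbr ((copiesGraph I y).image Prod.swap) Finset.univ (Finset.univ.erase j)).card ≤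
        ∑ i, y i := by
      rw [card_nbr_copiesGraph_swap]
      exact Finset.sum_le_sum fun i _ => by split_ifs <;> simp
    have h4 : ((∑ i, y i : ℕ) : ℤ) = ∑ i, (y i : ℤ) := by push_cast; rfl
    omega
  lift c to Fin N → ℕ using hc
  let t : (Σ j, Fin (c j)) → Finset (Σ i, Fin (y i)) := fun s =>
    Finset.univ.filter fun l => s.1 ∈ I l.1
  have hall : ∀ s : Finset (Σ j, Fin (c j)), s.card ≤ (s.biUnion t).card := by
    intro s
    have h1 : s ⊆ (s.image Sigma.fst).sigma fun j => (Finset.univ : Finset (Fin (c j))) := by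
      intro x hx
      exact Finset.mem_sigma.2 ⟨Finset.mem_image_of_mem _ hx, Finset.mem_univ _⟩
    have h2 := Finset.card_le_card h1
    rw [Finset.card_sigma] at h2
    simp only [Finset.card_univ, Fintype.card_fin] at h2
    have h3 := hle' (s.image Sigma.fst)
    have h4 : nbr ((copiesGraph I y).image Prod.swap) Finset.univ (s.image Sigma.fst) ⊆
        s.biUnion t := by
      intro l hl
      simp only [mem_nbr, copiesGraph, Finset.mem_image, Finset.mem_filter, Finset.mem_univ,
        true_and, Prod.exists, Prod.swap_prod_mk, Prod.mk.injEq] at hl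
      obtain ⟨_, ⟨x, hx, rfl⟩, l', r, h, rfl, rfl⟩ := hl
      exact Finset.mem_biUnion.2 ⟨x, hx, by simpa [t] using h⟩
    refine h2.trans (le_trans ?_ (Finset.card_le_card h4))
    beta_reduce at h3
    exact_mod_cast h3
  obtain ⟨f, hf, hft⟩ := (Finset.all_card_le_biUnion_card_iff_exists_injective t).1 hall
  have hcard : Fintype.card (Σ j, Fin (c j)) = Fintype.card (Σ i, Fin (y i)) := by
    simp only [Fintype.card_sigma, Fintype.card_fin]
    beta_reduce at hsum
    exact_mod_cast hsum
  let g := Equiv.ofBijective f ((Fintype.bijective_iff_injective_and_card f).2 ⟨hf, hcard⟩)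
  have hg : ∀ l, (g.symm l).1 ∈ I l.1 := by
    intro l
    have h1 := hft (g.symm l)
    have h2 : f (g.symm l) = l := g.apply_symm_apply l
    rw [h2] at h1
    simpa [t] using h1
  rw [Set.mem_fintype_sum]
  refine ⟨fun i => ∑ k, stdVec N (g.symm ⟨i, k⟩).1, fun i => ?_, ?_⟩
  · exact sum_mem_smul_of_convex (convex_convexHull ℝ _) (coordSimplex_nonempty (hI i)) _ _
      fun k => subset_convexHull ℝ _ ⟨_, hg ⟨i, k⟩, rfl⟩
  · rw [← Fintype.sum_sigma (fun l => stdVec N (g.symm l).1),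
      Equiv.sum_comp g.symm (fun s => stdVec N s.1), Fintype.sum_sigma]
    funext j
    simp [stdVec]

theorem mem_trimmed_iff {P : Set (Fin N → ℝ)} (hP : Convex ℝ P) {x : Fin N → ℝ} :
    x ∈ trimmed N P ↔ ∀ j, x + stdVec N j ∈ P := by
  constructor
  · exact fun h j => h _ (subset_convexHull ℝ _ ⟨j, Finset.mem_univ j, rfl⟩)
  · intro h q hq
    refine convexHull_min (t := (fun q => x + q) ⁻¹' P) ?_ (hP.translate_preimage_right x) hq
    rintro _ ⟨j, -, rfl⟩
    exact h j

theorem mem_trimmed_sum_simplices_iff {n : ℕ} {I : Fin m → Finset (Fin (n + 1))}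
    (hI : ∀ i, (I i).Nonempty) (b : Fin (n + 1) → ℤ) :
    (fun i => (b i : ℝ)) ∈
        trimmed (n + 1) (∑ i : Fin m, (y i : ℝ) • coordSimplex (n + 1) (I i)) ↔
      b ∈ hypertrees Finset.univ Finset.univ ((copiesGraph I y).image Prod.swap) := by
  have hP : Convex ℝ (∑ i : Fin m, (y i : ℝ) • coordSimplex (n + 1) (I i)) :=
    convex_sum _ fun i _ => (convex_convexHull ℝ _).smul _
  have hadd : ∀ j, (fun i => (b i : ℝ)) + stdVec (n + 1) j =
      fun i => (((b + Pi.single j 1 : Fin (n + 1) → ℤ) i : ℤ) : ℝ) := by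
    intro j
    funext i
    simp [stdVec, Pi.single_apply]
  have hcard : (Finset.univ : Finset (Σ i, Fin (y i))).card = ∑ i, y i := by simp
  have hsum : ∀ (J : Finset (Fin (n + 1))) (j : Fin (n + 1)),
      ∑ i ∈ J, (b + Pi.single j 1 : Fin (n + 1) → ℤ) i =
        ∑ i ∈ J, b i + if j ∈ J then 1 else 0 := by
    intro J j
    simp [Finset.sum_add_distrib, Finset.sum_pi_single']
  rw [mem_trimmed_iff hP]
  simp only [hadd]
  constructor
  · intro h
    refine ⟨by simp, ?_, fun J _ hne => ?_⟩
    · have h1 := sum_eq_of_mem_sum_simplices (h 0)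
      have h2 := hsum Finset.univ 0
      rw [if_pos (Finset.mem_univ _)] at h2
      rw [← h2, hcard]
      exact_mod_cast h1
    · obtain ⟨j, hj⟩ := hne
      have h1 := sum_le_of_mem_sum_simplices (h j) J
      have h2 := hsum J j
      rw [if_pos hj] at h2
      rw [← h2, card_nbr_copiesGraph_swap]
      have h3 : ((∑ i ∈ J, (b + Pi.single j 1 : Fin (n + 1) → ℤ) i : ℤ) : ℝ) ≤
          ((∑ i, if (I i ∩ J).Nonempty then y i else 0 : ℕ) : ℝ) := by
        push_cast at h1 ⊢
        exact h1
      exact_mod_cast h3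
  · intro h j
    refine mem_sum_simplices hI ?_ fun J hne => ?_
    · rw [hsum, if_pos (Finset.mem_univ _), h.2.1, hcard]
      push_cast
      rfl
    · rw [hsum]
      have := h.2.2 J (Finset.subset_univ _) hne
      split_ifs <;> omega

theorem card_piAntidiag_univ (k s : ℕ) :
    (Finset.piAntidiag (Finset.univ : Finset (Fin k)) s).card = (k + s - 1).choose s := by
  have := Finset.card_finsuppAntidiag_nat_eq_choose (s := (Finset.univ : Finset (Fin k))) s
  simpa [Finset.finsuppAntidiag] using this

theorem hypertrees_copiesGraph_eq_image {n : ℕ} {I : Fin m → Finset (Fin (n + 1))}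
    (hI : ∀ i, (I i).Nonempty) :
    hypertrees Finset.univ Finset.univ (copiesGraph I y) =
      (fun (f : ∀ i, Fin (y i) → ℕ) (l : Σ i, Fin (y i)) => (f l.1 l.2 : ℤ)) ''
        {f | (fun i => ∑ k, f i k) ∈ draconianSeqs n m I} := by
  have hnbr : ∀ (S : Finset (Σ i, Fin (y i))),
      nbr (copiesGraph I y) Finset.univ S = (S.image Sigma.fst).biUnion I := by
    intro S
    ext r
    simp only [mem_nbr, copiesGraph, Finset.mem_filter, Finset.mem_univ, true_and,
      Finset.mem_biUnion, Finset.mem_image]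
    grind
  ext a
  constructor
  · rintro ⟨-, h1, h2⟩
    rw [Finset.card_univ, Fintype.card_fin] at h1
    have ha : ∀ l, 0 ≤ a l := by
      intro l
      have h3 := Finset.add_sum_erase Finset.univ a (Finset.mem_univ l)
      rcases (Finset.univ.erase l).eq_empty_or_nonempty with h4 | h4
      · rw [h4, Finset.sum_empty] at h3
        omega
      · have h5 := h2 _ (Finset.subset_univ _) h4
        have h6 := Finset.card_le_univ (nbr (copiesGraph I y) Finset.univ (Finset.univ.erase l))
        rw [Fintype.card_fin] at h6
        omega
    lift a to (Σ i, Fin (y i)) → ℕ using ha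
    beta_reduce at h1 h2
    push_cast at h1
    refine ⟨fun i k => a ⟨i, k⟩, ?_, rfl⟩
    simp only [Set.mem_ofPred_eq, draconianSeqs, Finset.mem_filter,
      Finset.Nat.mem_antidiagonalTuple]
    refine ⟨?_, fun S hS => ?_⟩
    · rw [← Fintype.sum_sigma]
      zify
      linarith
    · rw [← Finset.sum_sigma S (fun _ => Finset.univ) a]
      rcases (S.sigma fun i => (Finset.univ : Finset (Fin (y i)))).eq_empty_or_nonempty
        with h3 | h3
      · rw [h3, Finset.sum_empty, zero_add]
        obtain ⟨i, hi⟩ := hS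
        obtain ⟨r, hr⟩ := hI i
        exact Finset.card_pos.2 ⟨r, Finset.mem_biUnion.2 ⟨i, hi, hr⟩⟩
      · have h4 := h2 _ (Finset.subset_univ _) h3
        rw [hnbr] at h4
        have h5 : ((S.sigma fun i => (Finset.univ : Finset (Fin (y i)))).image
            Sigma.fst).biUnion I ⊆ S.biUnion I := by
          apply Finset.biUnion_subset_biUnion_of_subset_left
          intro i hi
          simp only [Finset.mem_image, Finset.mem_sigma] at hi
          obtain ⟨x, hx, rfl⟩ := hi
          exact hx.1
        have h6 := Finset.card_le_card h5
        zify at h6 ⊢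
        linarith
  · rintro ⟨f, hf, rfl⟩
    simp only [Set.mem_ofPred_eq, draconianSeqs, Finset.mem_filter,
      Finset.Nat.mem_antidiagonalTuple] at hf
    obtain ⟨h1, h2⟩ := hf
    refine ⟨by simp, ?_, fun S _ hS => ?_⟩
    · rw [Fintype.sum_sigma, Finset.card_univ, Fintype.card_fin]
      beta_reduce
      exact_mod_cast congrArg (· + 1) h1
    · have h3 := h2 _ (hS.image Sigma.fst)
      rw [hnbr]
      have h4 : ∑ l ∈ S, f l.1 l.2 ≤ ∑ i ∈ S.image Sigma.fst, ∑ k, f i k := by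
        rw [← Finset.sum_sigma (S.image Sigma.fst) (fun _ => Finset.univ)
          (fun l : Σ i, Fin (y i) => f l.1 l.2)]
        apply Finset.sum_le_sum_of_subset
        intro x hx
        exact Finset.mem_sigma.2 ⟨Finset.mem_image_of_mem _ hx, Finset.mem_univ _⟩
      have h5 := (Nat.add_le_add_right h4 1).trans h3
      beta_reduce
      exact_mod_cast h5

theorem ncard_hypertrees_copiesGraph {n : ℕ} {I : Fin m → Finset (Fin (n + 1))}
    (hI : ∀ i, (I i).Nonempty) :
    (hypertrees Finset.univ Finset.univ (copiesGraph I y)).ncard =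
      ∑ a ∈ draconianSeqs n m I, ∏ i, (y i + a i - 1).choose (a i) := by
  rw [hypertrees_copiesGraph_eq_image hI, Set.ncard_image_of_injective]
  · have h : {f : ∀ i, Fin (y i) → ℕ | (fun i => ∑ k, f i k) ∈ draconianSeqs n m I} =
        (((draconianSeqs n m I).biUnion fun a =>
          Fintype.piFinset fun i => Finset.piAntidiag Finset.univ (a i) :
            Finset (∀ i, Fin (y i) → ℕ)) : Set (∀ i, Fin (y i) → ℕ)) := by
      ext f
      simp [← funext_iff]
    rw [h, Set.ncard_coe_finset, Finset.card_biUnion]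
    · simp [Fintype.card_piFinset, card_piAntidiag_univ]
    · intro a _ a' _ hne
      rw [Function.onFun, Finset.disjoint_left]
      intro f hf hf'
      simp only [Fintype.mem_piFinset, Finset.mem_piAntidiag] at hf hf'
      exact hne (funext fun i => (hf i).1.symm.trans (hf' i).1)
  · intro f g h
    funext i k
    simpa using congrFun h ⟨i, k⟩

theorem ncard_trimmed_sum_simplices {n : ℕ} {I : Fin m → Finset (Fin (n + 1))}
    (hI : ∀ i, (I i).Nonempty) (y : Fin m → ℕ) :
    Set.ncard {b : Fin (n + 1) → ℤ |
        (fun i => (b i : ℝ)) ∈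
          trimmed (n + 1) (∑ i : Fin m, (y i : ℝ) • coordSimplex (n + 1) (I i))} =
      ∑ a ∈ draconianSeqs n m I, ∏ i, (y i + a i - 1).choose (a i) := by
  simp only [mem_trimmed_sum_simplices_iff hI]
  rw [← ncard_hypertrees_copiesGraph hI]
  exact (Set.ncard_congr' (nonempty_hypertrees_equiv_swap (copiesGraph I y) _ _).some).symm

end Permutohedron

theorem stmt9 (n m : ℕ) (I : Fin m → Finset (Fin (n + 1))) (hI : ∀ i, (I i).Nonempty)
    (hcov : Finset.univ.biUnion I = Finset.univ) (y : Fin m → ℕ) :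
    Set.ncard {b : Fin (n + 1) → ℤ |
        (fun i => (b i : ℝ)) ∈
          trimmed (n + 1) (∑ i : Fin m, (y i : ℝ) • coordSimplex (n + 1) (I i))} =
      (∑ a ∈ draconianSeqs n m I, ∏ i, (y i + a i - 1).choose (a i)) ∧
    Set.ncard {b : Fin (n + 1) → ℤ |
        (fun i => (b i : ℝ)) ∈ trimmed (n + 1) (∑ i : Fin m, coordSimplex (n + 1) (I i))} =
      (draconianSeqs n m I).card := by
  refine ⟨ncard_trimmed_sum_simplices hI y, ?_⟩
  simpa using ncard_trimmed_sum_simplices hI (fun _ => 1)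
end

section
/- Let m, n ≥ 1 and let I_1,…,I_m ⊆ [n] be nonempty subsets with I_1 ∪ ⋯ ∪ I_m = [n]. For j ∈ [n], define the dual subsets I*_j := {i ∈ [m] : j ∈ I_i} ⊆ [m]. Let P_G^− := {x ∈ ℝ^n : x + Δ_{[n]} ⊆ Δ_{I_1} + ⋯ + Δ_{I_m}} and P_{G*}^− := {x ∈ ℝ^m : x + Δ_{[m]} ⊆ Δ_{I*_1} + ⋯ + Δ_{I*_n}}, where in the second expression the simplices are taken in ℝ^m. Then the number of integer lattice points in P_G^− (points of P_G^− ∩ ℤ^n) equals the number of integer lattice points in P_{G*}^− (points of P_{G*}^− ∩ ℤ^m). -/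
open Pointwise

section Weights

variable {α β : Type*} [DecidableEq α] [DecidableEq β]

/-- An integral weight on the edges of the complete bipartite graph on `α ⊔ β` is generic if the
edges on which it is a sum of vertex potentials always form a forest. -/
def GenericWeight (w : α × β → ℤ) : Prop :=
  ∀ (E : Finset (α × β)) (u : α → ℤ) (v : β → ℤ), E.Nonempty →
    (∀ e ∈ E, u e.1 + v e.2 = w e) → E.card + 1 ≤ (E.image Prod.fst).card + (E.image Prod.snd).card

/-- The rational weights whose restriction to `E` is a sum of vertex potentials. -/
def potentialSubspace (E : Finset (α × β)) : Submodule ℚ (α × β → ℚ) where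
  carrier := {w | ∃ (u : α → ℚ) (v : β → ℚ), ∀ e ∈ E, u e.1 + v e.2 = w e}
  zero_mem' := ⟨0, 0, by simp⟩
  add_mem' := by
    rintro w w' ⟨u, v, h⟩ ⟨u', v', h'⟩
    refine ⟨u + u', v + v', fun e he => ?_⟩
    simp only [Pi.add_apply, ← h e he, ← h' e he]
    ring
  smul_mem' := by
    rintro c w ⟨u, v, h⟩
    refine ⟨c • u, c • v, fun e he => ?_⟩
    simp only [Pi.smul_apply, smul_eq_mul, ← h e he]
    ring

/-- The sum of vertex potentials as a function on the edges of `E`. -/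
def potentialSum (E : Finset (α × β)) :
    ((E.image Prod.fst → ℚ) × (E.image Prod.snd → ℚ)) →ₗ[ℚ] (E → ℚ) where
  toFun p e := p.1 ⟨e.1.1, Finset.mem_image_of_mem _ e.2⟩ +
    p.2 ⟨e.1.2, Finset.mem_image_of_mem _ e.2⟩
  map_add' p q := by ext; simp; ring
  map_smul' c p := by ext; simp; ring

lemma card_add_one_le_of_potentialSubspace_eq_top {E : Finset (α × β)} (hE : E.Nonempty)
    (h : potentialSubspace E = ⊤) :
    E.card + 1 ≤ (E.image Prod.fst).card + (E.image Prod.snd).card := by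
  have hsurj : Function.Surjective (potentialSum E) := by
    intro f
    have hf : (fun e => if he : e ∈ E then f ⟨e, he⟩ else 0) ∈ potentialSubspace E :=
      h ▸ Submodule.mem_top
    obtain ⟨u, v, huv⟩ := hf
    refine ⟨(fun i => u i, fun j => v j), ?_⟩
    ext ⟨e, he⟩
    simpa [he, potentialSum] using huv e he
  have hker : 0 < Module.finrank ℚ (LinearMap.ker (potentialSum E)) := by
    rw [Module.finrank_pos_iff_exists_ne_zero]
    refine ⟨⟨(fun _ => 1, fun _ => -1), ?_⟩, ?_⟩
    · ext e
      simp [potentialSum]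
    · obtain ⟨e, he⟩ := hE
      intro h0
      have h1 := congrFun (congrArg (fun p => p.1.1) h0) ⟨e.1, Finset.mem_image_of_mem _ he⟩
      simp at h1
  have hrank := LinearMap.finrank_range_add_finrank_ker (potentialSum E)
  rw [LinearMap.range_eq_top.mpr hsurj, finrank_top, Module.finrank_prod,
    Module.finrank_fintype_fun_eq_card, Module.finrank_fintype_fun_eq_card,
    Module.finrank_fintype_fun_eq_card, Fintype.card_coe, Fintype.card_coe,
    Fintype.card_coe] at hrank
  omega

lemma exists_genericWeight (α β : Type*) [Fintype α] [Fintype β] [DecidableEq α]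
    [DecidableEq β] : ∃ w : α × β → ℤ, GenericWeight w := by
  classical
  let s : Finset (Submodule ℚ (α × β → ℚ)) :=
    (Finset.univ.image potentialSubspace).filter (· ≠ ⊤)
  have hs : ⊤ ∉ s := by simp [s]
  obtain ⟨w, hw⟩ := (Set.ne_univ_iff_exists_notMem _).mp
    (Subspace.biUnion_ne_univ_of_top_notMem hs)
  obtain ⟨d, hd⟩ := IsLocalization.exist_integer_multiples_of_finite (nonZeroDivisors ℤ) w
  choose z hz using hd
  refine ⟨z, fun E u v hE huv => card_add_one_le_of_potentialSubspace_eq_top hE ?_⟩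
  by_contra hne
  refine hw (Set.mem_biUnion (x := potentialSubspace E) (by simp [s, hne]) ?_)
  have hd0 : ((d : ℤ) : ℚ) ≠ 0 := Int.cast_ne_zero.mpr (nonZeroDivisors.coe_ne_zero d)
  refine ⟨fun i => u i / (d : ℤ), fun j => v j / (d : ℤ), fun e he => ?_⟩
  have h1 : ((z e : ℤ) : ℚ) = (d : ℤ) * w e := by simpa using hz e
  rw [← add_div, div_eq_iff hd0, mul_comm, ← h1, ← huv e he]
  push_cast
  rfl

end Weights

section Cells

variable {α β : Type*} [DecidableEq β]

/-- The degree in `E` of a vertex `j` on the right side. -/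
def rightDegree (E : Finset (α × β)) (j : β) : ℕ := (E.filter (fun e => e.2 = j)).card

lemma sum_rightDegree (E : Finset (α × β)) (S : Finset β) :
    ∑ j ∈ S, rightDegree E j = (E.filter (fun e => e.2 ∈ S)).card := by
  have hmaps : ∀ e ∈ E.filter (fun e => e.2 ∈ S), e.2 ∈ S := by simp
  rw [Finset.card_eq_sum_card_fiberwise hmaps]
  refine Finset.sum_congr rfl fun j hj => ?_
  rw [rightDegree, Finset.filter_filter]
  congr 1
  ext e
  simp only [Finset.mem_filter]
  grind

lemma sum_univ_rightDegree [Fintype β] (E : Finset (α × β)) :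
    ∑ j, rightDegree E j = E.card := by
  simp [sum_rightDegree]

/-- The vertex potentials `u`, `v` are dominated by `w` on the edges of the graph `r`. -/
def FeasiblePotential (r : α → β → Prop) (w : α × β → ℤ) (u : α → ℤ) (v : β → ℤ) : Prop :=
  ∀ i j, r i j → u i + v j ≤ w (i, j)

/-- `E` is the set of tight edges of a feasible potential. -/
def IsTightSet (r : α → β → Prop) (w : α × β → ℤ) (u : α → ℤ) (v : β → ℤ)
    (E : Finset (α × β)) : Prop :=
  FeasiblePotential r w u v ∧ ∀ e, e ∈ E ↔ r e.1 e.2 ∧ u e.1 + v e.2 = w e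

/-- The spanning trees of `r` that are sets of tight edges: for generic `w`, the maximal cells of
the regular triangulation of the root polytope of `r` induced by `w`. -/
def IsTreeCell [Fintype α] [Fintype β] (r : α → β → Prop) (w : α × β → ℤ)
    (E : Finset (α × β)) : Prop :=
  (∃ u v, IsTightSet r w u v E) ∧ E.card + 1 = Fintype.card α + Fintype.card β

variable [DecidableEq α]

lemma GenericWeight.sum_rightDegree_add_one_le {w : α × β → ℤ} (hw : GenericWeight w)
    {u : α → ℤ} {v : β → ℤ} {E : Finset (α × β)} (hE : ∀ e ∈ E, u e.1 + v e.2 = w e)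
    {A : Finset α} {B : Finset β} (hAB : 1 ≤ A.card + B.card)
    (h : ∀ e ∈ E, e.2 ∈ B → e.1 ∈ A) :
    ∑ j ∈ B, rightDegree E j + 1 ≤ A.card + B.card := by
  rw [sum_rightDegree]
  rcases (E.filter (fun e => e.2 ∈ B)).eq_empty_or_nonempty with h0 | h0
  · simpa [h0] using hAB
  · refine (hw _ u v h0 fun e he => hE e (Finset.mem_filter.mp he).1).trans ?_
    gcongr
    · intro i hi
      obtain ⟨e, he, rfl⟩ := Finset.mem_image.mp hi
      exact h e (Finset.mem_filter.mp he).1 (Finset.mem_filter.mp he).2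
    · intro j hj
      obtain ⟨e, he, rfl⟩ := Finset.mem_image.mp hj
      exact (Finset.mem_filter.mp he).2

variable [Fintype α] [Fintype β] {r : α → β → Prop} {w : α × β → ℤ}

lemma IsTreeCell.subset_of_rightDegree_eq (hw : GenericWeight w) {E E' : Finset (α × β)}
    (hE : IsTreeCell r w E) (hE' : IsTreeCell r w E') (hdeg : rightDegree E = rightDegree E') :
    E ⊆ E' := by
  obtain ⟨⟨u, v, hf, ht⟩, hc⟩ := hE
  obtain ⟨⟨u', v', hf', ht'⟩, hc'⟩ := hE'
  intro e he
  obtain ⟨hr, heq⟩ := (ht e).mp he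
  refine (ht' e).mpr ⟨hr, (hf' _ _ hr).antisymm ?_⟩
  by_contra! hlt
  let t := v e.2 - v' e.2
  let A : Finset α := Finset.univ.filter fun i => t ≤ u' i - u i
  let B : Finset β := Finset.univ.filter fun j => t ≤ v j - v' j
  have hB : e.2 ∈ B := by simp [B, t]
  have hA : e.1 ∈ Aᶜ := by
    have : u e.1 + v e.2 = w (e.1, e.2) := heq
    simp [A, t]
    omega
  have hApos := Finset.card_pos.mpr ⟨_, hA⟩
  have hBpos := Finset.card_pos.mpr ⟨_, hB⟩
  have h1 : ∑ j ∈ B, rightDegree E' j + 1 ≤ A.card + B.card := by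
    refine hw.sum_rightDegree_add_one_le (fun e he => ((ht' e).mp he).2) (by omega) ?_
    intro e he hj
    obtain ⟨hr, heq⟩ := (ht' e).mp he
    have hle : u e.1 + v e.2 ≤ w e := hf _ _ hr
    simp only [A, B, Finset.mem_filter, Finset.mem_univ, true_and] at hj ⊢
    omega
  have h2 : ∑ j ∈ Bᶜ, rightDegree E j + 1 ≤ Aᶜ.card + Bᶜ.card := by
    refine hw.sum_rightDegree_add_one_le (fun e he => ((ht e).mp he).2) (by omega) ?_
    intro e he hj
    obtain ⟨hr, heq⟩ := (ht e).mp he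
    have hle : u' e.1 + v' e.2 ≤ w e := hf' _ _ hr
    simp only [A, B, Finset.mem_compl, Finset.mem_filter, Finset.mem_univ, true_and] at hj ⊢
    omega
  have h3 := Finset.sum_add_sum_compl B (rightDegree E)
  rw [sum_univ_rightDegree] at h3
  rw [← hdeg] at h1
  have h4 := Finset.card_add_card_compl A
  have h5 := Finset.card_add_card_compl B
  omega

lemma IsTreeCell.rightDegree_pos (hw : GenericWeight w) [Nonempty α] {E : Finset (α × β)}
    (hE : IsTreeCell r w E) (j : β) : 0 < rightDegree E j := by
  obtain ⟨⟨u, v, hf, ht⟩, hc⟩ := hE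
  by_contra! h0
  have hα : 0 < (Finset.univ : Finset α).card := Finset.card_pos.mpr Finset.univ_nonempty
  have h1 := hw.sum_rightDegree_add_one_le (A := Finset.univ) (B := {j}ᶜ)
    (fun e he => ((ht e).mp he).2) (by omega) (by simp)
  have h2 := Finset.sum_add_sum_compl {j} (rightDegree E)
  rw [sum_univ_rightDegree, Finset.sum_singleton] at h2
  have h3 := Finset.card_add_card_compl ({j} : Finset β)
  rw [Finset.card_singleton] at h3
  rw [Finset.card_univ] at h1
  omega

/-- If all the shifts of `b` by a unit vector satisfy the weak duality bound, then `b` is the vector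
of right degrees, reduced by one, of a tree cell. -/
lemma exists_isTreeCell (hw : GenericWeight w) [Nonempty β] {b : β → ℤ} {W : ℤ}
    (hsum : ∑ j, b j + 1 = Fintype.card α)
    (hbound : ∀ u v, FeasiblePotential r w u v → ∀ k, ∑ i, u i + ∑ j, b j * v j + v k ≤ W) :
    ∃ E, IsTreeCell r w E ∧ ∀ j, (rightDegree E j : ℤ) = b j + 1 := by
  classical
  let Φ : (α → ℤ) → (β → ℤ) → ℤ := fun u v =>
    Fintype.card β * (∑ i, u i) + ∑ j, (Fintype.card β * b j + 1) * v j
  obtain ⟨M, ⟨u, v, hf, hM⟩, hmax⟩ := Int.exists_greatest_of_bdd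
    (P := fun z => ∃ u v, FeasiblePotential r w u v ∧ Φ u v = z)
    ⟨Fintype.card β * W, by
      rintro _ ⟨u, v, hf, rfl⟩
      have h := Finset.sum_le_sum fun k (_ : k ∈ Finset.univ) => hbound u v hf k
      simp only [Finset.sum_add_distrib, Finset.sum_const, Finset.card_univ, nsmul_eq_mul] at h
      refine le_trans (le_of_eq ?_) h
      simp only [Φ, add_mul, one_mul, Finset.sum_add_distrib, mul_assoc, Finset.mul_sum]
      ring⟩
    ⟨_, fun _ => -∑ e, |w e|, 0, fun i j _ => by
      have h1 := Finset.single_le_sum (fun e _ => abs_nonneg (w e)) (Finset.mem_univ (i, j))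
      have h2 := neg_abs_le (w (i, j))
      simp only [Pi.zero_apply, add_zero]
      linarith, rfl⟩
  let E : Finset (α × β) := Finset.univ.filter fun e => r e.1 e.2 ∧ u e.1 + v e.2 = w e
  have hE : ∀ e, e ∈ E ↔ r e.1 e.2 ∧ u e.1 + v e.2 = w e := by simp [E]
  have hn : 0 < Fintype.card β := Fintype.card_pos
  have hdeg : ∀ k, b k + 1 ≤ rightDegree E k := by
    intro k
    let u' : α → ℤ := fun i => u i - if (i, k) ∈ E then 1 else 0
    let v' : β → ℤ := fun j => v j + if j = k then 1 else 0
    have hf' : FeasiblePotential r w u' v' := by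
      intro i j hij
      have h1 := hf i j hij
      have h2 := hE (i, j)
      simp only [u', v']
      grind
    have hcount : ∑ i, (if (i, k) ∈ E then (1 : ℤ) else 0) = rightDegree E k := by
      rw [Finset.sum_boole, rightDegree]
      congr 1
      refine Finset.card_bij (fun i _ => (i, k)) (by simp) (by simp) ?_
      rintro ⟨i, j⟩ h
      obtain ⟨h1, rfl⟩ := Finset.mem_filter.mp h
      exact ⟨i, by simpa using h1, rfl⟩
    have hΦ : Φ u' v' = Φ u v - Fintype.card β * rightDegree E k + (Fintype.card β * b k + 1) := by
      simp only [Φ, u', v', Finset.sum_sub_distrib, hcount, mul_add, Finset.sum_add_distrib,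
        mul_ite, mul_one, mul_zero, Finset.sum_ite_eq', Finset.mem_univ, if_true]
      ring
    have hle := hmax _ ⟨u', v', hf', rfl⟩
    rw [hΦ, hM] at hle
    by_contra! hlt
    have : (rightDegree E k : ℤ) ≤ b k := by omega
    nlinarith
  have htotal : (∑ j, (rightDegree E j : ℤ)) = E.card := by
    exact_mod_cast sum_univ_rightDegree E
  have hforest := hw.sum_rightDegree_add_one_le (A := Finset.univ) (B := Finset.univ)
    (fun e he => ((hE e).mp he).2) (by simp only [Finset.card_univ]; omega) (by simp)
  rw [sum_univ_rightDegree, Finset.card_univ, Finset.card_univ] at hforest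
  have hsum' : ∑ j, (b j + 1) = Fintype.card α - 1 + Fintype.card β := by
    simp [Finset.sum_add_distrib, ← hsum]
  have hle := Finset.sum_le_sum fun j (_ : j ∈ Finset.univ) => hdeg j
  refine ⟨E, ⟨⟨u, v, hf, hE⟩, by omega⟩, fun j => ?_⟩
  exact ((Finset.sum_eq_sum_iff_of_le fun j _ => hdeg j).mp (by omega) j (Finset.mem_univ j)).symm

/-- The right degrees of a tree cell, reduced by one except at `k`, count the edges assigned to each
right vertex by an assignment of an incident edge to each left vertex. -/
lemma IsTreeCell.exists_assignment (hw : GenericWeight w) [Nonempty α] {E : Finset (α × β)}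
    (hE : IsTreeCell r w E) (k : β) :
    ∃ g : α → β, (∀ i, r i (g i)) ∧ ∀ j,
      (Finset.univ.filter fun i => g i = j).card + 1 = rightDegree E j + if j = k then 1 else 0 := by
  classical
  have hpos := hE.rightDegree_pos hw
  obtain ⟨⟨u, v, hf, ht⟩, hc⟩ := hE
  let c : β → ℕ := fun j => rightDegree E j - 1 + if j = k then 1 else 0
  have hc1 : ∀ j, c j + 1 = rightDegree E j + if j = k then 1 else 0 := by
    intro j
    have := hpos j
    simp only [c]
    omega
  have hcsum : ∀ S : Finset β, ∑ j ∈ S, c j + S.card = ∑ j ∈ S, rightDegree E j +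
      if k ∈ S then 1 else 0 := by
    intro S
    have h := Finset.sum_congr rfl fun j (_ : j ∈ S) => hc1 j
    simpa [Finset.sum_add_distrib] using h
  let N : (Σ j, Fin (c j)) → Finset α := fun x => Finset.univ.filter fun i => (i, x.1) ∈ E
  have hall : ∀ s : Finset (Σ j, Fin (c j)), s.card ≤ (s.biUnion N).card := by
    intro s
    rcases s.eq_empty_or_nonempty with rfl | hs
    · simp
    let S := s.image Sigma.fst
    have hS : 0 < S.card := Finset.card_pos.mpr (hs.image _)
    have h1 : s.card ≤ ∑ j ∈ S, c j := by
      have : s ⊆ S.sigma fun _ => Finset.univ := fun x hx =>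
        Finset.mem_sigma.mpr ⟨Finset.mem_image_of_mem _ hx, Finset.mem_univ _⟩
      simpa using Finset.card_le_card this
    have h2 := hw.sum_rightDegree_add_one_le (A := s.biUnion N) (B := S)
      (fun e he => ((ht e).mp he).2) (by omega) (by
        intro e he hj
        obtain ⟨x, hx, hxe⟩ := Finset.mem_image.mp hj
        exact Finset.mem_biUnion.mpr ⟨x, hx, by simpa [N, hxe] using he⟩)
    have h3 := hcsum S
    split_ifs at h3 <;> omega
  obtain ⟨f, hinj, hmem⟩ := (Finset.all_card_le_biUnion_card_iff_exists_injective N).mp hall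
  have hcard : Fintype.card (Σ j, Fin (c j)) = Fintype.card α := by
    have h := hcsum Finset.univ
    rw [sum_univ_rightDegree, Finset.card_univ, if_pos (Finset.mem_univ k)] at h
    simp only [Fintype.card_sigma, Fintype.card_fin]
    omega
  let F := Equiv.ofBijective f ((Fintype.bijective_iff_injective_and_card f).mpr ⟨hinj, hcard⟩)
  have hF : ∀ x, F x = f x := fun _ => rfl
  refine ⟨fun i => (F.symm i).1, fun i => ?_, fun j => ?_⟩
  · have h := hmem (F.symm i)
    rw [← hF, F.apply_symm_apply] at h
    exact ((ht _).mp (Finset.mem_filter.mp h).2).1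
  · rw [← hc1]
    congr 1
    rw [← Fintype.card_fin (c j), ← Finset.card_univ]
    symm
    refine Finset.card_bij (fun y _ => F ⟨j, y⟩) (by simp) (fun y _ z _ h => ?_) fun i hi => ?_
    · simpa using h
    · obtain ⟨x, rfl⟩ := F.surjective i
      obtain ⟨j', y⟩ := x
      obtain rfl : j' = j := by simpa using hi
      exact ⟨y, Finset.mem_univ _, rfl⟩

end Cells

section LatticePoints

lemma coordSimplex_subset (n : ℕ) (I : Finset (Fin n)) :
    coordSimplex n I ⊆ {p | (∀ j, 0 ≤ p j) ∧ ∑ j, p j = 1 ∧ ∀ j ∉ I, p j = 0} := by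
  refine convexHull_min ?_ ?_
  · rintro _ ⟨i, hi, rfl⟩
    refine ⟨fun j => ?_, by simp [stdVec], fun j hj => ?_⟩
    · rw [stdVec]
      split_ifs <;> norm_num
    · rw [stdVec, if_neg]
      rintro rfl
      exact hj hi
  · rintro p ⟨hp0, hp1, hpI⟩ q ⟨hq0, hq1, hqI⟩ a b ha hb hab
    refine ⟨fun j => ?_, ?_, fun j hj => ?_⟩
    · exact add_nonneg (mul_nonneg ha (hp0 j)) (mul_nonneg hb (hq0 j))
    · simp [Finset.sum_add_distrib, ← Finset.mul_sum, hp1, hq1, hab]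
    · simp [hpI j hj, hqI j hj]

lemma stdVec_mem_coordSimplex {n : ℕ} {I : Finset (Fin n)} {i : Fin n} (hi : i ∈ I) :
    stdVec n i ∈ coordSimplex n I :=
  subset_convexHull ℝ _ ⟨i, hi, rfl⟩

lemma mem_trimmed_of_forall_add_stdVec_mem {n : ℕ} {P : Set (Fin n → ℝ)} (hP : Convex ℝ P)
    {x : Fin n → ℝ} (h : ∀ k, x + stdVec n k ∈ P) : x ∈ trimmed n P := by
  intro q hq
  refine convexHull_min (t := (fun z => x + z) ⁻¹' P) ?_ (hP.translate_preimage_right x) hq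
  rintro _ ⟨k, -, rfl⟩
  exact h k

/-- The integer points of the trimmed generalized permutohedron of the set family `I`. -/
def trimmedLatticePoints (n m : ℕ) (I : Fin m → Finset (Fin n)) : Set (Fin n → ℤ) :=
  {b | (fun k => (b k : ℝ)) ∈ trimmed n (∑ i : Fin m, coordSimplex n (I i))}

variable {n m : ℕ} {I : Fin m → Finset (Fin n)} {b : Fin n → ℤ}

/-- A fractional assignment realizing the shift of a trimmed lattice point by a unit vector. -/
lemma exists_fractional_assignment (hb : b ∈ trimmedLatticePoints n m I) (k : Fin n) :
    ∃ p : Fin m → Fin n → ℝ, (∀ i j, 0 ≤ p i j) ∧ (∀ i, ∑ j, p i j = 1) ∧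
      (∀ i, ∀ j ∉ I i, p i j = 0) ∧ ∀ j, ∑ i, p i j = b j + if j = k then 1 else 0 := by
  have h := hb _ (stdVec_mem_coordSimplex (Finset.mem_univ k))
  rw [Set.mem_fintype_sum] at h
  obtain ⟨p, hp, hsum⟩ := h
  have hp' := fun i => coordSimplex_subset n (I i) (hp i)
  refine ⟨p, fun i => (hp' i).1, fun i => (hp' i).2.1, fun i => (hp' i).2.2, fun j => ?_⟩
  have := congrFun hsum j
  simpa [stdVec] using this

lemma sum_add_one_eq_of_mem_trimmedLatticePoints (hn : 1 ≤ n)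
    (hb : b ∈ trimmedLatticePoints n m I) : ∑ j, b j + 1 = m := by
  obtain ⟨p, -, hp1, -, hpb⟩ := exists_fractional_assignment hb ⟨0, hn⟩
  have h : ∑ i, ∑ j, p i j = ∑ j, ∑ i, p i j := Finset.sum_comm
  simp only [hp1, hpb, Finset.sum_add_distrib, Finset.sum_ite_eq', Finset.mem_univ, if_true,
    Finset.sum_const, Finset.card_univ, Fintype.card_fin, nsmul_eq_mul, mul_one] at h
  exact_mod_cast h.symm

lemma FeasiblePotential.sum_le_of_mem_trimmedLatticePoints
    (hb : b ∈ trimmedLatticePoints n m I) {w : Fin m × Fin n → ℤ} {u : Fin m → ℤ}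
    {v : Fin n → ℤ} (huv : FeasiblePotential (fun i j => j ∈ I i) w u v) (k : Fin n) :
    ∑ i, u i + ∑ j, b j * v j + v k ≤ ∑ e, |w e| := by
  obtain ⟨p, hp0, hp1, hpI, hpb⟩ := exists_fractional_assignment hb k
  have hple : ∀ i j, p i j ≤ 1 := fun i j =>
    (Finset.single_le_sum (fun j _ => hp0 i j) (Finset.mem_univ j)).trans (hp1 i).le
  have hterm : ∀ i j, p i j * (u i + v j) ≤ |(w (i, j) : ℝ)| := by
    intro i j
    by_cases hij : j ∈ I i
    · have h1 : (u i + v j : ℝ) ≤ w (i, j) := by exact_mod_cast huv i j hij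
      calc p i j * (u i + v j) ≤ p i j * |(w (i, j) : ℝ)| :=
            mul_le_mul_of_nonneg_left (h1.trans (le_abs_self _)) (hp0 i j)
        _ ≤ |(w (i, j) : ℝ)| := mul_le_of_le_one_left (abs_nonneg _) (hple i j)
    · simp [hpI i j hij]
  have hu : ∑ i, ∑ j, p i j * u i = ∑ i, (u i : ℝ) := by
    simp [← Finset.sum_mul, hp1]
  have hv : ∑ i, ∑ j, p i j * v j = ∑ j, (b j * v j : ℝ) + v k := by
    rw [Finset.sum_comm]
    simp [← Finset.sum_mul, hpb, add_mul, Finset.sum_add_distrib]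
  have h := Finset.sum_le_sum fun i (_ : i ∈ Finset.univ) =>
    Finset.sum_le_sum fun j (_ : j ∈ Finset.univ) => hterm i j
  simp only [mul_add, Finset.sum_add_distrib, hu, hv] at h
  rw [← Fintype.sum_prod_type' (fun i j => |(w (i, j) : ℝ)|), ← add_assoc] at h
  exact_mod_cast h

lemma IsTreeCell.rightDegree_sub_one_mem_trimmedLatticePoints (hm : 1 ≤ m)
    {w : Fin m × Fin n → ℤ} (hw : GenericWeight w) {E : Finset (Fin m × Fin n)}
    (hE : IsTreeCell (fun i j => j ∈ I i) w E) :
    (fun j => (rightDegree E j : ℤ) - 1) ∈ trimmedLatticePoints n m I := by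
  have : Nonempty (Fin m) := ⟨⟨0, hm⟩⟩
  refine mem_trimmed_of_forall_add_stdVec_mem
    (convex_sum _ fun i _ => convex_convexHull ℝ _) fun k => ?_
  obtain ⟨g, hg, hcount⟩ := hE.exists_assignment hw k
  rw [Set.mem_fintype_sum]
  refine ⟨fun i => stdVec n (g i), fun i => stdVec_mem_coordSimplex (hg i), ?_⟩
  ext j
  have h : ((Finset.univ.filter fun i => g i = j).card : ℝ) + 1 =
      rightDegree E j + if j = k then 1 else 0 := by exact_mod_cast hcount j
  simp only [Finset.sum_apply, stdVec, Pi.add_apply, eq_comm (a := j) (b := g _),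
    Finset.sum_boole]
  push_cast
  linarith

lemma ncard_trimmedLatticePoints (hn : 1 ≤ n) (hm : 1 ≤ m) {w : Fin m × Fin n → ℤ}
    (hw : GenericWeight w) :
    (trimmedLatticePoints n m I).ncard = {E | IsTreeCell (fun i j => j ∈ I i) w E}.ncard := by
  have : Nonempty (Fin n) := ⟨⟨0, hn⟩⟩
  symm
  refine Set.ncard_congr (fun E _ j => (rightDegree E j : ℤ) - 1)
    (fun E hE => IsTreeCell.rightDegree_sub_one_mem_trimmedLatticePoints hm hw hE) ?_ ?_
  · intro E E' hE hE' h
    have hdeg : rightDegree E = rightDegree E' := by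
      ext j
      simpa using congrFun h j
    exact (IsTreeCell.subset_of_rightDegree_eq hw hE hE' hdeg).antisymm
      (IsTreeCell.subset_of_rightDegree_eq hw hE' hE hdeg.symm)
  · intro b hb
    obtain ⟨E, hE, hdeg⟩ := exists_isTreeCell (r := fun i j => j ∈ I i) hw
      (by simpa using sum_add_one_eq_of_mem_trimmedLatticePoints hn hb)
      fun u v huv k => huv.sum_le_of_mem_trimmedLatticePoints hb k
    exact ⟨E, hE, funext fun j => by simp [hdeg]⟩

end LatticePoints

section Duality

variable {α β : Type*}

lemma GenericWeight.swap [DecidableEq α] [DecidableEq β] {w : α × β → ℤ} (hw : GenericWeight w) :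
    GenericWeight (fun e : β × α => w e.swap) := by
  intro E u v hE huv
  have h := hw (E.map (Equiv.prodComm β α).toEmbedding) v u (by simpa using hE) (by
    intro e he
    rw [add_comm]
    exact huv e.swap (Finset.mem_map_equiv.mp he))
  have h1 : (E.map (Equiv.prodComm β α).toEmbedding).image Prod.fst = E.image Prod.snd := by
    ext; simp
  have h2 : (E.map (Equiv.prodComm β α).toEmbedding).image Prod.snd = E.image Prod.fst := by
    ext; simp
  rw [Finset.card_map, h1, h2] at h
  omega

lemma IsTreeCell.swap [Fintype α] [Fintype β] {r : α → β → Prop} {w : α × β → ℤ}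
    {E : Finset (α × β)} (hE : IsTreeCell r w E) :
    IsTreeCell (fun j i => r i j) (fun e : β × α => w e.swap)
      (E.map (Equiv.prodComm α β).toEmbedding) := by
  obtain ⟨⟨u, v, hf, ht⟩, hc⟩ := hE
  refine ⟨⟨v, u, fun j i hij => ?_, fun e => ?_⟩, ?_⟩
  · rw [add_comm]
    exact hf i j hij
  · rw [Finset.mem_map_equiv, add_comm (v e.1)]
    exact ht e.swap
  · rw [Finset.card_map, add_comm (Fintype.card β)]
    exact hc

lemma ncard_isTreeCell_swap [Fintype α] [Fintype β] (r : α → β → Prop) (w : α × β → ℤ) :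
    {E | IsTreeCell r w E}.ncard =
      {E | IsTreeCell (fun j i => r i j) (fun e : β × α => w e.swap) E}.ncard := by
  refine Set.ncard_congr (fun E _ => E.map (Equiv.prodComm α β).toEmbedding)
    (fun E hE => IsTreeCell.swap hE) (fun E E' _ _ h => Finset.map_injective _ h) ?_
  intro E hE
  refine ⟨E.map (Equiv.prodComm β α).toEmbedding, IsTreeCell.swap hE, ?_⟩
  ext e
  simp [Finset.mem_map_equiv]

end Duality

theorem stmt10 (n m : ℕ) (hn : 1 ≤ n) (hm : 1 ≤ m)
    (I : Fin m → Finset (Fin n)) (hI : ∀ i, (I i).Nonempty)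
    (hcov : Finset.univ.biUnion I = Finset.univ) :
    Set.ncard {b : Fin n → ℤ |
        (fun k => (b k : ℝ)) ∈ trimmed n (∑ i : Fin m, coordSimplex n (I i))} =
      Set.ncard {b : Fin m → ℤ |
        (fun k => (b k : ℝ)) ∈
          trimmed m (∑ j : Fin n,
            coordSimplex m (Finset.univ.filter fun i : Fin m => j ∈ I i))} := by
  obtain ⟨w, hw⟩ := exists_genericWeight (Fin m) (Fin n)
  have h1 := ncard_trimmedLatticePoints (I := I) hn hm hw
  have h2 := ncard_trimmedLatticePoints
    (I := fun j : Fin n => Finset.univ.filter fun i : Fin m => j ∈ I i) hm hn hw.swap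
  simp only [Finset.mem_filter, Finset.mem_univ, true_and] at h2
  exact h1.trans ((ncard_isTreeCell_swap _ w).trans h2.symm)
end
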